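/- arXiv:2201.08037 — 2 statements merged into one kernel-verified Lean document; each statement's English description precedes it below -/
import Mathlib

section
/- Let p be prime, A ⊆ 𝔽_p a set, and f_A(x) = A(x) − |A|/p its balanced function. Then Σ_l |Σ_x f_A(x) f_A(l x)|⁵ ≲ (E⁺(f_A))^{1/6} |A|^{11/2} + (Ē^×(f_A))^{1/2} |A|^{9/2}, where the sum over l is over all affine transformations x ↦ ax + b (a ∈ 𝔽_p*, b ∈ 𝔽_p) whose graph contains at least two points of A×A. -/
open scoped Classical Pointwise

noncomputable section

/-- Number of collinear `k`-tuples of points of `A × B`. -/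
def Ctuples (F : Type*) [Field F] (k : ℕ) (A B : Finset F) : ℕ :=
  ((Fintype.piFinset fun _ : Fin k => A ×ˢ B).filter fun f => Collinear F (Set.range f)).card

/-- Additive energy of two finite sets. -/
def addE (F : Type*) [Field F] (A B : Finset F) : ℕ :=
  (((A ×ˢ A) ×ˢ B ×ˢ B).filter fun q => q.1.1 - q.2.1 = q.1.2 - q.2.2).card

/-- Multiplicative energy of two finite sets. -/
def mulE (F : Type*) [Field F] (A B : Finset F) : ℕ :=
  (((A ×ˢ A) ×ˢ B ×ˢ B).filter fun q => q.1.1 * q.2.2 = q.1.2 * q.2.1).card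

/-- `max_s E^×(A - s)`. -/
def mulEbar (F : Type*) [Field F] (A : Finset F) : ℕ :=
  ⨆ s : F, mulE F (A.image fun a => a - s) (A.image fun a => a - s)

def repSub (F : Type*) [Field F] (A B : Finset F) (x : F) : ℕ :=
  ((A ×ˢ B).filter fun q => q.1 - q.2 = x).card

def addEk (F : Type*) [Field F] (k : ℕ) (A : Finset F) : ℕ :=
  ∑ x ∈ A - A, repSub F A A x ^ k

def repDiv (F : Type*) [Field F] (A B : Finset F) (x : F) : ℕ :=
  ((A ×ˢ B).filter fun q => q.2 ≠ 0 ∧ q.1 / q.2 = x).card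

def mulEk (F : Type*) [Field F] (k : ℕ) (A : Finset F) : ℕ :=
  ∑ x ∈ A / A, repDiv F A A x ^ k

def mulEkbar (F : Type*) [Field F] (k : ℕ) (A : Finset F) : ℕ :=
  ⨆ s : F, mulEk F k (A.image fun a => a - s)

/-- Number of points of `A × B` on the graph of `x ↦ l.1 * x + l.2`. -/
def nPts {F : Type*} [Field F] (A B : Finset F) (l : F × F) : ℕ :=
  ((A ×ˢ B).filter fun q => q.2 = l.1 * q.1 + l.2).card

/-- τ-rich lines of `𝓛`. -/
def Lrich {F : Type*} [Field F] (A B : Finset F) (L : Finset (F × F)) (τ : ℝ) : Finset (F × F) :=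
  L.filter fun l => τ ≤ (nPts A B l : ℝ)

def affMap {F : Type*} [Field F] (l : F × F) : F → F := fun x => l.1 * x + l.2

def affInv {F : Type*} [Field F] (l : F × F) : F → F := fun x => (x - l.2) / l.1

/-- alternating product `l₁ ∘ l₂⁻¹ ∘ l₃ ∘ l₄⁻¹ ∘ ⋯` in the affine group. -/
def altAff {F : Type*} [Field F] {k : ℕ} (a : Fin k → F × F) : F → F :=
  (List.ofFn fun i : Fin k => if (i : ℕ) % 2 = 0 then affMap (a i) else affInv (a i)).foldr
    (· ∘ ·) id

def TaffSet {F : Type*} [Field F] (k : ℕ) (L : Finset (F × F)) : ℕ :=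
  (((Fintype.piFinset fun _ : Fin k => L) ×ˢ Fintype.piFinset fun _ : Fin k => L).filter
    fun q => altAff q.1 = altAff q.2).card

def affEnergy {F : Type*} [Field F] (L : Finset (F × F)) : ℕ :=
  (((L ×ˢ L) ×ˢ L ×ˢ L).filter fun q =>
    affMap q.1.1 ∘ affInv q.1.2 = affMap q.2.1 ∘ affInv q.2.2).card

/-- incidences between `A × B` and the graphs of the maps in `L`. -/
def nInc {F : Type*} [Field F] (A B : Finset F) (L : Finset (F × F)) : ℕ :=
  (((A ×ˢ B) ×ˢ L).filter fun q => q.1.2 = q.2.1 * q.1.1 + q.2.2).card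

/-- balanced function of `A ⊆ 𝔽_p`. -/
def balanced {p : ℕ} [NeZero p] (A : Finset (ZMod p)) : ZMod p → ℝ :=
  fun x => (if x ∈ A then 1 else 0) - (A.card : ℝ) / p

def addEfun {p : ℕ} [NeZero p] (f : ZMod p → ℝ) : ℝ :=
  ∑ x, ∑ y, ∑ z, ∑ w, if x - y = z - w then f x * f y * f z * f w else 0

def mulEfun {p : ℕ} [NeZero p] (f : ZMod p → ℝ) : ℝ :=
  ∑ x, ∑ y, ∑ z, ∑ w, if x * w = z * y then f x * f y * f z * f w else 0

def mulEbarFun {p : ℕ} [NeZero p] (f : ZMod p → ℝ) : ℝ :=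
  ⨆ s : ZMod p, mulEfun fun x => f (x + s)

/-- a line in the plane: `inl (a,b)` is `y = a x + b`, `inr c` is `x = c`. -/
def onLine {F : Type*} [Field F] (l : (F × F) ⊕ F) (q : F × F) : Prop :=
  match l with
  | .inl ab => q.2 = ab.1 * q.1 + ab.2
  | .inr c => q.1 = c

def iLine {F : Type*} [Field F] (A B : Finset F) (l : (F × F) ⊕ F) : ℕ :=
  ((A ×ˢ B).filter fun q => onLine l q).card

def altSum {M : Type*} [AddCommGroup M] {k : ℕ} (x : Fin k → M) : M :=
  ∑ i : Fin k, if (i : ℕ) % 2 = 0 then x i else -x i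

def TaddSet {M : Type*} [AddCommGroup M] (k : ℕ) (A : Finset M) : ℕ :=
  (((Fintype.piFinset fun _ : Fin k => A) ×ˢ Fintype.piFinset fun _ : Fin k => A).filter
    fun q => altSum q.1 = altSum q.2).card

def TaddFun {p : ℕ} [NeZero p] (k : ℕ) (f : ZMod p → ℝ) : ℝ :=
  ∑ x : Fin k → ZMod p, ∑ y : Fin k → ZMod p,
    if altSum x = altSum y then (∏ i, f (x i)) * ∏ i, f (y i) else 0

def TaffFun {p : ℕ} [Fact p.Prime] (k : ℕ) (f : ZMod p × ZMod p → ℝ) : ℝ :=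
  ∑ a ∈ Fintype.piFinset fun _ : Fin k => (Finset.univ.filter fun l : ZMod p × ZMod p => l.1 ≠ 0),
    ∑ b ∈ Fintype.piFinset fun _ : Fin k => (Finset.univ.filter fun l : ZMod p × ZMod p => l.1 ≠ 0),
      if altAff a = altAff b then (∏ i, f (a i)) * ∏ i, f (b i) else 0

/-- `Ẽ^×_k (X, Y)`. -/
def tmulEk (F : Type*) [Field F] (k : ℕ) (X Y : Finset F) : ℕ :=
  (((Fintype.piFinset fun _ : Fin k => X.erase 0) ×ˢ
      Fintype.piFinset fun _ : Fin k => Y.erase 0).filter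
    fun q => ∀ i j : Fin k, q.1 i * q.2 j = q.1 j * q.2 i).card

def addEkG {G : Type*} [AddCommGroup G] (k : ℕ) (A : Finset G) : ℕ :=
  ∑ x ∈ A - A, (((A ×ˢ A).filter fun q => q.1 - q.2 = x).card) ^ k

end

namespace MvPolynomial

section Degree

variable {σ K : Type*} [Field K]

theorem degreeOf_le_of_dvd {P Q : MvPolynomial σ K} (i : σ) (h : P ∣ Q) (hQ : Q ≠ 0) :
    degreeOf i P ≤ degreeOf i Q := by
  obtain ⟨R, rfl⟩ := h
  rw [degreeOf_mul_eq (left_ne_zero_of_mul hQ) (right_ne_zero_of_mul hQ)]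
  exact Nat.le_add_right _ _

theorem degreeOf_pderiv_le (i j : σ) (P : MvPolynomial σ K) :
    degreeOf j (pderiv i P) ≤ degreeOf j P := by
  rw [degreeOf_le_iff]
  intro m hm
  rw [mem_support_iff, coeff_pderiv] at hm
  have : m + Finsupp.single i 1 ∈ P.support := by
    rw [mem_support_iff]; exact left_ne_zero_of_mul hm
  refine le_trans ?_ (degreeOf_le_iff.1 le_rfl _ this)
  simp

theorem degreeOf_pderiv_lt (i : σ) (P : MvPolynomial σ K) (h : 0 < degreeOf i P) :
    degreeOf i (pderiv i P) < degreeOf i P := by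
  rw [degreeOf_lt_iff h]
  intro m hm
  rw [mem_support_iff, coeff_pderiv] at hm
  have : m + Finsupp.single i 1 ∈ P.support := by
    rw [mem_support_iff]; exact left_ne_zero_of_mul hm
  refine lt_of_lt_of_le ?_ (degreeOf_le_iff.1 le_rfl _ this)
  simp

theorem pderiv_ne_zero_of_degreeOf_lt (p : ℕ) [CharP K p] (i : σ) (P : MvPolynomial σ K)
    (h : 0 < degreeOf i P) (hp : degreeOf i P < p) : pderiv i P ≠ 0 := by
  obtain ⟨m, hm, hmd⟩ : ∃ m ∈ P.support, m i = degreeOf i P := by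
    rw [degreeOf_eq_sup]
    obtain ⟨m, hm, h'⟩ := Finset.exists_mem_eq_sup P.support
      (Finset.nonempty_iff_ne_empty.2 (by rintro h0; simp [support_eq_empty.1 h0] at h))
      (fun m => m i)
    exact ⟨m, hm, h'.symm⟩
  intro h0
  have := coeff_pderiv (i := i) P (m - Finsupp.single i 1)
  rw [h0, coeff_zero] at this
  have h1 : Finsupp.single i 1 ≤ m := by
    rw [Finsupp.single_le_iff]; omega
  rw [tsub_add_cancel_of_le h1] at this
  have h2 : (((m - Finsupp.single i 1 : σ →₀ ℕ) i : K) + 1) = ((m i : ℕ) : K) := by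
    have : (m - Finsupp.single i 1 : σ →₀ ℕ) i + 1 = m i := by
      have := Finsupp.single_le_iff.1 h1
      simp only [Finsupp.coe_tsub, Pi.sub_apply, Finsupp.single_eq_same]; omega
    exact_mod_cast congrArg (Nat.cast (R := K)) this
  rw [h2, eq_comm, mul_eq_zero] at this
  rcases this with h3 | h3
  · exact (mem_support_iff.1 hm) h3
  · rw [CharP.cast_eq_zero_iff K p] at h3
    have := Nat.le_of_dvd (by omega) h3
    omega

theorem derivative_aeval {A : Type*} [CommRing A] [Algebra K A] [Fintype σ]
    (g : σ → Polynomial A) (P : MvPolynomial σ K) :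
    Polynomial.derivative (aeval g P) =
      ∑ i, aeval g (pderiv i P) * Polynomial.derivative (g i) := by
  induction P using MvPolynomial.induction_on with
  | C a =>
    rw [aeval_C, Polynomial.algebraMap_apply, Polynomial.derivative_C]
    simp
  | add P Q hP hQ =>
    rw [map_add, Polynomial.derivative_add, hP, hQ, ← Finset.sum_add_distrib]
    refine Finset.sum_congr rfl fun i _ => ?_
    rw [map_add, map_add, add_mul]
  | mul_X P n hP =>
    have h : ∀ i, aeval g (pderiv i (P * X n)) * Polynomial.derivative (g i) =
        aeval g (pderiv i P) * Polynomial.derivative (g i) * g n +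
          (if i = n then aeval g P * Polynomial.derivative (g n) else 0) := by
      intro i
      rw [Derivation.leibniz, map_add, smul_eq_mul, smul_eq_mul, map_mul, map_mul, aeval_X]
      split_ifs with hi
      · subst hi
        rw [pderiv_X_self, map_one]; ring
      · rw [pderiv_X_of_ne (Ne.symm hi), map_zero]; ring
    rw [map_mul, aeval_X, Polynomial.derivative_mul, hP, Finset.sum_congr rfl fun i _ => h i,
      Finset.sum_add_distrib, Finset.sum_mul]
    simp

theorem natDegree_aeval_le {A : Type*} [CommRing A] [IsDomain A] [Algebra K A] [Fintype σ]
    (g : σ → Polynomial A) (P : MvPolynomial σ K) :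
    (aeval g P).natDegree ≤ ∑ i, degreeOf i P * (g i).natDegree := by
  rw [aeval_def, eval₂_eq]
  refine Polynomial.natDegree_sum_le_of_forall_le _ _ fun m hm => ?_
  refine Polynomial.natDegree_mul_le.trans ?_
  rw [Polynomial.algebraMap_apply, Polynomial.natDegree_C, zero_add]
  refine (Polynomial.natDegree_prod_le _ _).trans ?_
  refine (Finset.sum_le_sum fun i _ => Polynomial.natDegree_pow_le).trans ?_
  refine (Finset.sum_le_univ_sum_of_nonneg fun i => Nat.zero_le _).trans ?_
  exact Finset.sum_le_sum fun i _ => Nat.mul_le_mul_right _ (degreeOf_le_iff.1 le_rfl _ hm)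

end Degree

section Box

variable {K : Type*} [Field K]

/-- Polynomials in three variables whose degree in the `i`-th variable is at most `m i`. -/
noncomputable def box (K : Type*) [Field K] (m : Fin 3 →₀ ℕ) : Submodule K (MvPolynomial (Fin 3) K) :=
  restrictSupport K (Set.Iic m)

theorem mem_box {m : Fin 3 →₀ ℕ} {P : MvPolynomial (Fin 3) K} :
    P ∈ box K m ↔ ∀ i, degreeOf i P ≤ m i := by
  simp only [box, mem_restrictSupport_iff, degreeOf_le_iff]
  constructor
  · intro h i s hs; exact h hs i
  · intro h s hs i; exact h i s hs

instance (m : Fin 3 →₀ ℕ) : FiniteDimensional K (box K m) :=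
  Module.Finite.of_basis (basisRestrictSupport K (Set.Iic m))

theorem card_Iic_fin_three (m : Fin 3 →₀ ℕ) :
    (Finset.Iic m).card = (m 0 + 1) * (m 1 + 1) * (m 2 + 1) := by
  rw [Finsupp.card_Iic, Finset.prod_subset (Finset.subset_univ _), Fin.prod_univ_three]
  · simp
  · intro i _ hi; simp [Finsupp.notMem_support_iff.1 hi]

theorem finrank_box (m : Fin 3 →₀ ℕ) :
    Module.finrank K (box K m) = (m 0 + 1) * (m 1 + 1) * (m 2 + 1) := by
  rw [← card_Iic_fin_three]
  have := Module.finrank_eq_card_basis (basisRestrictSupport K (Set.Iic m))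
  rw [show Module.finrank K (box K m) = _ from this]
  simp

end Box

variable {K : Type*} [Field K]

/-- The exponent vector `(a, b, c)`. -/
noncomputable def expo (a b c : ℕ) : Fin 3 →₀ ℕ := Finsupp.equivFunOnFinite.symm ![a, b, c]

@[simp] theorem expo_zero (a b c : ℕ) : expo a b c 0 = a := rfl
@[simp] theorem expo_one (a b c : ℕ) : expo a b c 1 = b := rfl
@[simp] theorem expo_two (a b c : ℕ) : expo a b c 2 = c := rfl

theorem mem_box_expo {a b c : ℕ} {P : MvPolynomial (Fin 3) K} :
    P ∈ box K (expo a b c) ↔ degreeOf 0 P ≤ a ∧ degreeOf 1 P ≤ b ∧ degreeOf 2 P ≤ c := by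
  rw [mem_box, Fin.forall_fin_succ, Fin.forall_fin_two]; rfl

theorem degreeOf_mul_add_mul_le {i : Fin 3} {U P V Q : MvPolynomial (Fin 3) K} {m u v : ℕ}
    (hU : degreeOf i U ≤ u) (hV : degreeOf i V ≤ v) (h₁ : u + degreeOf i P ≤ m)
    (h₂ : v + degreeOf i Q ≤ m) : degreeOf i (U * P + V * Q) ≤ m := by
  refine (degreeOf_add_le _ _ _).trans (max_le ?_ ?_)
  · exact (degreeOf_mul_le _ _ _).trans (by omega)
  · exact (degreeOf_mul_le _ _ _).trans (by omega)

/-- Elimination of the last variable from two coprime polynomials. -/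
theorem exists_elimination {P Q : MvPolynomial (Fin 3) K} (hP : Prime P)
    (hz : 0 < degreeOf 2 P) (hPQ : ¬ P ∣ Q) :
    ∃ U V W : MvPolynomial (Fin 3) K, U * P + V * Q = W ∧ W ≠ 0 ∧ degreeOf 2 W = 0 ∧
      degreeOf 1 W ≤ degreeOf 2 Q * degreeOf 1 P + degreeOf 2 P * degreeOf 1 Q := by
  have hQ0 : Q ≠ 0 := by rintro rfl; exact hPQ (dvd_zero _)
  rcases Nat.eq_zero_or_pos (degreeOf 2 Q) with hQz | hQz
  · refine ⟨0, 1, Q, by ring, hQ0, hQz, ?_⟩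
    nlinarith [Nat.zero_le (degreeOf 1 Q)]
  generalize hx : degreeOf 2 Q = x at *
  generalize hy : degreeOf 2 P = y at *
  generalize he : degreeOf 1 P = e at *
  generalize hf : degreeOf 1 Q = f at *
  generalize hg : degreeOf 0 P = g at *
  generalize hh : degreeOf 0 Q = h at *
  set M₁ := x * e + y * f with hM₁
  obtain ⟨α, hα⟩ : ∃ α, M₁ = α + e := ⟨M₁ - e, by
    have : e ≤ x * e := Nat.le_mul_of_pos_left _ hQz
    omega⟩
  obtain ⟨β, hβ⟩ : ∃ β, M₁ = β + f := ⟨M₁ - f, by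
    have : f ≤ y * f := Nat.le_mul_of_pos_left _ hz
    omega⟩
  obtain ⟨x, rfl⟩ : ∃ x', x = x' + 1 := ⟨x - 1, by omega⟩
  obtain ⟨y, rfl⟩ : ∃ y', y = y' + 1 := ⟨y - 1, by omega⟩
  set N := h + (x + 1) * g * (α + 1) + (y + 1) * h * (β + 1) with hN
  obtain ⟨N', hN'⟩ : ∃ N', N + g = N' + h :=
    ⟨(x + 1) * g * (α + 1) + (y + 1) * h * (β + 1) + g, by rw [hN]; ring⟩
  let Uspace := box K (expo N α x)
  let Vspace := box K (expo N' β y)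
  let I := Finset.Iic (expo (N + g) M₁ (x + y))
  let Φ : (Uspace × Vspace) →ₗ[K] (I → K) := LinearMap.pi fun s =>
    (lcoeff K ((s : Fin 3 →₀ ℕ) + Finsupp.single 2 1)).comp
      (((LinearMap.mulRight K P).comp Uspace.subtype).coprod
        ((LinearMap.mulRight K Q).comp Vspace.subtype))
  have hdim : Module.finrank K (I → K) < Module.finrank K (Uspace × Vspace) := by
    rw [Module.finrank_prod, finrank_box, finrank_box, Module.finrank_fintype_fun_eq_card,
      Fintype.card_coe, card_Iic_fin_three]
    simp only [expo_zero, expo_one, expo_two]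
    have e1 : M₁ = (x + 1) * e + (y + 1) * f := hM₁
    have e2 : (N : ℤ) = h + (x + 1) * g * (α + 1) + (y + 1) * h * (β + 1) := by exact_mod_cast hN
    have e3 : (N : ℤ) + g = N' + h := by exact_mod_cast hN'
    have e4 : (M₁ : ℤ) = (x + 1) * e + (y + 1) * f := by exact_mod_cast hM₁
    have e5 : (M₁ : ℤ) = α + e := by exact_mod_cast hα
    have e6 : (M₁ : ℤ) = β + f := by exact_mod_cast hβ
    zify
    have key : ((N : ℤ) + 1) * (α + 1) * (x + 1) + (N' + 1) * (β + 1) * (y + 1)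
        - (N + g + 1) * (M₁ + 1) * (x + y + 1) = g + h + 1 := by
      have h1 : (α : ℤ) = M₁ - e := by linarith
      have h2 : (β : ℤ) = M₁ - f := by linarith
      have h3 : (N' : ℤ) = N + g - h := by linarith
      have h4 : ((x : ℤ) + 1) * (α + 1) + (y + 1) * (β + 1) = (x + y + 2) * (M₁ + 1) - M₁ := by
        rw [h1, h2]; linear_combination e4
      rw [h3]
      linear_combination (N + g + 1) * h4 + e2
    have : (0 : ℤ) ≤ g := by positivity
    have : (0 : ℤ) ≤ h := by positivity
    linarith
  obtain ⟨⟨⟨U, hU⟩, ⟨V, hV⟩⟩, hker, hne⟩ :=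
    (Submodule.ne_bot_iff _).1 (LinearMap.ker_ne_bot_of_finrank_lt (f := Φ) hdim)
  rw [mem_box_expo] at hU hV
  have hcoeff : ∀ s ∈ I, coeff (s + Finsupp.single 2 1) (U * P + V * Q) = 0 := by
    intro s hs
    have := congrFun (LinearMap.mem_ker.1 hker) ⟨s, hs⟩
    simpa [Φ] using this
  have hd0 : degreeOf 0 (U * P + V * Q) ≤ N + g :=
    degreeOf_mul_add_mul_le hU.1 hV.1 (by omega) (by omega)
  have hd1 : degreeOf 1 (U * P + V * Q) ≤ M₁ :=
    degreeOf_mul_add_mul_le hU.2.1 hV.2.1 (by omega) (by omega)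
  have hd2 : degreeOf 2 (U * P + V * Q) ≤ x + y + 1 :=
    degreeOf_mul_add_mul_le hU.2.2 hV.2.2 (by omega) (by omega)
  refine ⟨U, V, _, rfl, ?_, ?_, hd1⟩
  · intro h0
    have hdvd : P ∣ V := by
      refine (hP.dvd_or_dvd (?_ : P ∣ V * Q)).resolve_right hPQ
      exact ⟨-U, by linear_combination h0⟩
    have hV0 : V = 0 := by
      by_contra hV0
      have := degreeOf_le_of_dvd 2 hdvd hV0
      omega
    have hU0 : U = 0 := by
      rw [hV0, zero_mul, add_zero, mul_eq_zero] at h0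
      exact h0.resolve_right hP.ne_zero
    subst hU0 hV0
    exact hne rfl
  · rw [← Nat.le_zero, degreeOf_le_iff]
    intro s hs
    by_contra hs2
    have h1 : Finsupp.single 2 1 ≤ s := by rw [Finsupp.single_le_iff]; omega
    refine mem_support_iff.1 hs ?_
    rw [← tsub_add_cancel_of_le h1]
    refine hcoeff _ ?_
    rw [Finset.mem_Iic]
    intro i
    have hs0 := degreeOf_le_iff.1 hd0 s hs
    have hs1 := degreeOf_le_iff.1 hd1 s hs
    have hs2 := degreeOf_le_iff.1 hd2 s hs
    fin_cases i
    · simpa using hs0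
    · simpa using hs1
    · simpa using hs2

theorem pderiv_pderiv_comm {σ : Type*} {i j : σ} (hij : i ≠ j) (P : MvPolynomial σ K) :
    pderiv i (pderiv j P) = pderiv j (pderiv i P) := by
  ext m
  rw [coeff_pderiv, coeff_pderiv, coeff_pderiv, coeff_pderiv, add_right_comm m]
  simp only [Finsupp.add_apply, Finsupp.single_apply, hij, hij.symm, if_false, add_zero]
  ring

/-- Restriction of a polynomial to the line `X₀ = a, X₂ = b X₁ + c` for `r = (a, b, c)`. -/
noncomputable def red (r : K × K × K) : MvPolynomial (Fin 3) K →ₐ[K] Polynomial K :=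
  aeval ![Polynomial.C r.1, Polynomial.X,
    Polynomial.C r.2.1 * Polynomial.X + Polynomial.C r.2.2]

/-- Restriction of a polynomial to the line `X₁ = v, X₂ = u X₀ + w` for `b = (v, u, w)`. -/
noncomputable def blue (b : K × K × K) : MvPolynomial (Fin 3) K →ₐ[K] Polynomial K :=
  aeval ![Polynomial.X, Polynomial.C b.1,
    Polynomial.C b.2.1 * Polynomial.X + Polynomial.C b.2.2]

/-- The lines indexed by `r` and `b` meet. -/
def Meets (r b : K × K × K) : Prop := r.2.1 * b.1 + r.2.2 = b.2.1 * r.1 + b.2.2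

theorem eval_aeval_polynomial {σ : Type*} (g : σ → Polynomial K) (y : K) (P : MvPolynomial σ K) :
    (aeval g P).eval y = eval (fun i => (g i).eval y) P := by
  have h : ((Polynomial.aeval y).comp (aeval g) : MvPolynomial σ K →ₐ[K] K) =
      aeval (fun i => (g i).eval y) := by
    ext i; simp
  have := DFunLike.congr_fun h P
  simpa [Polynomial.aeval_def, Polynomial.eval₂_eq_eval_map, aeval_eq_eval] using this

theorem eval_red (r : K × K × K) (y : K) (P : MvPolynomial (Fin 3) K) :
    (red r P).eval y = eval ![r.1, y, r.2.1 * y + r.2.2] P := by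
  rw [red, eval_aeval_polynomial]
  congr 2
  ext i
  fin_cases i <;> simp

theorem eval_blue (b : K × K × K) (x : K) (P : MvPolynomial (Fin 3) K) :
    (blue b P).eval x = eval ![x, b.1, b.2.1 * x + b.2.2] P := by
  rw [blue, eval_aeval_polynomial]
  congr 2
  ext i
  fin_cases i <;> simp

theorem Meets.eval_eq {r b : K × K × K} (h : Meets r b) (P : MvPolynomial (Fin 3) K) :
    (red r P).eval b.1 = (blue b P).eval r.1 := by
  rw [eval_red, eval_blue, h]

theorem natDegree_linear_le (u w : K) :
    (Polynomial.C u * Polynomial.X + Polynomial.C w).natDegree ≤ 1 :=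
  Polynomial.natDegree_linear_le

theorem natDegree_red_le (r : K × K × K) (P : MvPolynomial (Fin 3) K) :
    (red r P).natDegree ≤ degreeOf 1 P + degreeOf 2 P := by
  refine (natDegree_aeval_le _ P).trans ?_
  rw [Fin.sum_univ_three]
  have := Nat.mul_le_mul_left (degreeOf 2 P) (natDegree_linear_le r.2.1 r.2.2)
  simp only [Matrix.cons_val_zero, Matrix.cons_val_one, Matrix.cons_val, Polynomial.natDegree_C,
    Polynomial.natDegree_X]
  linarith

theorem natDegree_blue_le (r : K × K × K) (P : MvPolynomial (Fin 3) K) :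
    (blue r P).natDegree ≤ degreeOf 0 P + degreeOf 2 P := by
  refine (natDegree_aeval_le _ P).trans ?_
  rw [Fin.sum_univ_three]
  have := Nat.mul_le_mul_left (degreeOf 2 P) (natDegree_linear_le r.2.1 r.2.2)
  simp only [Matrix.cons_val_zero, Matrix.cons_val_one, Matrix.cons_val, Polynomial.natDegree_C,
    Polynomial.natDegree_X]
  linarith

theorem card_le_of_blue_ne_zero {b : K × K × K} {Q : MvPolynomial (Fin 3) K} (hb : blue b Q ≠ 0)
    {T : Finset (K × K × K)} (hT : ∀ r ∈ T, Meets r b ∧ red r Q = 0)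
    (hinj : Set.InjOn Prod.fst (T : Set (K × K × K))) :
    T.card ≤ degreeOf 0 Q + degreeOf 2 Q := by
  by_contra hlt
  push Not at hlt
  refine hb (Polynomial.eq_zero_of_natDegree_lt_card_of_eval_eq_zero' _ (T.image Prod.fst) ?_ ?_)
  · intro x hx
    obtain ⟨r, hr, rfl⟩ := Finset.mem_image.1 hx
    rw [← (hT r hr).1.eval_eq, (hT r hr).2, Polynomial.eval_zero]
  · rw [Finset.card_image_of_injOn hinj]
    exact (natDegree_blue_le b Q).trans_lt hlt

theorem eval_congr_of_degreeOf_eq_zero {W : MvPolynomial (Fin 3) K} (hW : degreeOf 2 W = 0)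
    (x y z z' : K) : eval ![x, y, z] W = eval ![x, y, z'] W := by
  refine eval₂Hom_congr' rfl (fun i hi _ => ?_) rfl
  rw [mem_vars_iff_degreeOf_ne_zero] at hi
  fin_cases i
  · rfl
  · rfl
  · exact absurd hW hi

theorem exists_coprime_prime_factors {F : MvPolynomial (Fin 3) K} (hF : F ≠ 0) :
    ∃ S : Finset (MvPolynomial (Fin 3) K), (∀ P ∈ S, Prime P) ∧
      (∀ P ∈ S, ∀ Q ∈ S, P ∣ Q → P = Q) ∧ (∏ P ∈ S, P) ∣ F ∧ ∃ n, F ∣ (∏ P ∈ S, P) ^ n := by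
  let _ : StrongNormalizationMonoid (MvPolynomial (Fin 3) K) :=
    UniqueFactorizationMonoid.strongNormalizationMonoid
  refine ⟨UniqueFactorizationMonoid.primeFactors F, ?_, ?_,
    UniqueFactorizationMonoid.radical_dvd_self,
    UniqueFactorizationMonoid.exists_dvd_radical_self_pow hF⟩
  · intro P hP
    exact UniqueFactorizationMonoid.prime_of_normalized_factor P
      (UniqueFactorizationMonoid.mem_primeFactors.1 hP)
  · intro P hP Q hQ h
    rw [UniqueFactorizationMonoid.mem_primeFactors] at hP hQ
    have h1 := (UniqueFactorizationMonoid.prime_of_normalized_factor P hP)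
    have h2 := (UniqueFactorizationMonoid.prime_of_normalized_factor Q hQ)
    have h3 : Associated P Q := h1.irreducible.associated_of_dvd h2.irreducible h
    have h4 := UniqueFactorizationMonoid.normalize_normalized_factor P hP
    have h5 := UniqueFactorizationMonoid.normalize_normalized_factor Q hQ
    rw [← h4, ← h5]
    exact normalize_eq_normalize_iff_associated.2 h3

variable [Infinite K]

theorem exists_eval_ne_zero {σ : Type*} {W : MvPolynomial σ K} (hW : W ≠ 0) :
    ∃ x, eval x W ≠ 0 := by
  by_contra! h
  exact hW (MvPolynomial.funext fun x => by rw [h, map_zero])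

theorem card_le_of_blue_eq_zero {W : MvPolynomial (Fin 3) K} (hW : W ≠ 0)
    (hW2 : degreeOf 2 W = 0) {S : Finset (K × K × K)} (hS : ∀ b ∈ S, blue b W = 0)
    (hinj : Set.InjOn Prod.fst (S : Set (K × K × K))) : S.card ≤ degreeOf 1 W := by
  obtain ⟨x, hx⟩ := exists_eval_ne_zero hW
  let ψ : Polynomial K := aeval ![Polynomial.C (x 0), Polynomial.X, Polynomial.C (x 2)] W
  have hψ : ∀ y, ψ.eval y = eval ![x 0, y, x 2] W := by
    intro y
    rw [eval_aeval_polynomial]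
    congr 2
    ext i
    fin_cases i <;> simp
  have hψ0 : ψ ≠ 0 := by
    intro h0
    have h1 := hψ (x 1)
    rw [h0, Polynomial.eval_zero] at h1
    refine hx ?_
    rw [h1]
    congr 2
    ext i
    fin_cases i <;> rfl
  have hdeg : ψ.natDegree ≤ degreeOf 1 W := by
    refine (natDegree_aeval_le _ W).trans ?_
    rw [Fin.sum_univ_three]
    simp
  by_contra! hlt
  refine hψ0 (Polynomial.eq_zero_of_natDegree_lt_card_of_eval_eq_zero' _ (S.image Prod.fst) ?_ ?_)
  · intro y hy
    obtain ⟨b, hb, rfl⟩ := Finset.mem_image.1 hy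
    rw [hψ, eval_congr_of_degreeOf_eq_zero hW2 _ _ _ (b.2.1 * x 0 + b.2.2), ← eval_blue, hS b hb,
      Polynomial.eval_zero]
  · rw [Finset.card_image_of_injOn hinj]
    omega

theorem card_le_of_blue_eq_zero_of_prime {P Q : MvPolynomial (Fin 3) K} (hP : Prime P)
    (hz : 0 < degreeOf 2 P) (hPQ : ¬ P ∣ Q) {S : Finset (K × K × K)}
    (hS : ∀ b ∈ S, blue b P = 0 ∧ blue b Q = 0)
    (hinj : Set.InjOn Prod.fst (S : Set (K × K × K))) :
    S.card ≤ degreeOf 2 Q * degreeOf 1 P + degreeOf 2 P * degreeOf 1 Q := by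
  obtain ⟨U, V, W, hUV, hW, hW2, hW1⟩ := exists_elimination hP hz hPQ
  refine (card_le_of_blue_eq_zero hW hW2 (fun b hb => ?_) hinj).trans hW1
  rw [← hUV, map_add, map_mul, map_mul, (hS b hb).1, (hS b hb).2, mul_zero, mul_zero, add_zero]

end MvPolynomial

theorem Polynomial.eq_zero_of_sq_mul_derivative_two {A : Type*} [CommRing A] [IsDomain A] (p : ℕ)
    [CharP A p] {φ B M S : Polynomial A} (hdeg : φ.natDegree < p) (h0 : φ.coeff 0 = 0)
    (h1 : φ.coeff 1 = 0) (hB : B.coeff 0 ≠ 0)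
    (h : B ^ 2 * derivative (derivative φ) = φ * M + derivative φ * S) : φ = 0 := by
  by_contra hφ
  obtain ⟨k, hk⟩ : ∃ k, φ.natTrailingDegree = k + 2 := by
    have ht : φ.coeff φ.natTrailingDegree ≠ 0 := by
      rwa [← trailingCoeff, Ne, trailingCoeff_eq_zero]
    refine ⟨φ.natTrailingDegree - 2, ?_⟩
    rcases hn : φ.natTrailingDegree with _ | _ | n
    · rw [hn] at ht; exact absurd h0 ht
    · rw [hn] at ht; exact absurd h1 ht
    · rfl
  have hlow : ∀ d < k + 2, φ.coeff d = 0 := fun d hd =>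
    coeff_eq_zero_of_lt_natTrailingDegree (by omega)
  have hk0 : φ.coeff (k + 2) ≠ 0 := by
    rwa [← hk, ← trailingCoeff, Ne, trailingCoeff_eq_zero]
  have hd1 : X ^ (k + 1) ∣ derivative φ := by
    rw [X_pow_dvd_iff]
    intro d hd
    rw [coeff_derivative, hlow (d + 1) (by omega), zero_mul]
  have hd0 : X ^ (k + 1) ∣ φ := by
    rw [X_pow_dvd_iff]
    intro d hd
    exact hlow d (by omega)
  have hdvd : X ^ (k + 1) ∣ B ^ 2 * derivative (derivative φ) := by
    rw [h]; exact dvd_add (hd0.mul_right _) (hd1.mul_right _)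
  have hd2 := prime_X.pow_dvd_of_dvd_mul_left (k + 1) (fun hX => hB
    (X_dvd_iff.1 (prime_X.dvd_of_dvd_pow hX))) hdvd
  have := X_pow_dvd_iff.1 hd2 k (Nat.lt_succ_self k)
  rw [coeff_derivative, coeff_derivative, mul_assoc, mul_eq_zero] at this
  have hlt : k + 2 < p := by
    rw [← hk]; exact (natTrailingDegree_le_natDegree φ).trans_lt hdeg
  rcases this with h2 | h2
  · exact hk0 h2
  · rw [mul_eq_zero] at h2
    have hc : ∀ m : ℕ, 0 < m → m < p → (m : A) ≠ 0 := fun m hm hmp h3 =>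
      absurd (Nat.le_of_dvd hm ((CharP.cast_eq_zero_iff A p m).1 h3)) (by omega)
    rcases h2 with h2 | h2
    · exact hc (k + 2) (by omega) (by omega) (by push_cast at h2 ⊢; linear_combination h2)
    · exact hc (k + 1) (by omega) (by omega) (by push_cast; exact h2)

namespace MvPolynomial

variable {K : Type*} [Field K]

/-- The second fundamental form of the level sets of `P` along the null direction of
`∂₀P dX₀ + ∂₂P dX₂`. -/
noncomputable def hess (P : MvPolynomial (Fin 3) K) : MvPolynomial (Fin 3) K :=
  pderiv 0 (pderiv 0 P) * pderiv 2 P ^ 2 - 2 * pderiv 2 (pderiv 0 P) * pderiv 0 P * pderiv 2 P +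
    pderiv 2 (pderiv 2 P) * pderiv 0 P ^ 2

theorem derivative_blue (b : K × K × K) (P : MvPolynomial (Fin 3) K) :
    Polynomial.derivative (blue b P) =
      blue b (pderiv 0 P) + Polynomial.C b.2.1 * blue b (pderiv 2 P) := by
  rw [blue, derivative_aeval, Fin.sum_univ_three]
  simp only [Matrix.cons_val_zero, Matrix.cons_val_one, Matrix.cons_val, Polynomial.derivative_X,
    Polynomial.derivative_C, Polynomial.derivative_add, Polynomial.derivative_C_mul]
  ring

theorem blue_hess {b : K × K × K} {P : MvPolynomial (Fin 3) K} (h : blue b P = 0) :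
    blue b (hess P) = 0 := by
  have h1 := derivative_blue b P
  rw [h, Polynomial.derivative_zero] at h1
  have h2 := congrArg Polynomial.derivative h1
  rw [Polynomial.derivative_zero, Polynomial.derivative_add, Polynomial.derivative_C_mul,
    derivative_blue, derivative_blue, pderiv_pderiv_comm (i := 0) (j := 2) (by decide)] at h2
  simp only [hess, map_add, map_sub, map_mul, map_pow, map_ofNat]
  generalize blue b (pderiv 0 P) = x at *
  generalize blue b (pderiv 2 P) = y at *
  generalize blue b (pderiv 0 (pderiv 0 P)) = x2 at *
  generalize blue b (pderiv 2 (pderiv 0 P)) = xy at *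
  generalize blue b (pderiv 2 (pderiv 2 P)) = y2 at *
  have hx : x = -Polynomial.C b.2.1 * y := by linear_combination -h1
  subst hx
  linear_combination -(y ^ 2) * h2

theorem degreeOf_hess_le (i : Fin 3) (P : MvPolynomial (Fin 3) K) :
    degreeOf i (hess P) ≤ 3 * degreeOf i P := by
  have hd : ∀ j (Q : MvPolynomial (Fin 3) K), degreeOf i (pderiv j Q) ≤ degreeOf i Q :=
    fun j Q => degreeOf_pderiv_le j i Q
  have h0 := hd 0 P
  have h2 := hd 2 P
  have h00 := (hd 0 (pderiv 0 P)).trans h0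
  have h20 := (hd 2 (pderiv 0 P)).trans h0
  have h22 := (hd 2 (pderiv 2 P)).trans h2
  have hm : ∀ (Q R : MvPolynomial (Fin 3) K) (m n : ℕ), degreeOf i Q ≤ m → degreeOf i R ≤ n →
      degreeOf i (Q * R) ≤ m + n := fun Q R m n hQ hR => (degreeOf_mul_le _ _ _).trans (by omega)
  generalize degreeOf i P = m at *
  have hsq : ∀ Q : MvPolynomial (Fin 3) K, degreeOf i Q ≤ m → degreeOf i (Q ^ 2) ≤ m + m :=
    fun Q hQ => by rw [sq]; exact hm _ _ _ _ hQ hQ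
  have hC : degreeOf i (2 : MvPolynomial (Fin 3) K) ≤ 0 := by
    have := degreeOf_C (2 : K) i
    rw [map_ofNat] at this
    exact this.le
  rw [hess]
  refine (degreeOf_add_le _ _ _).trans (max_le ((degreeOf_sub_le _ _ _).trans (max_le ?_ ?_)) ?_)
  · exact (hm _ _ _ _ h00 (hsq _ h2)).trans (by omega)
  · exact (hm _ _ _ _ (hm _ _ _ _ (hm _ _ _ _ hC h20) h0) h2).trans (by omega)
  · exact (hm _ _ _ _ h22 (hsq _ h0)).trans (by omega)

/-- Restriction to the ruled surface swept out by the lines through the points `(a, y, b y + c)`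
in the direction `(q, 0, -t)`. -/
noncomputable def sweep (r : K × K × K) (q t : Polynomial K) :
    MvPolynomial (Fin 3) K →ₐ[K] Polynomial (Polynomial K) :=
  aeval ![Polynomial.C (Polynomial.C r.1) + Polynomial.C q * Polynomial.X,
    Polynomial.C Polynomial.X,
    Polynomial.C (Polynomial.C r.2.1 * Polynomial.X + Polynomial.C r.2.2) -
      Polynomial.C t * Polynomial.X]

theorem coeff_zero_sweep (r : K × K × K) (q t : Polynomial K) (P : MvPolynomial (Fin 3) K) :
    (sweep r q t P).coeff 0 = red r P := by
  have h : (((Polynomial.aeval (0 : Polynomial K)).restrictScalars K).comp (sweep r q t) :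
      MvPolynomial (Fin 3) K →ₐ[K] Polynomial K) = red r := by
    ext1 i
    fin_cases i <;> simp [sweep, red]
  rw [Polynomial.coeff_zero_eq_aeval_zero, ← h]
  simp

theorem eval_eval_sweep (r : K × K × K) (q t : Polynomial K) (x y : K)
    (P : MvPolynomial (Fin 3) K) :
    ((sweep r q t P).eval (Polynomial.C x)).eval y =
      eval ![r.1 + q.eval y * x, y, r.2.1 * y + r.2.2 - t.eval y * x] P := by
  have h : ((Polynomial.aeval y).comp
      (((Polynomial.aeval (Polynomial.C x : Polynomial K)).restrictScalars K).comp
        (sweep r q t)) : MvPolynomial (Fin 3) K →ₐ[K] K) =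
      aeval ![r.1 + q.eval y * x, y, r.2.1 * y + r.2.2 - t.eval y * x] := by
    ext1 i
    fin_cases i <;> simp [sweep]
  have := DFunLike.congr_fun h P
  simpa [aeval_eq_eval] using this

theorem natDegree_sweep_le (r : K × K × K) (q t : Polynomial K) (P : MvPolynomial (Fin 3) K) :
    (sweep r q t P).natDegree ≤ degreeOf 0 P + degreeOf 2 P := by
  refine (natDegree_aeval_le _ P).trans ?_
  rw [Fin.sum_univ_three]
  have h0 : (Polynomial.C (Polynomial.C r.1) + Polynomial.C q * Polynomial.X).natDegree ≤ 1 := by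
    rw [add_comm]; exact Polynomial.natDegree_linear_le
  have h2 : (Polynomial.C (Polynomial.C r.2.1 * Polynomial.X + Polynomial.C r.2.2) -
      Polynomial.C t * Polynomial.X).natDegree ≤ 1 := by
    refine (Polynomial.natDegree_sub_le _ _).trans (max_le ?_ 
      ((Polynomial.natDegree_C_mul_le _ _).trans Polynomial.natDegree_X_le))
    rw [Polynomial.natDegree_C]; exact zero_le_one
  have h0' := Nat.mul_le_mul_left (degreeOf 0 P) h0
  have h2' := Nat.mul_le_mul_left (degreeOf 2 P) h2
  simp only [Matrix.cons_val_zero, Matrix.cons_val_one, Matrix.cons_val, Polynomial.natDegree_C]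
  linarith

theorem derivative_sweep (r : K × K × K) (q t : Polynomial K) (P : MvPolynomial (Fin 3) K) :
    Polynomial.derivative (sweep r q t P) =
      Polynomial.C q * sweep r q t (pderiv 0 P) - Polynomial.C t * sweep r q t (pderiv 2 P) := by
  rw [sweep, derivative_aeval, Fin.sum_univ_three]
  simp only [Matrix.cons_val_zero, Matrix.cons_val_one, Matrix.cons_val, Polynomial.derivative_X,
    Polynomial.derivative_C, Polynomial.derivative_add, Polynomial.derivative_sub,
    Polynomial.derivative_C_mul]
  ring

/-- The surface swept out by the lines of `sweep`. -/
noncomputable def sweepSurface (r : K × K × K) (q t : Polynomial K) : MvPolynomial (Fin 3) K :=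
  Polynomial.aeval (X 1) q * (X 2 - (C r.2.1 * X 1 + C r.2.2)) +
    Polynomial.aeval (X 1) t * (X 0 - C r.1)

theorem red_aeval_X_one (r : K × K × K) (q : Polynomial K) :
    red r (Polynomial.aeval (X 1) q) = q := by
  rw [← Polynomial.aeval_algHom_apply]
  simp [red]

theorem red_sweepSurface (r s : K × K × K) (q t : Polynomial K) :
    red s (sweepSurface r q t) =
      q * (Polynomial.C (s.2.1 - r.2.1) * Polynomial.X + Polynomial.C (s.2.2 - r.2.2)) +
        t * Polynomial.C (s.1 - r.1) := by
  rw [sweepSurface, map_add, map_mul, map_mul, red_aeval_X_one, red_aeval_X_one]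
  simp only [red, map_sub, map_add, map_mul, aeval_X, aeval_C, Matrix.cons_val_zero,
    Matrix.cons_val_one, Matrix.cons_val, Polynomial.algebraMap_eq]
  ring

theorem sweep_sweepSurface (r : K × K × K) (q t : Polynomial K) :
    sweep r q t (sweepSurface r q t) = 0 := by
  have h : ∀ s : Polynomial K, sweep r q t (Polynomial.aeval (X 1) s) = Polynomial.C s := by
    intro s
    rw [← Polynomial.aeval_algHom_apply]
    have : sweep r q t (X 1) = Polynomial.C Polynomial.X := by simp [sweep]
    rw [this]
    have h2 := Polynomial.aeval_algebraMap_apply (Polynomial (Polynomial K))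
      (Polynomial.X : Polynomial K) s
    rw [Polynomial.aeval_X_left_apply] at h2
    exact h2
  rw [sweepSurface, map_add, map_mul, map_mul, h, h]
  simp only [sweep, map_sub, map_add, map_mul, aeval_X, aeval_C, Matrix.cons_val_zero,
    Matrix.cons_val_one, Matrix.cons_val, Polynomial.algebraMap_apply, Polynomial.algebraMap_eq]
  ring

/-- A prime `P` dividing its second fundamental form and containing a line along which `∂₂P` does
not vanish is a ruled surface. -/
theorem dvd_sweepSurface [Infinite K] (p : ℕ) [CharP K p] {P : MvPolynomial (Fin 3) K}
    (hP : Prime P) (hz : 0 < degreeOf 2 P) (hdeg : degreeOf 0 P + degreeOf 2 P < p)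
    (hhess : P ∣ hess P) {r : K × K × K} (hr : red r P = 0) (hr2 : red r (pderiv 2 P) ≠ 0) :
    P ∣ sweepSurface r (red r (pderiv 2 P)) (red r (pderiv 0 P)) := by
  generalize hq : red r (pderiv 2 P) = q at *
  generalize ht : red r (pderiv 0 P) = t at *
  have hφ : sweep r q t P = 0 := by
    obtain ⟨Q, hQ⟩ := hhess
    have hH := congrArg (sweep r q t) hQ
    have e1 := derivative_sweep r q t P
    have e2 := congrArg Polynomial.derivative e1
    rw [Polynomial.derivative_sub, Polynomial.derivative_C_mul, Polynomial.derivative_C_mul,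
      derivative_sweep r q t (pderiv 0 P), derivative_sweep r q t (pderiv 2 P),
      pderiv_pderiv_comm (i := 0) (j := 2) (by decide)] at e2
    simp only [hess, map_add, map_sub, map_mul, map_pow, map_ofNat] at hH
    refine Polynomial.eq_zero_of_sq_mul_derivative_two p
      (B := sweep r q t (pderiv 2 P)) (M := Polynomial.C q ^ 2 * sweep r q t Q)
      (S := 2 * Polynomial.C q * sweep r q t (pderiv 2 (pderiv 0 P)) * sweep r q t (pderiv 2 P)
        - sweep r q t (pderiv 2 (pderiv 2 P)) * Polynomial.derivative (sweep r q t P)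
        - 2 * Polynomial.C t * sweep r q t (pderiv 2 P) * sweep r q t (pderiv 2 (pderiv 2 P)))
      ((natDegree_sweep_le _ _ _ _).trans_lt hdeg) ?_ ?_ ?_ ?_
    · rw [coeff_zero_sweep, hr]
    · have := congrArg (Polynomial.coeff · 0) e1
      simp only [Polynomial.coeff_derivative, Polynomial.coeff_sub, Polynomial.coeff_C_mul,
        coeff_zero_sweep, hq, ht] at this
      push_cast at this
      linear_combination this
    · rw [coeff_zero_sweep, hq]; exact hr2
    · rw [e2, e1]
      generalize sweep r q t (pderiv 0 P) = A at *
      generalize sweep r q t (pderiv 2 P) = B at *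
      generalize sweep r q t (pderiv 0 (pderiv 0 P)) = A0 at *
      generalize sweep r q t (pderiv 2 (pderiv 0 P)) = A2 at *
      generalize sweep r q t (pderiv 2 (pderiv 2 P)) = B2 at *
      linear_combination Polynomial.C q ^ 2 * hH
  by_contra hndvd
  obtain ⟨U, V, W, hUV, hW, hW2, -⟩ := exists_elimination hP hz hndvd
  have hψW : sweep r q t W = 0 := by
    rw [← hUV, map_add, map_mul, map_mul, hφ, sweep_sweepSurface, mul_zero, mul_zero, add_zero]
  have hWq : W * Polynomial.aeval (X 1) q = 0 := by
    refine MvPolynomial.funext fun v => ?_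
    rw [map_mul, map_zero, mul_eq_zero, or_iff_not_imp_right]
    have hqv : eval v (Polynomial.aeval (X 1) q) = q.eval (v 1) := by
      have := (Polynomial.aeval_algHom_apply (aeval v : MvPolynomial (Fin 3) K →ₐ[K] K) (X 1) q)
      rw [aeval_X] at this
      simpa [aeval_eq_eval] using this.symm
    intro hv
    rw [hqv] at hv
    have := eval_eval_sweep r q t ((v 0 - r.1) / q.eval (v 1)) (v 1) W
    rw [hψW, Polynomial.eval_zero, Polynomial.eval_zero, mul_div_cancel₀ _ hv,
      eval_congr_of_degreeOf_eq_zero hW2 _ _ _ (v 2)] at this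
    rw [this]
    congr 2
    ext i
    fin_cases i <;> simp
  rcases mul_eq_zero.1 hWq with h | h
  · exact hW h
  · have := red_aeval_X_one r q
    rw [h, map_zero] at this
    exact hr2 this.symm

/-- The triples `r₁`, `r₂`, `r` are collinear (when `r₁` and `r₂` differ in the first entry). -/
def TripleCollinear (r₁ r₂ r : K × K × K) : Prop :=
  (r.2.1 - r₁.2.1) * (r₂.1 - r₁.1) = (r₂.2.1 - r₁.2.1) * (r.1 - r₁.1) ∧
    (r.2.2 - r₁.2.2) * (r₂.1 - r₁.1) = (r₂.2.2 - r₁.2.2) * (r.1 - r₁.1)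

/-- At most `k` elements of `R` are collinear with any two given ones. -/
def CollinearBound (k : ℕ) (R : Finset (K × K × K)) : Prop :=
  ∀ r₁ ∈ R, ∀ r₂ ∈ R, r₁ ≠ r₂ → (R.filter (TripleCollinear r₁ r₂)).card ≤ k

theorem CollinearBound.mono {k : ℕ} {R R' : Finset (K × K × K)} (h : CollinearBound k R)
    (hR : R' ⊆ R) : CollinearBound k R' := fun r₁ h₁ r₂ h₂ h12 =>
  (Finset.card_le_card (Finset.filter_subset_filter _ hR)).trans (h r₁ (hR h₁) r₂ (hR h₂) h12)

theorem exists_interpolation (R : Finset (K × K × K)) (m d : ℕ)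
    (h : R.card * (2 * d + 1) < (m + 1) * (d + 1) * (d + 1)) :
    ∃ F : MvPolynomial (Fin 3) K, F ≠ 0 ∧ degreeOf 0 F ≤ m ∧ degreeOf 1 F ≤ d ∧
      degreeOf 2 F ≤ d ∧ ∀ r ∈ R, red r F = 0 := by
  let Φ : box K (expo m d d) →ₗ[K] (R × Fin (2 * d + 1) → K) := LinearMap.pi fun s =>
    (Polynomial.lcoeff K (s.2 : ℕ)).comp ((red s.1.1).toLinearMap.comp (Submodule.subtype _))
  have hdim : Module.finrank K (R × Fin (2 * d + 1) → K) <
      Module.finrank K (box K (expo m d d)) := by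
    rw [finrank_box, Module.finrank_fintype_fun_eq_card]
    simpa using h
  obtain ⟨⟨F, hF⟩, hker, hne⟩ :=
    (Submodule.ne_bot_iff _).1 (LinearMap.ker_ne_bot_of_finrank_lt (f := Φ) hdim)
  rw [mem_box_expo] at hF
  refine ⟨F, fun h0 => hne (Subtype.ext h0), hF.1, hF.2.1, hF.2.2, fun r hr => ?_⟩
  ext j
  rw [Polynomial.coeff_zero]
  rcases lt_or_ge j (2 * d + 1) with hj | hj
  · exact congrFun (LinearMap.mem_ker.1 hker) ⟨⟨r, hr⟩, ⟨j, hj⟩⟩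
  · refine Polynomial.coeff_eq_zero_of_natDegree_lt ((natDegree_red_le r F).trans_lt ?_)
    omega

theorem card_red_eq_zero_le [Infinite K] (p : ℕ) [CharP K p] {P : MvPolynomial (Fin 3) K}
    (hP : Prime P) (hz : 0 < degreeOf 2 P) (hdeg : degreeOf 0 P + degreeOf 2 P < p)
    (hhess : P ∣ hess P) {k : ℕ} (hk : 1 ≤ k) {R : Finset (K × K × K)} (hR : CollinearBound k R) :
    (R.filter fun r => red r P = 0 ∧ red r (pderiv 2 P) ≠ 0).card ≤ k := by
  rcases Finset.eq_empty_or_nonempty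
    (R.filter fun r => red r P = 0 ∧ red r (pderiv 2 P) ≠ 0) with h | ⟨r₁, hr₁⟩
  · rw [h]; simp
  obtain ⟨hr₁R, hr₁P, hr₁q⟩ := Finset.mem_filter.1 hr₁
  have hdvd := dvd_sweepSurface p hP hz hdeg hhess hr₁P hr₁q
  generalize red r₁ (pderiv 2 P) = q at *
  generalize red r₁ (pderiv 0 P) = t at *
  by_cases hall : ∃ r₂ ∈ R, red r₂ P = 0 ∧ r₂ ≠ r₁
  · obtain ⟨r₂, hr₂R, hr₂P, hne⟩ := hall
    have hs : ∀ r, red r P = 0 → red r (sweepSurface r₁ q t) = 0 := by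
      intro r hr
      obtain ⟨Q, hQ⟩ := hdvd
      rw [hQ, map_mul, hr, zero_mul]
    refine (Finset.card_le_card ?_).trans (hR r₁ hr₁R r₂ hr₂R hne.symm)
    intro r hr
    obtain ⟨hrR, hrP, -⟩ := Finset.mem_filter.1 hr
    refine Finset.mem_filter.2 ⟨hrR, ?_⟩
    have e1 := hs r hrP
    have e2 := hs r₂ hr₂P
    rw [red_sweepSurface] at e1 e2
    have e3 : q * (Polynomial.C ((r.2.1 - r₁.2.1) * (r₂.1 - r₁.1) -
        (r₂.2.1 - r₁.2.1) * (r.1 - r₁.1)) * Polynomial.X +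
          Polynomial.C ((r.2.2 - r₁.2.2) * (r₂.1 - r₁.1) -
        (r₂.2.2 - r₁.2.2) * (r.1 - r₁.1))) = 0 := by
      simp only [map_sub, map_mul] at e1 e2 ⊢
      linear_combination (Polynomial.C r₂.1 - Polynomial.C r₁.1) * e1
        - (Polynomial.C r.1 - Polynomial.C r₁.1) * e2
    have e4 := (mul_eq_zero.1 e3).resolve_left hr₁q
    have c0 := congrArg (Polynomial.coeff · 0) e4
    have c1 := congrArg (Polynomial.coeff · 1) e4
    simp only [Polynomial.coeff_add, Polynomial.coeff_C_mul, Polynomial.coeff_X_zero,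
      Polynomial.coeff_X_one, Polynomial.coeff_C_zero, Polynomial.coeff_C_of_ne_zero one_ne_zero,
      Polynomial.coeff_zero, mul_zero, mul_one, zero_add, add_zero] at c0 c1
    exact ⟨sub_eq_zero.1 c1, sub_eq_zero.1 c0⟩
  · push Not at hall
    refine le_trans (Finset.card_le_one.2 fun x hx y hy => ?_) hk
    rw [hall x (Finset.mem_filter.1 hx).1 (Finset.mem_filter.1 hx).2.1,
      hall y (Finset.mem_filter.1 hy).1 (Finset.mem_filter.1 hy).2.1]

theorem card_meets_le [Infinite K] (p : ℕ) [CharP K p] {P Q : MvPolynomial (Fin 3) K}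
    (hP : Prime P) (hz : 0 < degreeOf 2 P) (hdeg : degreeOf 0 P + degreeOf 2 P < p)
    (hhess : P ∣ hess P) {k N : ℕ} (hk : 1 ≤ k) {R : Finset (K × K × K)}
    (hinj : Set.InjOn Prod.fst (R : Set (K × K × K)))
    (hR : CollinearBound k R) {b : K × K × K} (hbQ : blue b Q ≠ 0)
    (hb2 : blue b (pderiv 2 P) ≠ 0) (hRPQ : ∀ r ∈ R, red r P = 0 ∨ red r Q = 0)
    (hNP : degreeOf 0 P + degreeOf 2 P ≤ N) (hNQ : degreeOf 0 Q + degreeOf 2 Q ≤ N) :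
    (R.filter fun r => Meets r b).card ≤ 2 * N + k := by
  have hsub : R.filter (fun r => Meets r b) ⊆
      R.filter (fun r => Meets r b ∧ red r Q = 0) ∪
      (R.filter (fun r => Meets r b ∧ red r (pderiv 2 P) = 0) ∪
        R.filter fun r => red r P = 0 ∧ red r (pderiv 2 P) ≠ 0) := by
    intro r hr
    obtain ⟨hrR, hrb⟩ := Finset.mem_filter.1 hr
    simp only [Finset.mem_union, Finset.mem_filter, hrR, hrb, true_and]
    have := hRPQ r hrR
    tauto
  have h1 := card_le_of_blue_ne_zero hbQ (T := R.filter (fun r => Meets r b ∧ red r Q = 0))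
    (fun r hr => (Finset.mem_filter.1 hr).2)
    (hinj.mono fun r hr => (Finset.mem_filter.1 hr).1)
  have h2 := card_le_of_blue_ne_zero hb2
    (T := R.filter (fun r => Meets r b ∧ red r (pderiv 2 P) = 0))
    (fun r hr => (Finset.mem_filter.1 hr).2)
    (hinj.mono fun r hr => (Finset.mem_filter.1 hr).1)
  have h3 := card_red_eq_zero_le p hP hz hdeg hhess hk hR
  have h4 := (Finset.card_le_card hsub).trans ((Finset.card_union_le _ _).trans
    (Nat.add_le_add_left (Finset.card_union_le _ _) _))
  have h5 := degreeOf_pderiv_le 2 0 P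
  have h6 := degreeOf_pderiv_le 2 2 P
  omega

/-- The lines `b` on the surface `P = 0` that are exceptional for the counting argument. -/
def Exceptional (P Q : MvPolynomial (Fin 3) K) (b : K × K × K) : Prop :=
  blue b P = 0 ∧ (degreeOf 2 P = 0 ∨ blue b Q = 0 ∨ blue b (pderiv 2 P) = 0 ∨ ¬ P ∣ hess P)

theorem card_exceptional_le [Infinite K] (p : ℕ) [CharP K p] {P Q : MvPolynomial (Fin 3) K}
    (hP : Prime P) (hPQ : ¬ P ∣ Q) {d : ℕ} (hz : degreeOf 2 P ≤ d) (he : degreeOf 1 P ≤ d)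
    (hdp : d < p) (hzQ : degreeOf 2 Q ≤ d) (heQ : degreeOf 1 Q ≤ d) {B : Finset (K × K × K)}
    (hinj : Set.InjOn Prod.fst (B : Set (K × K × K))) :
    (B.filter (Exceptional P Q)).card ≤ 9 * d * degreeOf 1 P + d * degreeOf 2 P := by
  rcases Nat.eq_zero_or_pos (degreeOf 2 P) with hz0 | hz0
  · have h1 := card_le_of_blue_eq_zero hP.ne_zero hz0 (S := B.filter (Exceptional P Q))
      (fun b hb => (Finset.mem_filter.1 hb).2.1) (hinj.mono fun r hr => (Finset.mem_filter.1 hr).1)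
    rcases Nat.eq_zero_or_pos (degreeOf 1 P) with he0 | he0
    · omega
    · have : degreeOf 1 P ≤ 9 * d * degreeOf 1 P := Nat.le_mul_of_pos_left _ (by omega)
      omega
  have key : ∀ W : MvPolynomial (Fin 3) K, ¬ P ∣ W →
      (B.filter fun b => blue b P = 0 ∧ blue b W = 0).card ≤
        degreeOf 2 W * degreeOf 1 P + degreeOf 2 P * degreeOf 1 W := fun W hW =>
    card_le_of_blue_eq_zero_of_prime hP hz0 hW (fun b hb => (Finset.mem_filter.1 hb).2)
      (hinj.mono fun r hr => (Finset.mem_filter.1 hr).1)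
  have h1 := key Q hPQ
  have hd0 : pderiv 2 P ≠ 0 := pderiv_ne_zero_of_degreeOf_lt p 2 P hz0 (by omega)
  have h2 := key (pderiv 2 P) (fun h => absurd (degreeOf_le_of_dvd 2 h hd0)
    (not_le.2 (degreeOf_pderiv_lt 2 P hz0)))
  have h3 : (B.filter fun b => blue b P = 0 ∧ ¬ P ∣ hess P).card ≤
      6 * degreeOf 2 P * degreeOf 1 P := by
    by_cases hh : P ∣ hess P
    · simp [hh]
    · have h4 := key (hess P) hh
      have h5 := Nat.mul_le_mul_right (degreeOf 1 P) (degreeOf_hess_le 2 P)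
      have h6 := Nat.mul_le_mul_left (degreeOf 2 P) (degreeOf_hess_le 1 P)
      refine (Finset.card_le_card ?_).trans (h4.trans (by linarith))
      exact Finset.monotone_filter_right _ fun b _ hb => ⟨hb.1, blue_hess hb.1⟩
  have hsub : B.filter (Exceptional P Q) ⊆ B.filter (fun b => blue b P = 0 ∧ blue b Q = 0) ∪
      (B.filter (fun b => blue b P = 0 ∧ blue b (pderiv 2 P) = 0) ∪
        B.filter fun b => blue b P = 0 ∧ ¬ P ∣ hess P) := by
    intro b hb
    obtain ⟨hbB, hbP, hb⟩ := Finset.mem_filter.1 hb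
    simp only [Finset.mem_union, Finset.mem_filter, hbB, hbP, true_and]
    rcases hb with h | h | h | h
    · omega
    · exact Or.inl h
    · exact Or.inr (Or.inl h)
    · exact Or.inr (Or.inr h)
  have h4 := (Finset.card_le_card hsub).trans ((Finset.card_union_le _ _).trans
    (Nat.add_le_add_left (Finset.card_union_le _ _) _))
  have h5 := Nat.mul_le_mul_right (degreeOf 1 P) (degreeOf_pderiv_le 2 2 P)
  have h6 := Nat.mul_le_mul_left (degreeOf 2 P) (degreeOf_pderiv_le 2 1 P)
  have h7 := Nat.mul_le_mul_right (degreeOf 1 P) hzQ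
  have h8 := Nat.mul_le_mul_left (degreeOf 2 P) heQ
  have h9 := Nat.mul_le_mul_right (degreeOf 1 P) hz
  nlinarith

/-- Among two families of lines there is one line of the larger family meeting few of the others. -/
theorem exists_card_meets_le [Infinite K] (p : ℕ) [CharP K p] {k s : ℕ} (hk : 1 ≤ k)
    {R B : Finset (K × K × K)} (hRinj : Set.InjOn Prod.fst (R : Set (K × K × K)))
    (hBinj : Set.InjOn Prod.fst (B : Set (K × K × K))) (hR : CollinearBound k R)
    (hRB : R.card ≤ B.card) (hBs : B.card < s ^ 2) (hsp : 8 * s < p) (hB : B.Nonempty) :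
    ∃ b ∈ B, (R.filter fun r => Meets r b).card ≤ 16 * s + k := by
  by_contra! hmany
  set d := Nat.sqrt ((B.card - 1) / 11) with hd
  have hBpos := hB.card_pos
  have hd1 : 11 * d ^ 2 < B.card := by
    have h1 := Nat.sqrt_le' ((B.card - 1) / 11)
    have h2 := Nat.div_mul_le_self (B.card - 1) 11
    rw [← hd] at h1
    omega
  have hd2 : B.card ≤ 11 * (d + 1) ^ 2 := by
    have h1 := Nat.lt_succ_sqrt' ((B.card - 1) / 11)
    rw [← hd, Nat.succ_eq_add_one] at h1
    omega
  have hds : d < s := by nlinarith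
  have hcount : R.card * (2 * d + 1) < (7 * s + 1) * (d + 1) * (d + 1) := by
    have h1 : R.card ^ 2 ≤ 11 * (d + 1) ^ 2 * s ^ 2 := by
      rw [sq]; exact Nat.mul_le_mul (hRB.trans hd2) (by omega)
    refine lt_of_pow_lt_pow_left₀ 2 (Nat.zero_le _) ?_
    calc (R.card * (2 * d + 1)) ^ 2 = R.card ^ 2 * (2 * d + 1) ^ 2 := by ring
      _ ≤ 11 * (d + 1) ^ 2 * s ^ 2 * (2 * (d + 1)) ^ 2 :=
        Nat.mul_le_mul h1 (Nat.pow_le_pow_left (by omega) 2)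
      _ = 44 * s ^ 2 * (d + 1) ^ 4 := by ring
      _ < (7 * s + 1) ^ 2 * (d + 1) ^ 4 := by
        refine Nat.mul_lt_mul_of_pos_right ?_ (by positivity)
        nlinarith
      _ = _ := by ring
  obtain ⟨F, hF0, hFd0, hFd1, hFd2, hFR⟩ := exists_interpolation R (7 * s) d hcount
  have hFB : ∀ b ∈ B, blue b F = 0 := by
    intro b hb
    by_contra hbF
    have := card_le_of_blue_ne_zero hbF (T := R.filter fun r => Meets r b)
      (fun r hr => ⟨(Finset.mem_filter.1 hr).2, hFR r (Finset.mem_filter.1 hr).1⟩)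
      (hRinj.mono fun r hr => (Finset.mem_filter.1 hr).1)
    have := hmany b hb
    omega
  obtain ⟨S, hSp, hSass, hSF, n, hFn⟩ := exists_coprime_prime_factors hF0
  have hSdeg : ∀ i, ∑ P ∈ S, degreeOf i P ≤ degreeOf i F := by
    intro i
    rw [← degreeOf_prod_eq S (fun P => P) fun P hP => (hSp P hP).ne_zero]
    exact degreeOf_le_of_dvd i hSF hF0
  let Q : MvPolynomial (Fin 3) K → MvPolynomial (Fin 3) K := fun P => ∏ P' ∈ S.erase P, P'
  have hPQ : ∀ P ∈ S, P * Q P = ∏ P' ∈ S, P' := fun P hP => Finset.mul_prod_erase S (fun P => P) hP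
  have hQF : ∀ P ∈ S, Q P ∣ F := fun P hP => (Dvd.intro_left P (hPQ P hP)).trans hSF
  have hPF : ∀ P ∈ S, P ∣ F := fun P hP => (Dvd.intro _ (hPQ P hP)).trans hSF
  have hndvd : ∀ P ∈ S, ¬ P ∣ Q P := by
    intro P hP h
    obtain ⟨P', hP', hdvd⟩ := (hSp P hP).exists_mem_finset_dvd h
    obtain ⟨hne, hP'S⟩ := Finset.mem_erase.1 hP'
    exact hne (hSass P hP P' hP'S hdvd).symm
  have hzero : ∀ f : MvPolynomial (Fin 3) K →ₐ[K] Polynomial K, f F = 0 →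
      f (∏ P ∈ S, P) = 0 := by
    intro f hf
    obtain ⟨G, hG⟩ := hFn
    have := congrArg f hG
    rw [map_mul, hf, zero_mul, map_pow] at this
    by_contra h
    exact pow_ne_zero n h this
  have hdegle : ∀ P ∈ S, ∀ i, degreeOf i P ≤ degreeOf i F ∧ degreeOf i (Q P) ≤ degreeOf i F :=
    fun P hP i => ⟨degreeOf_le_of_dvd i (hPF P hP) hF0, degreeOf_le_of_dvd i (hQF P hP) hF0⟩
  have hexc : (S.biUnion fun P => B.filter (Exceptional P (Q P))).card < B.card := by
    refine (Finset.card_biUnion_le.trans (Finset.sum_le_sum fun P hP => card_exceptional_le p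
      (hSp P hP) (hndvd P hP) (d := d) ((hdegle P hP 2).1.trans hFd2)
      ((hdegle P hP 1).1.trans hFd1) (by omega) ((hdegle P hP 2).2.trans hFd2)
      ((hdegle P hP 1).2.trans hFd1) hBinj)).trans_lt ?_
    rw [Finset.sum_add_distrib, ← Finset.mul_sum, ← Finset.mul_sum]
    have h1 := Nat.mul_le_mul_left (9 * d) ((hSdeg 1).trans hFd1)
    have h2 := Nat.mul_le_mul_left d ((hSdeg 2).trans hFd2)
    nlinarith
  obtain ⟨b, hb, hbS⟩ := Finset.exists_mem_notMem_of_card_lt_card hexc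
  simp only [Finset.mem_biUnion, Finset.mem_filter, hb, true_and, not_exists, not_and] at hbS
  obtain ⟨P, hP, hbP⟩ : ∃ P ∈ S, blue b P = 0 := by
    have := hzero (blue b) (hFB b hb)
    rw [map_prod] at this
    exact Finset.prod_eq_zero_iff.1 this
  have hbS := hbS P hP
  rw [Exceptional] at hbS
  push Not at hbS
  obtain ⟨hz, hbQ, hb2, hhess⟩ := hbS hbP
  have := card_meets_le p (hSp P hP) (Nat.pos_of_ne_zero hz)
    (by have := (hdegle P hP 0).1; have := (hdegle P hP 2).1; omega) hhess hk hRinj hR hbQ hb2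
    (N := 7 * s + d)
    (fun r hr => by
      have := hzero (red r) (hFR r hr)
      rwa [← hPQ P hP, map_mul, mul_eq_zero] at this)
    (Nat.add_le_add ((hdegle P hP 0).1.trans hFd0) ((hdegle P hP 2).1.trans hFd2))
    (Nat.add_le_add ((hdegle P hP 0).2.trans hFd0) ((hdegle P hP 2).2.trans hFd2))
  have := hmany b hb
  omega

theorem Meets.symm {r b : K × K × K} (h : Meets r b) : Meets b r := Eq.symm h

theorem meets_comm {r b : K × K × K} : Meets r b ↔ Meets b r := ⟨Meets.symm, Meets.symm⟩

/-- The number of meeting pairs between two families. -/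
noncomputable def meetCount (R B : Finset (K × K × K)) : ℕ :=
  ∑ b ∈ B, (R.filter fun r => Meets r b).card

theorem meetCount_comm (R B : Finset (K × K × K)) : meetCount R B = meetCount B R := by
  simp only [meetCount, Finset.card_filter]
  rw [Finset.sum_comm]
  simp only [meets_comm]

theorem meetCount_le_of_injOn [Infinite K] (p : ℕ) [CharP K p] {k s : ℕ} (hk : 1 ≤ k)
    (hsp : 8 * s < p) (n : ℕ) : ∀ {R B : Finset (K × K × K)}, R.card + B.card = n →
    Set.InjOn Prod.fst (R : Set (K × K × K)) → Set.InjOn Prod.fst (B : Set (K × K × K)) →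
    CollinearBound k R → CollinearBound k B → R.card < s ^ 2 → B.card < s ^ 2 →
    meetCount R B ≤ (16 * s + k) * (R.card + B.card) := by
  induction n with
  | zero =>
    intro R B h _ _ _ _ _ _
    have : B = ∅ := Finset.card_eq_zero.1 (by omega)
    simp [this, meetCount]
  | succ n ih =>
    intro R B h hRi hBi hR hB hRs hBs
    wlog hRB : R.card ≤ B.card generalizing R B
    · rw [meetCount_comm, add_comm R.card]
      exact this (by omega) hBi hRi hB hR hBs hRs (by omega)
    obtain ⟨b, hb, hbc⟩ := exists_card_meets_le p hk hRi hBi hR hRB hBs hsp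
      (Finset.card_pos.1 (by omega))
    have hce := Finset.card_erase_of_mem hb
    have hpos := Finset.card_pos.2 ⟨b, hb⟩
    have h1 := ih (R := R) (B := B.erase b) (by omega) hRi
      (hBi.mono (Finset.erase_subset b B)) hR (hB.mono (Finset.erase_subset b B)) hRs (by omega)
    rw [meetCount, ← Finset.add_sum_erase _ _ hb]
    rw [meetCount] at h1
    have h2 : R.card + B.card = R.card + (B.erase b).card + 1 := by omega
    rw [h2, mul_add, mul_one]
    omega

/-- Three points of affine 3-space are collinear, expressed by minors. -/
def Aligned (r₁ r₂ r : K × K × K) : Prop :=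
  (r.1 - r₁.1) * (r₂.2.1 - r₁.2.1) = (r.2.1 - r₁.2.1) * (r₂.1 - r₁.1) ∧
    (r.1 - r₁.1) * (r₂.2.2 - r₁.2.2) = (r.2.2 - r₁.2.2) * (r₂.1 - r₁.1) ∧
    (r.2.1 - r₁.2.1) * (r₂.2.2 - r₁.2.2) = (r.2.2 - r₁.2.2) * (r₂.2.1 - r₁.2.1)

/-- At most `k` elements of `R` are on the line through any two given ones. -/
def AlignedBound (k : ℕ) (R : Finset (K × K × K)) : Prop :=
  ∀ r₁ ∈ R, ∀ r₂ ∈ R, r₁ ≠ r₂ → (R.filter (Aligned r₁ r₂)).card ≤ k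

/-- A projective change of coordinates. -/
def twist (α β γ : K) (r : K × K × K) : K × K × K :=
  ((r.1 - α * r.2.1 - γ * r.2.2) / (1 - β * r.2.1), r.2.1 / (1 - β * r.2.1),
    r.2.2 / (1 - β * r.2.1))

theorem meets_twist {α β γ : K} {r b : K × K × K} (hr : 1 - β * r.2.1 ≠ 0)
    (hb : 1 - γ * b.2.1 ≠ 0) : Meets (twist α β γ r) (twist α γ β b) ↔ Meets r b := by
  simp only [Meets, twist]
  rw [div_mul_div_comm, div_mul_div_comm, div_add_div _ _ (mul_ne_zero hr hb) hr,
    div_add_div _ _ (mul_ne_zero hb hr) hb, div_eq_div_iff (by positivity) (by positivity)]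
  constructor
  · intro h
    have h2 : (1 - β * r.2.1) ^ 2 * (1 - γ * b.2.1) ^ 2 *
        (r.2.1 * b.1 + r.2.2 - (b.2.1 * r.1 + b.2.2)) = 0 := by
      linear_combination h
    have h3 := (mul_eq_zero.1 h2).resolve_left (by positivity)
    exact sub_eq_zero.1 h3
  · intro h
    linear_combination (1 - β * r.2.1) ^ 2 * (1 - γ * b.2.1) ^ 2 * h

theorem aligned_of_tripleCollinear_twist {α β γ : K} {r₁ r₂ r : K × K × K}
    (h₁ : 1 - β * r₁.2.1 ≠ 0) (h₂ : 1 - β * r₂.2.1 ≠ 0) (h : 1 - β * r.2.1 ≠ 0)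
    (hne : (twist α β γ r₁).1 ≠ (twist α β γ r₂).1)
    (hc : TripleCollinear (twist α β γ r₁) (twist α β γ r₂) (twist α β γ r)) :
    Aligned r₁ r₂ r := by
  have key : ∀ s : K × K × K, 1 - β * s.2.1 ≠ 0 →
      1 / (1 - β * s.2.1) = 1 + β * (twist α β γ s).2.1 ∧
      s.2.1 / (1 - β * s.2.1) = (twist α β γ s).2.1 ∧
      s.2.2 / (1 - β * s.2.1) = (twist α β γ s).2.2 ∧
      s.1 / (1 - β * s.2.1) =
        (twist α β γ s).1 + α * (twist α β γ s).2.1 + γ * (twist α β γ s).2.2 := by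
    intro s hs
    refine ⟨?_, rfl, rfl, ?_⟩
    · simp only [twist]; field_simp; ring
    · simp only [twist]; field_simp; ring
  obtain ⟨p1, p2, p3, p4⟩ := key r₁ h₁
  obtain ⟨q1, q2, q3, q4⟩ := key r₂ h₂
  obtain ⟨s1, s2, s3, s4⟩ := key r h
  obtain ⟨c1, c2⟩ := hc
  generalize twist α β γ r₁ = t₁ at *
  generalize twist α β γ r₂ = t₂ at *
  generalize twist α β γ r = t at *
  have hd : t₂.1 - t₁.1 ≠ 0 := sub_ne_zero.2 hne.symm
  obtain ⟨l, hl⟩ : ∃ l, t.1 - t₁.1 = l * (t₂.1 - t₁.1) :=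
    ⟨(t.1 - t₁.1) / (t₂.1 - t₁.1), by field_simp⟩
  have m1 : t.1 = t₁.1 + l * (t₂.1 - t₁.1) := by linear_combination hl
  have m2 : t.2.1 = t₁.2.1 + l * (t₂.2.1 - t₁.2.1) := by
    apply mul_right_cancel₀ hd
    rw [hl] at c1; linear_combination c1
  have m3 : t.2.2 = t₁.2.2 + l * (t₂.2.2 - t₁.2.2) := by
    apply mul_right_cancel₀ hd
    rw [hl] at c2; linear_combination c2
  generalize 1 - β * r₁.2.1 = D₁ at *
  generalize 1 - β * r₂.2.1 = D₂ at *
  generalize 1 - β * r.2.1 = D at *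
  have w0 : 1 / D = (1 - l) / D₁ + l / D₂ := by
    rw [s1, m2]; linear_combination -(1 - l) * p1 - l * q1
  have w1 : r.1 / D = (1 - l) * (r₁.1 / D₁) + l * (r₂.1 / D₂) := by
    rw [s4, p4, q4, m1, m2, m3]; ring
  have w2 : r.2.1 / D = (1 - l) * (r₁.2.1 / D₁) + l * (r₂.2.1 / D₂) := by
    rw [s2, p2, q2, m2]; ring
  have w3 : r.2.2 / D = (1 - l) * (r₁.2.2 / D₁) + l * (r₂.2.2 / D₂) := by
    rw [s3, p3, q3, m3]; ring
  have fin : ∀ x x₁ x₂ : K, x / D = (1 - l) * (x₁ / D₁) + l * (x₂ / D₂) →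
      x - x₁ = D * l / D₂ * (x₂ - x₁) := by
    intro x x₁ x₂ hx
    have hx' : x = D * ((1 - l) * (x₁ / D₁) + l * (x₂ / D₂)) := by
      rw [← hx]; field_simp
    have h1 : D * ((1 - l) / D₁ + l / D₂) = 1 := by rw [← w0]; field_simp
    rw [hx']
    linear_combination x₁ * h1
  have f1 := fin _ _ _ w1
  have f2 := fin _ _ _ w2
  have f3 := fin _ _ _ w3
  exact ⟨by rw [f1, f2]; ring, by rw [f1, f3]; ring, by rw [f2, f3]; ring⟩

theorem exists_generic_twist [Infinite K] (R B : Finset (K × K × K)) :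
    ∃ α β γ : K, (∀ r ∈ R, 1 - β * r.2.1 ≠ 0) ∧ (∀ b ∈ B, 1 - γ * b.2.1 ≠ 0) ∧
      (∀ r ∈ R, ∀ r' ∈ R, r ≠ r' → (twist α β γ r).1 ≠ (twist α β γ r').1) ∧
      ∀ b ∈ B, ∀ b' ∈ B, b ≠ b' → (twist α γ β b).1 ≠ (twist α γ β b').1 := by
  let f : (K × K × K) × (K × K × K) → Fin 3 → Fin 3 → MvPolynomial (Fin 3) K := fun q i j =>
    (C q.1.1 - X 0 * C q.1.2.1 - X j * C q.1.2.2) * (1 - X i * C q.2.2.1) -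
      (C q.2.1 - X 0 * C q.2.2.1 - X j * C q.2.2.2) * (1 - X i * C q.1.2.1)
  let g : (K × K × K) → Fin 3 → MvPolynomial (Fin 3) K := fun r i => 1 - X i * C r.2.1
  have hg : ∀ r i, g r i ≠ 0 := by
    intro r i h
    have := congrArg (eval (0 : Fin 3 → K)) h
    simp [g] at this
  have hf : ∀ q : (K × K × K) × (K × K × K), q.1 ≠ q.2 → ∀ i j : Fin 3, i ≠ 0 → j ≠ 0 → i ≠ j →
      f q i j ≠ 0 := by
    intro q hq i j hi hj hij h
    have e0 := congrArg (eval (0 : Fin 3 → K)) h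
    have e1 := congrArg (eval (Pi.single 0 1 : Fin 3 → K)) h
    have e2 := congrArg (eval (Pi.single j 1 : Fin 3 → K)) h
    simp [f] at e0
    simp [f, hi, hj] at e1
    simp [f, hj.symm, hij] at e2
    have a0 : q.1.1 = q.2.1 := by linear_combination e0
    have a1 : q.1.2.1 = q.2.2.1 := by linear_combination a0 - e1
    have a2 : q.1.2.2 = q.2.2.2 := by linear_combination a0 - e2
    exact hq (Prod.ext a0 (Prod.ext a1 a2))
  have hF : (∏ r ∈ R, g r 1) * (∏ b ∈ B, g b 2) * (∏ q ∈ R.offDiag, f q 1 2) *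
      (∏ q ∈ B.offDiag, f q 2 1) ≠ 0 := by
    refine mul_ne_zero (mul_ne_zero (mul_ne_zero ?_ ?_) ?_) ?_
    · exact Finset.prod_ne_zero_iff.2 fun r _ => hg r 1
    · exact Finset.prod_ne_zero_iff.2 fun r _ => hg r 2
    · exact Finset.prod_ne_zero_iff.2 fun q hq => hf q (Finset.mem_offDiag.1 hq).2.2 1 2
        (by decide) (by decide) (by decide)
    · exact Finset.prod_ne_zero_iff.2 fun q hq => hf q (Finset.mem_offDiag.1 hq).2.2 2 1
        (by decide) (by decide) (by decide)
  obtain ⟨x, hx⟩ := exists_eval_ne_zero hF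
  simp only [map_mul, map_prod, mul_ne_zero_iff, Finset.prod_ne_zero_iff] at hx
  obtain ⟨⟨⟨x1, x2⟩, x3⟩, x4⟩ := hx
  have y1 : ∀ r ∈ R, 1 - x 1 * r.2.1 ≠ 0 := fun r hr => by simpa [g] using x1 r hr
  have y2 : ∀ r ∈ B, 1 - x 2 * r.2.1 ≠ 0 := fun r hr => by simpa [g] using x2 r hr
  refine ⟨x 0, x 1, x 2, y1, y2, ?_, ?_⟩
  · intro r hr r' hr' hne heq
    have := x3 (r, r') (Finset.mem_offDiag.2 ⟨hr, hr', hne⟩)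
    rw [twist, twist, div_eq_div_iff (y1 r hr) (y1 r' hr')] at heq
    refine this ?_
    simp [f]
    linear_combination heq
  · intro r hr r' hr' hne heq
    have := x4 (r, r') (Finset.mem_offDiag.2 ⟨hr, hr', hne⟩)
    rw [twist, twist, div_eq_div_iff (y2 r hr) (y2 r' hr')] at heq
    refine this ?_
    simp [f]
    linear_combination heq

theorem meetCount_le_of_infinite [Infinite K] (p : ℕ) [CharP K p] {k s : ℕ} (hk : 1 ≤ k)
    (hsp : 8 * s < p) {R B : Finset (K × K × K)} (hR : AlignedBound k R) (hB : AlignedBound k B)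
    (hRs : R.card < s ^ 2) (hBs : B.card < s ^ 2) :
    meetCount R B ≤ (16 * s + k) * (R.card + B.card) := by
  obtain ⟨α, β, γ, h1, h2, h3, h4⟩ := exists_generic_twist R B
  have hRi : Set.InjOn (twist α β γ) (R : Set (K × K × K)) := fun r hr r' hr' h => by
    by_contra hne
    exact h3 r hr r' hr' hne (by rw [h])
  have hBi : Set.InjOn (twist α γ β) (B : Set (K × K × K)) := fun r hr r' hr' h => by
    by_contra hne
    exact h4 r hr r' hr' hne (by rw [h])
  have hcol : ∀ (β γ : K) (T : Finset (K × K × K)), AlignedBound k T →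
      (∀ r ∈ T, 1 - β * r.2.1 ≠ 0) →
      (∀ r ∈ T, ∀ r' ∈ T, r ≠ r' → (twist α β γ r).1 ≠ (twist α β γ r').1) →
      CollinearBound k (T.image (twist α β γ)) ∧
        Set.InjOn Prod.fst ((T.image (twist α β γ) : Finset _) : Set (K × K × K)) := by
    intro β γ T hT hT1 hT2
    constructor
    · intro r₁ hr₁ r₂ hr₂ hne
      obtain ⟨r₁, hr₁', rfl⟩ := Finset.mem_image.1 hr₁
      obtain ⟨r₂, hr₂', rfl⟩ := Finset.mem_image.1 hr₂
      have hne' : r₁ ≠ r₂ := fun h => hne (by rw [h])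
      refine le_trans ?_ (hT r₁ hr₁' r₂ hr₂' hne')
      refine (Finset.card_le_card ?_).trans (Finset.card_image_le (f := twist α β γ))
      intro t ht
      obtain ⟨ht, htc⟩ := Finset.mem_filter.1 ht
      obtain ⟨r, hr, rfl⟩ := Finset.mem_image.1 ht
      exact Finset.mem_image_of_mem _ (Finset.mem_filter.2 ⟨hr,
        aligned_of_tripleCollinear_twist (hT1 r₁ hr₁') (hT1 r₂ hr₂') (hT1 r hr)
          (hT2 r₁ hr₁' r₂ hr₂' hne') htc⟩)
    · intro t ht t' ht' h
      obtain ⟨r, hr, rfl⟩ := Finset.mem_image.1 (Finset.mem_coe.1 ht)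
      obtain ⟨r', hr', rfl⟩ := Finset.mem_image.1 (Finset.mem_coe.1 ht')
      by_contra hne
      exact hT2 r hr r' hr' (fun h => hne (by rw [h])) h
  obtain ⟨cR, iR⟩ := hcol β γ R hR h1 h3
  obtain ⟨cB, iB⟩ := hcol γ β B hB h2 h4
  have := meetCount_le_of_injOn p hk hsp _ rfl iR iB cR cB
    (by rwa [Finset.card_image_of_injOn hRi]) (by rwa [Finset.card_image_of_injOn hBi])
  rw [Finset.card_image_of_injOn hRi, Finset.card_image_of_injOn hBi] at this
  refine le_trans (le_of_eq ?_) this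
  rw [meetCount, meetCount, Finset.sum_image hBi]
  refine Finset.sum_congr rfl fun b hb => ?_
  rw [Finset.filter_image, Finset.card_image_of_injOn (hRi.mono (Finset.filter_subset _ _))]
  refine congrArg _ (Finset.filter_congr fun r hr => ?_)
  exact (meets_twist (h1 r hr) (h2 b hb)).symm

/-- A point-plane incidence bound in characteristic `p`. -/
theorem meetCount_le (p : ℕ) [CharP K p] {k s : ℕ} (hk : 1 ≤ k)
    (hsp : 8 * s < p) {R B : Finset (K × K × K)} (hR : AlignedBound k R) (hB : AlignedBound k B)
    (hRs : R.card < s ^ 2) (hBs : B.card < s ^ 2) :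
    meetCount R B ≤ (16 * s + k) * (R.card + B.card) := by
  let L := AlgebraicClosure K
  have : CharP L p := charP_of_injective_algebraMap (algebraMap K L).injective p
  have : Infinite L := IsAlgClosed.instInfinite
  let e : K × K × K → L × L × L := fun r =>
    (algebraMap K L r.1, algebraMap K L r.2.1, algebraMap K L r.2.2)
  have hinj := (algebraMap K L).injective
  have he : Function.Injective e := by
    intro r r' h
    simp only [e, Prod.mk.injEq, hinj.eq_iff] at h
    exact Prod.ext h.1 (Prod.ext h.2.1 h.2.2)
  have hal : ∀ r₁ r₂ r, Aligned (e r₁) (e r₂) (e r) ↔ Aligned r₁ r₂ r := by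
    intro r₁ r₂ r
    simp only [Aligned, e, ← map_sub, ← map_mul, hinj.eq_iff]
  have hme : ∀ r b, Meets (e r) (e b) ↔ Meets r b := by
    intro r b
    simp only [Meets, e, ← map_add, ← map_mul, hinj.eq_iff]
  have hbd : ∀ T : Finset (K × K × K), AlignedBound k T → AlignedBound k (T.image e) := by
    intro T hT r₁ hr₁ r₂ hr₂ hne
    obtain ⟨r₁, hr₁', rfl⟩ := Finset.mem_image.1 hr₁
    obtain ⟨r₂, hr₂', rfl⟩ := Finset.mem_image.1 hr₂
    refine le_trans ?_ (hT r₁ hr₁' r₂ hr₂' fun h => hne (by rw [h]))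
    rw [Finset.filter_image]
    simp only [hal]
    exact Finset.card_image_le
  have := meetCount_le_of_infinite p hk hsp (hbd R hR) (hbd B hB)
    (by rwa [Finset.card_image_of_injective _ he]) (by rwa [Finset.card_image_of_injective _ he])
  rw [Finset.card_image_of_injective _ he, Finset.card_image_of_injective _ he] at this
  refine le_trans (le_of_eq ?_) this
  rw [meetCount, meetCount, Finset.sum_image he.injOn]
  refine Finset.sum_congr rfl fun b hb => ?_
  rw [Finset.filter_image, Finset.card_image_of_injective _ he]
  simp only [hme]

end MvPolynomial

section Correlation

variable {G : Type*} [CommGroup G] [Fintype G]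

@[to_additive sum_sq_correlation_add]
theorem sum_sq_correlation (u w : G → ℝ) :
    ∑ a, (∑ y, u y * w (a * y)) ^ 2 =
      ∑ l, (∑ y, u y * u (l * y)) * ∑ y, w y * w (l * y) := by
  have h1 : ∀ a, (∑ y, u y * w (a * y)) ^ 2 =
      ∑ y, ∑ z, u y * w (a * y) * (u z * w (a * z)) := fun a => by
    rw [sq, Finset.sum_mul_sum]
  have h2 : ∀ l, (∑ y, u y * u (l * y)) * ∑ y, w y * w (l * y) =
      ∑ y, ∑ t, u y * u (l * y) * (w t * w (l * t)) := fun l => by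
    rw [Finset.sum_mul_sum]
  simp only [h1, h2]
  rw [Finset.sum_comm, Finset.sum_comm (s := Finset.univ (α := G)) (t := Finset.univ (α := G))
    (f := fun l y => ∑ t, u y * u (l * y) * (w t * w (l * t)))]
  refine Finset.sum_congr rfl fun y _ => ?_
  rw [Finset.sum_comm]
  rw [← Equiv.sum_comp (Equiv.mulRight y)]
  refine Finset.sum_congr rfl fun l _ => ?_
  rw [← Equiv.sum_comp (Equiv.mulRight y) (fun t => u y * u (l * y) * (w t * w (l * t)))]
  refine Finset.sum_congr rfl fun a _ => ?_
  simp only [Equiv.coe_mulRight]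
  rw [show a * (l * y) = l * (a * y) by ac_rfl]
  ring

theorem autocorrelation_inv (u : G → ℝ) (l : G) :
    ∑ y, u y⁻¹ * u (l * y)⁻¹ = ∑ y, u y * u (l * y) := by
  rw [← Equiv.sum_comp ((Equiv.inv G).trans (Equiv.mulRight l⁻¹))]
  refine Finset.sum_congr rfl fun y _ => ?_
  simp only [Equiv.trans_apply, Equiv.inv_apply, Equiv.coe_mulRight, mul_inv_rev, inv_inv]
  rw [mul_comm (u _), mul_inv_cancel_comm]

end Correlation

section Moments

variable {p : ℕ} [Fact p.Prime]

/-- The correlation of `f` with its composition with an affine map. -/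
noncomputable def affCorr (f : ZMod p → ℝ) (l : ZMod p × ZMod p) : ℝ :=
  ∑ x, f x * f (l.1 * x + l.2)

/-- The additive autocorrelation of `f`. -/
noncomputable def autoCorr (f : ZMod p → ℝ) (d : ZMod p) : ℝ := ∑ x, f x * f (d + x)

theorem sum_sq_affCorr_slope (f : ZMod p → ℝ) {a : ZMod p} (ha : a ≠ 0) :
    ∑ b, affCorr f (a, b) ^ 2 = ∑ d, autoCorr f (a⁻¹ * d) * autoCorr f d := by
  have h1 : ∀ b, affCorr f (a, b) = ∑ x, f (a⁻¹ * x) * f (b + x) := by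
    intro b
    rw [affCorr, ← Equiv.sum_comp (Equiv.mulLeft₀ a ha) (fun x => f (a⁻¹ * x) * f (b + x))]
    refine Finset.sum_congr rfl fun x _ => ?_
    simp only [Equiv.mulLeft₀_apply, inv_mul_cancel_left₀ ha, add_comm b]
  simp only [h1]
  rw [sum_sq_correlation_add]
  refine Finset.sum_congr rfl fun d _ => ?_
  congr 1
  rw [autoCorr, ← Equiv.sum_comp (Equiv.mulLeft₀ a⁻¹ (inv_ne_zero ha))
    fun x => f x * f (a⁻¹ * d + x)]
  refine Finset.sum_congr rfl fun x _ => ?_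
  simp only [Equiv.mulLeft₀_apply, mul_add]

theorem addEfun_eq (f : ZMod p → ℝ) : addEfun f = ∑ d, autoCorr f d ^ 2 := by
  have h1 : ∀ x y z, (∑ w, if x - y = z - w then f x * f y * f z * f w else 0) =
      f x * f y * f z * f (z - x + y) := by
    intro x y z
    have : ∀ w, (x - y = z - w) ↔ (z - x + y = w) := fun w =>
      ⟨fun h => by linear_combination -h, fun h => by linear_combination -h⟩
    simp only [this, Finset.sum_ite_eq, Finset.mem_univ, if_true]
  simp only [addEfun, h1]
  rw [Finset.sum_comm]
  simp only [autoCorr, sq, Finset.sum_mul_sum]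
  rw [Finset.sum_comm (s := Finset.univ (α := ZMod p)) (t := Finset.univ (α := ZMod p))
    (f := fun d y => ∑ t, f y * f (d + y) * (f t * f (d + t)))]
  refine Finset.sum_congr rfl fun y _ => ?_
  rw [← Equiv.sum_comp (Equiv.addRight y)]
  refine Finset.sum_congr rfl fun d _ => ?_
  rw [← Equiv.sum_comp (Equiv.addLeft d) fun z => _]
  refine Finset.sum_congr rfl fun t _ => ?_
  simp only [Equiv.coe_addRight, Equiv.coe_addLeft]
  rw [show d + t - (d + y) + y = t by ring]
  ring

theorem addEfun_nonneg (f : ZMod p → ℝ) : 0 ≤ addEfun f := by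
  rw [addEfun_eq]; positivity

theorem sum_sq_affCorr_slope_le (f : ZMod p → ℝ) {a : ZMod p} (ha : a ≠ 0) :
    ∑ b, affCorr f (a, b) ^ 2 ≤ addEfun f := by
  rw [sum_sq_affCorr_slope f ha, addEfun_eq]
  have h1 : ∑ d, autoCorr f (a⁻¹ * d) ^ 2 = ∑ d, autoCorr f d ^ 2 :=
    Equiv.sum_comp (Equiv.mulLeft₀ a⁻¹ (inv_ne_zero ha)) fun d => autoCorr f d ^ 2
  have h2 : ∑ d, autoCorr f (a⁻¹ * d) * autoCorr f d ≤
      ∑ d, (autoCorr f (a⁻¹ * d) ^ 2 + autoCorr f d ^ 2) / 2 :=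
    Finset.sum_le_sum fun d _ => by
      linarith [two_mul_le_add_sq (autoCorr f (a⁻¹ * d)) (autoCorr f d)]
  rw [← Finset.sum_div, Finset.sum_add_distrib, h1] at h2
  linarith

theorem sum_autoCorr (f : ZMod p → ℝ) (hf : ∑ x, f x = 0) : ∑ d, autoCorr f d = 0 := by
  simp only [autoCorr]
  rw [Finset.sum_comm]
  refine Finset.sum_eq_zero fun x _ => ?_
  have h : ∑ d, f (d + x) = ∑ d, f d := Equiv.sum_comp (Equiv.addRight x) f
  rw [← Finset.mul_sum, h, hf, mul_zero]

theorem sum_sq_affCorr (f : ZMod p → ℝ) (hf : ∑ x, f x = 0) :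
    ∑ l ∈ Finset.univ.filter (fun l : ZMod p × ZMod p => l.1 ≠ 0), affCorr f l ^ 2 =
      p * autoCorr f 0 ^ 2 := by
  have h0 : Finset.univ.filter (fun l : ZMod p × ZMod p => l.1 ≠ 0) =
      (Finset.univ.erase 0) ×ˢ Finset.univ := by
    ext l; simp
  rw [h0, Finset.sum_product]
  rw [Finset.sum_congr rfl fun a ha => sum_sq_affCorr_slope f (Finset.ne_of_mem_erase ha)]
  rw [Finset.sum_comm, ← Finset.add_sum_erase _ _ (Finset.mem_univ (0 : ZMod p))]
  have hsum := sum_autoCorr f hf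
  rw [← Finset.add_sum_erase _ _ (Finset.mem_univ (0 : ZMod p))] at hsum
  have h1 : ∀ d ∈ Finset.univ.erase (0 : ZMod p),
      ∑ a ∈ Finset.univ.erase (0 : ZMod p), autoCorr f (a⁻¹ * d) * autoCorr f d =
        -autoCorr f 0 * autoCorr f d := by
    intro d hd
    have hd0 := Finset.ne_of_mem_erase hd
    rw [← Finset.sum_mul]
    congr 1
    rw [← eq_neg_iff_add_eq_zero.2 (by rw [add_comm]; exact hsum)]
    refine Finset.sum_bij' (fun a _ => a⁻¹ * d) (fun e _ => d * e⁻¹) ?_ ?_ ?_ ?_ ?_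
    · intro a ha
      simpa [hd0] using ha
    · intro a ha
      simpa [hd0] using ha
    · intro a ha
      have := Finset.ne_of_mem_erase ha
      field_simp
    · intro a ha
      have := Finset.ne_of_mem_erase ha
      field_simp
    · intro a _; rfl
  rw [Finset.sum_congr rfl h1, ← Finset.mul_sum]
  simp only [mul_zero, Finset.sum_const, Finset.card_erase_of_mem (Finset.mem_univ _),
    Finset.card_univ, ZMod.card, nsmul_eq_mul]
  rw [Nat.cast_sub (Fact.out : p.Prime).one_le, Nat.cast_one]
  linear_combination -(autoCorr f 0) * hsum

theorem sum_units_eq (h : ZMod p → ℝ) :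
    ∑ y : (ZMod p)ˣ, h y = ∑ y ∈ Finset.univ.erase (0 : ZMod p), h y := by
  refine Finset.sum_bij (fun y _ => (y : ZMod p)) ?_ ?_ ?_ ?_
  · intro y _; simp
  · intro y _ z _ h; exact Units.ext h
  · intro y hy
    exact ⟨Units.mk0 y (Finset.ne_of_mem_erase hy), Finset.mem_univ _, rfl⟩
  · intro y _; rfl

theorem mulEfun_eq (u : ZMod p → ℝ) :
    mulEfun u = ∑ π, (∑ x, ∑ w, if x * w = π then u x * u w else 0) ^ 2 := by
  have h1 : ∀ g : ZMod p → ZMod p → ZMod p → ℝ,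
      ∑ y, ∑ z, ∑ w, g y z w = ∑ w, ∑ z, ∑ y, g y z w := by
    intro g
    rw [Finset.sum_comm]
    refine (Finset.sum_congr rfl fun z _ => Finset.sum_comm).trans ?_
    rw [Finset.sum_comm]
  simp only [sq, Finset.sum_mul]
  simp only [Finset.mul_sum, mulEfun]
  symm
  refine Finset.sum_comm.trans (Finset.sum_congr rfl fun x _ => ?_)
  refine Eq.trans ?_ (h1 _).symm
  refine Finset.sum_comm.trans (Finset.sum_congr rfl fun w _ => ?_)
  refine Finset.sum_comm.trans (Finset.sum_congr rfl fun z _ => ?_)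
  refine Finset.sum_comm.trans (Finset.sum_congr rfl fun y _ => ?_)
  simp only [ite_mul, zero_mul]
  rw [Finset.sum_ite_eq]
  simp only [Finset.mem_univ, if_true, eq_comm (a := z * y), mul_ite, mul_zero]
  split_ifs
  · ring
  · rfl

theorem mulEfun_nonneg (u : ZMod p → ℝ) : 0 ≤ mulEfun u := by
  rw [mulEfun_eq]; positivity

theorem sum_sq_unit_autocorrelation_le (u : ZMod p → ℝ) :
    ∑ l : (ZMod p)ˣ, (∑ y : (ZMod p)ˣ, u y * u ((l * y : (ZMod p)ˣ))) ^ 2 ≤ mulEfun u := by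
  let v : (ZMod p)ˣ → ℝ := fun y => u y
  have h1 := sum_sq_correlation v fun y => v y⁻¹
  simp only [autocorrelation_inv] at h1
  have h2 : ∑ l : (ZMod p)ˣ, (∑ y : (ZMod p)ˣ, u y * u ((l * y : (ZMod p)ˣ))) ^ 2 =
      ∑ a, (∑ y, v y * v (a * y)⁻¹) ^ 2 := by
    rw [h1]
    exact Finset.sum_congr rfl fun l _ => sq _
  rw [h2, mulEfun_eq, ← Equiv.sum_comp (Equiv.inv (ZMod p)ˣ)]
  have h3 : ∀ a : (ZMod p)ˣ, ∑ y, v y * v ((Equiv.inv (ZMod p)ˣ) a * y)⁻¹ =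
      ∑ x, ∑ w, if x * w = (a : ZMod p) then u x * u w else 0 := by
    intro a
    rw [← Finset.add_sum_erase _ _ (Finset.mem_univ (0 : ZMod p)), ← sum_units_eq]
    have h4 : ∑ w, (if 0 * w = (a : ZMod p) then u 0 * u w else 0) = 0 :=
      Finset.sum_eq_zero fun w _ => by rw [zero_mul, if_neg a.ne_zero.symm]
    rw [h4, zero_add]
    refine Finset.sum_congr rfl fun y _ => ?_
    have h5 : ∀ w : ZMod p, (y : ZMod p) * w = a ↔ (((a * y⁻¹ : (ZMod p)ˣ)) : ZMod p) = w := by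
      intro w
      rw [Units.val_mul, eq_comm, ← Units.eq_mul_inv_iff_mul_eq, mul_comm w, inv_inv]
    simp only [h5, Finset.sum_ite_eq, Finset.mem_univ, if_true, v]
    rw [Equiv.inv_apply, mul_inv_rev, inv_inv, mul_comm y⁻¹]
  simp only [h3]
  rw [sum_units_eq fun a => (∑ x, ∑ w, if x * w = a then u x * u w else 0) ^ 2]
  exact Finset.sum_le_sum_of_subset_of_nonneg (Finset.erase_subset _ _) fun _ _ _ => sq_nonneg _

theorem sum_sq_affCorr_concurrent_le (f : ZMod p → ℝ) (s t : ZMod p) :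
    ∑ a : (ZMod p)ˣ, (affCorr f (a, t - a * s) - f s * f t) ^ 2 ≤ mulEbarFun f := by
  let u : ZMod p → ℝ := fun x => f (x + s)
  let w : ZMod p → ℝ := fun x => f (x + t)
  have h1 : ∀ a : (ZMod p)ˣ, affCorr f (a, t - a * s) - f s * f t =
      ∑ y : (ZMod p)ˣ, u y * w ((a * y : (ZMod p)ˣ)) := by
    intro a
    rw [affCorr, ← Equiv.sum_comp (Equiv.addRight s),
      ← Finset.add_sum_erase _ _ (Finset.mem_univ (0 : ZMod p)), ← sum_units_eq]
    simp only [Equiv.coe_addRight, zero_add, u, w, Units.val_mul]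
    rw [add_sub_cancel, add_sub_cancel_left]
    refine Finset.sum_congr rfl fun y _ => ?_
    rw [show (a : ZMod p) * (y + s) + (t - a * s) = a * y + t by ring]
  have h2 := sum_sq_correlation (fun y : (ZMod p)ˣ => u y) fun y => w y
  have hle : ∀ s : ZMod p, mulEfun (fun x => f (x + s)) ≤ mulEbarFun f := fun s =>
    le_ciSup (f := fun s => mulEfun fun x => f (x + s)) (Set.finite_range _).bddAbove s
  have h3 := (sum_sq_unit_autocorrelation_le u).trans (hle s)
  have h4 := (sum_sq_unit_autocorrelation_le w).trans (hle t)
  simp only [h1]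
  rw [h2]
  have h5 : ∑ l : (ZMod p)ˣ, (∑ y : (ZMod p)ˣ, u y * u ((l * y : (ZMod p)ˣ))) *
      ∑ y : (ZMod p)ˣ, w y * w ((l * y : (ZMod p)ˣ)) ≤
      ∑ l : (ZMod p)ˣ, ((∑ y : (ZMod p)ˣ, u y * u ((l * y : (ZMod p)ˣ))) ^ 2 +
        (∑ y : (ZMod p)ˣ, w y * w ((l * y : (ZMod p)ˣ))) ^ 2) / 2 :=
    Finset.sum_le_sum fun l _ => by
      set U := ∑ y : (ZMod p)ˣ, u y * u ((l * y : (ZMod p)ˣ))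
      set W := ∑ y : (ZMod p)ˣ, w y * w ((l * y : (ZMod p)ˣ))
      linarith [two_mul_le_add_sq U W]
  rw [← Finset.sum_div, Finset.sum_add_distrib] at h5
  linarith

theorem mulEbarFun_nonneg (f : ZMod p → ℝ) : 0 ≤ mulEbarFun f :=
  Real.iSup_nonneg fun _ => mulEfun_nonneg _

end Moments

section Incidence

open MvPolynomial

theorem meetCount_le_of_card_le {K : Type*} [Field K] (p : ℕ) [CharP K p] {k n : ℕ} (hk : 1 ≤ k)
    (hn : 1 ≤ n) (hp : 256 * n < p ^ 2) {R B : Finset (K × K × K)} (hR : AlignedBound k R)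
    (hB : AlignedBound k B) (hRn : R.card ≤ n) (hBn : B.card ≤ n) :
    (meetCount R B : ℝ) ≤ 64 * n * √n + 2 * k * n := by
  have hs0 : 1 ≤ Nat.sqrt n := Nat.sqrt_pos.2 hn
  have hs1 : 16 * Nat.sqrt n < p := by
    have := Nat.sqrt_le' n
    refine lt_of_pow_lt_pow_left₀ 2 (Nat.zero_le _) (lt_of_le_of_lt ?_ hp)
    nlinarith
  have hs2 := Nat.lt_succ_sqrt' n
  have h := meetCount_le p hk (s := Nat.sqrt n + 1) (by omega) hR hB (hRn.trans_lt hs2)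
    (hBn.trans_lt hs2)
  have h' : meetCount R B ≤ (16 * (Nat.sqrt n + 1) + k) * (n + n) :=
    h.trans (Nat.mul_le_mul_left _ (Nat.add_le_add hRn hBn))
  have hs3 : (Nat.sqrt n : ℝ) ≤ √n := Real.nat_sqrt_le_real_sqrt
  have hs4 : (1 : ℝ) ≤ √n := by
    rw [Real.one_le_sqrt]; exact_mod_cast hn
  have h'' : (meetCount R B : ℝ) ≤ (16 * (Nat.sqrt n + 1) + k) * (n + n) := by exact_mod_cast h'
  have hn0 : (0 : ℝ) ≤ n := Nat.cast_nonneg n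
  nlinarith [mul_le_mul_of_nonneg_left hs3 hn0, mul_le_mul_of_nonneg_left hs4 hn0]

theorem meetCount_image {ι κ K : Type*} [Field K] {I : Finset ι} {J : Finset κ}
    {e : ι → K × K × K} {e' : κ → K × K × K} (he : Set.InjOn e I) (he' : Set.InjOn e' J) :
    (meetCount (I.image e) (J.image e') : ℝ) =
      ∑ j ∈ J, ∑ i ∈ I, if Meets (e i) (e' j) then (1 : ℝ) else 0 := by
  rw [meetCount, Finset.sum_image he', Nat.cast_sum]
  refine Finset.sum_congr rfl fun j _ => ?_
  rw [Finset.filter_image, Finset.card_image_of_injOn (he.mono (Finset.filter_subset _ _)),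
    Finset.card_filter]
  push_cast
  rfl

/-- The involution negating the first two coordinates. -/
def negFirstTwo {K : Type*} [Neg K] (r : K × K × K) : K × K × K := (-r.1, -r.2.1, r.2.2)

theorem MvPolynomial.AlignedBound.image_negFirstTwo {K : Type*} [Field K] {k : ℕ} {R : Finset (K × K × K)}
    (h : AlignedBound k R) : AlignedBound k (R.image negFirstTwo) := by
  intro r₁ hr₁ r₂ hr₂ hne
  obtain ⟨r₁, hr₁', rfl⟩ := Finset.mem_image.1 hr₁
  obtain ⟨r₂, hr₂', rfl⟩ := Finset.mem_image.1 hr₂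
  refine le_trans ?_ (h r₁ hr₁' r₂ hr₂' fun h => hne (by rw [h]))
  rw [Finset.filter_image]
  have : ∀ r, Aligned (negFirstTwo r₁) (negFirstTwo r₂) (negFirstTwo r) ↔ Aligned r₁ r₂ r := by
    intro r
    simp only [Aligned, negFirstTwo]
    refine and_congr ?_ (and_congr ?_ ?_)
    · constructor <;> intro h <;> linear_combination h
    · constructor <;> intro h <;> linear_combination -h
    · constructor <;> intro h <;> linear_combination -h
  simp only [this]
  exact Finset.card_image_le

end Incidence

section RichLines

open MvPolynomial

variable {F : Type*} [Field F]

theorem nPts_eq (A : Finset F) (l : F × F) :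
    nPts A A l = (A.filter fun x => l.1 * x + l.2 ∈ A).card := by
  rw [nPts]
  refine Finset.card_bij (fun q _ => q.1) ?_ ?_ ?_
  · intro q hq
    simp only [Finset.mem_filter, Finset.mem_product] at hq ⊢
    exact ⟨hq.1.1, hq.2 ▸ hq.1.2⟩
  · intro q hq q' hq' h
    simp only [Finset.mem_filter, Finset.mem_product] at hq hq'
    exact Prod.ext h (by rw [hq.2, hq'.2, h])
  · intro x hx
    simp only [Finset.mem_filter] at hx
    exact ⟨(x, l.1 * x + l.2), by simp [hx.1, hx.2], rfl⟩

theorem nPts_le_card (A : Finset F) (l : F × F) : nPts A A l ≤ A.card := by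
  rw [nPts_eq]; exact Finset.card_filter_le _ _

/-- Rich lines that meet pairwise at most above a fixed abscissa are few. -/
theorem card_mul_le_of_pencil {A : Finset F} {P : Finset (F × F)} {δ : ℝ} (hδ : 2 ≤ δ)
    (hr : ∀ l ∈ P, δ ≤ nPts A A l) (s : F)
    (hP : ∀ l ∈ P, ∀ l' ∈ P, ∀ x, x ≠ s → l.1 * x + l.2 = l'.1 * x + l'.2 → l = l') :
    P.card * δ ≤ 2 * A.card ^ 2 := by
  let T : F × F → Finset (F × F) := fun l =>
    ((A.filter fun x => l.1 * x + l.2 ∈ A).erase s).image fun x => (x, l.1 * x + l.2)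
  have h1 : (P.biUnion T).card = ∑ l ∈ P, (T l).card := by
    refine Finset.card_biUnion fun l hl l' hl' hne => ?_
    rw [Function.onFun, Finset.disjoint_left]
    intro q hq hq'
    simp only [T, Finset.mem_image, Finset.mem_erase] at hq hq'
    obtain ⟨x, hx, rfl⟩ := hq
    obtain ⟨x', hx', h⟩ := hq'
    simp only [Prod.mk.injEq] at h
    rw [h.1] at h
    exact hne (hP l hl l' hl' x hx.1 h.2.symm)
  have h2 : (P.biUnion T).card ≤ A.card ^ 2 := by
    rw [sq, ← Finset.card_product]
    refine Finset.card_le_card fun q hq => ?_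
    simp only [T, Finset.mem_biUnion, Finset.mem_image, Finset.mem_erase, Finset.mem_filter] at hq
    obtain ⟨l, _, x, hx, rfl⟩ := hq
    exact Finset.mem_product.2 hx.2
  have h3 : ∀ l ∈ P, δ / 2 ≤ ((T l).card : ℝ) := by
    intro l hl
    have h4 : nPts A A l ≤ (T l).card + 1 := by
      rw [nPts_eq, Finset.card_image_of_injective _ fun x y h => (Prod.mk.inj h).1]
      exact Nat.sub_le_iff_le_add.1 Finset.pred_card_le_card_erase
    have h5 : (nPts A A l : ℝ) ≤ (T l).card + 1 := by exact_mod_cast h4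
    linarith [hr l hl]
  have h6 := Finset.sum_le_sum h3
  rw [Finset.sum_const, nsmul_eq_mul] at h6
  have h7 : (∑ l ∈ P, ((T l).card : ℝ)) ≤ A.card ^ 2 := by
    rw [h1] at h2
    exact_mod_cast h2
  linarith

/-- The points `(a, x, b)` encoding a line `(a, b)` together with an abscissa `x`. -/
def lineAbscissa {F : Type*} (q : (F × F) × F) : F × F × F := (q.1.1, q.2, q.1.2)

theorem lineAbscissa_injective {F : Type*} : Function.Injective (lineAbscissa (F := F)) := by
  rintro ⟨⟨a, b⟩, x⟩ ⟨⟨a', b'⟩, x'⟩ h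
  simp only [lineAbscissa, Prod.mk.injEq] at h ⊢
  exact ⟨⟨h.1, h.2.2⟩, h.2.1⟩

theorem negFirstTwo_injective : Function.Injective (negFirstTwo (K := F)) := by
  rintro ⟨a, b, x⟩ ⟨a', b', x'⟩ h
  simpa only [negFirstTwo, Prod.mk.injEq, neg_inj] using h

theorem alignedBound_lineAbscissa {A : Finset F} {P : Finset (F × F)} {δ : ℝ} (hδ : 2 ≤ δ)
    (hr : ∀ l ∈ P, δ ≤ nPts A A l) :
    AlignedBound (A.card + ⌊2 * (A.card : ℝ) ^ 2 / δ⌋₊) ((P ×ˢ A).image lineAbscissa) := by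
  have hmem : ∀ r, r ∈ (P ×ˢ A).image lineAbscissa → (r.1, r.2.2) ∈ P ∧ r.2.1 ∈ A := by
    intro r hr
    obtain ⟨q, hq, rfl⟩ := Finset.mem_image.1 hr
    exact Finset.mem_product.1 hq
  rintro ⟨a₁, x₁, b₁⟩ hr₁ ⟨a₂, x₂, b₂⟩ hr₂ hne
  by_cases hx : x₁ = x₂
  · subst hx
    refine le_trans ?_ (Nat.le_add_left _ _)
    have hab : a₂ - a₁ ≠ 0 ∨ b₂ - b₁ ≠ 0 := by
      by_contra! h
      rw [sub_eq_zero, sub_eq_zero] at h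
      exact hne (by rw [h.1, h.2])
    set Q := ((P ×ˢ A).image lineAbscissa).filter (Aligned (a₁, x₁, b₁) (a₂, x₁, b₂)) with hQ
    have hQx : ∀ r ∈ Q, r.2.1 = x₁ ∧ (r.1 - a₁) * (b₂ - b₁) = (r.2.2 - b₁) * (a₂ - a₁) := by
      intro r hr
      obtain ⟨h1, h2, h3⟩ := (Finset.mem_filter.1 hr).2
      simp only at h1 h2 h3
      refine ⟨?_, h2⟩
      rw [sub_self, mul_zero] at h1 h3
      rcases hab with h | h
      · exact sub_eq_zero.1 ((mul_eq_zero.1 h1.symm).resolve_right h)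
      · exact sub_eq_zero.1 ((mul_eq_zero.1 h3).resolve_right h)
    have hinj : Set.InjOn (fun r : F × F × F => (r.1, r.2.2)) Q := by
      intro r hr r' hr' h
      simp only [Prod.mk.injEq] at h
      exact Prod.ext h.1 (Prod.ext ((hQx r hr).1.trans (hQx r' hr').1.symm) h.2)
    rw [← Finset.card_image_of_injOn hinj]
    refine Nat.le_floor ?_
    rw [le_div_iff₀ (by linarith)]
    refine card_mul_le_of_pencil hδ ?_ (-(b₂ - b₁) / (a₂ - a₁)) ?_
    · intro l hl
      obtain ⟨r, hr', rfl⟩ := Finset.mem_image.1 hl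
      exact hr _ (hmem r (Finset.mem_filter.1 hr').1).1
    · intro l hl l' hl' x hxs h
      obtain ⟨r, hr, rfl⟩ := Finset.mem_image.1 hl
      obtain ⟨r', hr', rfl⟩ := Finset.mem_image.1 hl'
      have e1 := (hQx r hr).2
      have e2 := (hQx r' hr').2
      simp only at h
      have key : r.1 = r'.1 := by
        by_cases ha : a₂ - a₁ = 0
        · have hb := hab.resolve_left (not_not.2 ha)
          rw [ha, mul_zero, mul_eq_zero, or_iff_left hb, sub_eq_zero] at e1 e2
          rw [e1, e2]
        · have h4 : (r.1 - r'.1) * (x * (a₂ - a₁) + (b₂ - b₁)) = 0 := by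
            linear_combination (a₂ - a₁) * h + e1 - e2
          refine sub_eq_zero.1 ((mul_eq_zero.1 h4).resolve_right fun h5 => hxs ?_)
          rw [eq_div_iff ha]
          linear_combination h5
      rw [key] at h
      exact Prod.ext key (add_left_cancel h)
  · refine le_trans ?_ (Nat.le_add_right _ _)
    refine Finset.card_le_card_of_injOn (fun r => r.2.1) ?_ ?_
    · intro r hr
      exact (hmem r (Finset.mem_filter.1 hr).1).2
    · intro r hr r' hr' h
      obtain ⟨h1, -, h3⟩ := (Finset.mem_filter.1 hr).2
      obtain ⟨h1', -, h3'⟩ := (Finset.mem_filter.1 hr').2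
      simp only at h h1 h3 h1' h3'
      have hx' : x₂ - x₁ ≠ 0 := sub_ne_zero.2 (Ne.symm hx)
      rw [← h] at h1' h3'
      refine Prod.ext ?_ (Prod.ext h ?_)
      · exact sub_left_injective (mul_right_cancel₀ hx' (h1.trans h1'.symm))
      · exact sub_left_injective (mul_right_cancel₀ hx' (h3.symm.trans h3'))

theorem sq_sum_nPts_le (A : Finset F) (P : Finset (F × F)) :
    (∑ l ∈ P, (nPts A A l : ℝ)) ^ 2 ≤ A.card *
      meetCount ((P ×ˢ A).image lineAbscissa)
        (((P ×ˢ A).image lineAbscissa).image negFirstTwo) := by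
  let V : Finset F := (P ×ˢ A).image (fun q => q.1.1 * q.2 + q.1.2) ∪ A
  let c : F → ℝ := fun y => ∑ l ∈ P, ∑ x ∈ A, if l.1 * x + l.2 = y then (1 : ℝ) else 0
  have h1 : ∑ l ∈ P, (nPts A A l : ℝ) = ∑ y ∈ A, c y := by
    simp only [c]
    rw [Finset.sum_comm]
    refine Finset.sum_congr rfl fun l _ => ?_
    rw [Finset.sum_comm, nPts_eq, Finset.card_filter]
    push_cast
    exact Finset.sum_congr rfl fun x _ => (Finset.sum_ite_eq A (l.1 * x + l.2) fun _ => 1).symm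
  have h2 : (∑ y ∈ A, c y) ^ 2 ≤ A.card * ∑ y ∈ A, c y ^ 2 := sq_sum_le_card_mul_sum_sq
  have h3 : ∑ y ∈ A, c y ^ 2 ≤ ∑ y ∈ V, c y ^ 2 :=
    Finset.sum_le_sum_of_subset_of_nonneg Finset.subset_union_right fun _ _ _ => sq_nonneg _
  have h4 : ∑ y ∈ V, c y ^ 2 = meetCount ((P ×ˢ A).image lineAbscissa)
        (((P ×ˢ A).image lineAbscissa).image negFirstTwo) := by
    rw [Finset.image_image, meetCount_image lineAbscissa_injective.injOn
      (negFirstTwo_injective.comp lineAbscissa_injective).injOn]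
    have h5 : ∀ y, c y ^ 2 = ∑ l ∈ P, ∑ x ∈ A, ∑ l' ∈ P, ∑ x' ∈ A,
        (if l.1 * x + l.2 = y then (1 : ℝ) else 0) *
          if l'.1 * x' + l'.2 = y then (1 : ℝ) else 0 := by
      intro y
      simp only [c, sq, Finset.sum_mul]
      simp only [Finset.mul_sum]
    simp only [h5, Finset.sum_product]
    rw [Finset.sum_comm]
    refine Finset.sum_congr rfl fun l hl => ?_
    rw [Finset.sum_comm]
    refine (Finset.sum_congr rfl fun x _ => Finset.sum_comm).trans ?_
    rw [Finset.sum_comm]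
    conv_rhs => rw [Finset.sum_comm]
    refine Finset.sum_congr rfl fun l' hl' => ?_
    refine (Finset.sum_congr rfl fun x _ => Finset.sum_comm).trans ?_
    rw [Finset.sum_comm]
    refine Finset.sum_congr rfl fun x' hx' => Finset.sum_congr rfl fun x hx => ?_
    simp only [ite_mul, one_mul, zero_mul]
    rw [Finset.sum_ite_eq, if_pos (Finset.mem_union_left _ (Finset.mem_image.2
      ⟨(l, x), Finset.mem_product.2 ⟨hl, hx⟩, rfl⟩))]
    refine if_congr ?_ rfl rfl
    simp only [Meets, lineAbscissa, negFirstTwo, Function.comp_apply]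
    constructor <;> intro h <;> linear_combination h
  rw [h1]
  refine h2.trans ?_
  rw [← h4]
  gcongr

theorem card_richLines_le_of_lt (p : ℕ) [CharP F p] {A : Finset F} {P : Finset (F × F)}
    {δ : ℝ} (hδ : 2 ≤ δ) (hr : ∀ l ∈ P, δ ≤ nPts A A l)
    (hp : 256 * (A.card * P.card) < p ^ 2) :
    P.card * δ ^ 4 ≤ 36864 * (A.card : ℝ) ^ 5 := by
  rcases P.eq_empty_or_nonempty with rfl | ⟨l₀, hl₀⟩
  · simp
  have hδN : δ ≤ A.card := (hr l₀ hl₀).trans (by exact_mod_cast nPts_le_card A l₀)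
  have hN : 1 ≤ A.card := by
    have : (0 : ℝ) < A.card := by linarith
    exact_mod_cast this
  have hM : 1 ≤ P.card := Finset.card_pos.2 ⟨l₀, hl₀⟩
  have hal := alignedBound_lineAbscissa hδ hr
  have hc : ((P ×ˢ A).image lineAbscissa).card = A.card * P.card := by
    rw [Finset.card_image_of_injective _ lineAbscissa_injective, Finset.card_product, mul_comm]
  have h1 := meetCount_le_of_card_le p (by omega) (Nat.mul_pos hN hM) hp hal
    hal.image_negFirstTwo hc.le (Finset.card_image_le.trans hc.le)
  have h2 := sq_sum_nPts_le A P
  have h3 : P.card * δ ≤ ∑ l ∈ P, (nPts A A l : ℝ) := by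
    rw [← nsmul_eq_mul, ← Finset.sum_const]
    exact Finset.sum_le_sum hr
  set m : ℝ := (meetCount ((P ×ˢ A).image lineAbscissa)
        (((P ×ˢ A).image lineAbscissa).image negFirstTwo) : ℝ)
  have hfl : (⌊2 * (A.card : ℝ) ^ 2 / δ⌋₊ : ℝ) ≤ 2 * (A.card : ℝ) ^ 2 / δ :=
    Nat.floor_le (by positivity)
  have hNM : (1 : ℝ) ≤ A.card ∧ (1 : ℝ) ≤ P.card := ⟨by exact_mod_cast hN, by exact_mod_cast hM⟩
  push_cast at h1
  set f : ℝ := (⌊2 * (A.card : ℝ) ^ 2 / δ⌋₊ : ℝ)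
  generalize (A.card : ℝ) = N at *
  generalize (P.card : ℝ) = M at *
  have hM0 : 0 < M := by linarith [hNM.2]
  have hN0 : 0 < N := by linarith [hNM.1]
  have hδ0 : 0 < δ := by linarith
  have h4 : (M * δ) ^ 2 ≤ N * (64 * (N * M) * √(N * M) + 2 * (N + f) * (N * M)) :=
    (pow_le_pow_left₀ (by positivity) h3 2).trans (h2.trans (by gcongr))
  have hf : f * δ ≤ 2 * N ^ 2 := by rwa [le_div_iff₀ hδ0] at hfl
  have h5 : M * δ ^ 2 ≤ N * (64 * N * √(N * M) + 2 * (N + f) * N) := by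
    refine le_of_mul_le_mul_left ?_ hM0
    linarith
  have h6 : M * δ ^ 3 ≤ 64 * N ^ 2 * √(N * M) * δ + 6 * N ^ 4 := by
    have := mul_le_mul_of_nonneg_right h5 hδ0.le
    have h7 : N ^ 3 * δ ≤ N ^ 4 := by nlinarith [pow_pos hN0 3]
    have h8 : N ^ 2 * (f * δ) ≤ N ^ 2 * (2 * N ^ 2) := by gcongr
    nlinarith
  rcases le_total (64 * N ^ 2 * √(N * M) * δ) (6 * N ^ 4) with h | h
  · have h9 : M * δ ^ 3 * δ ≤ 12 * N ^ 4 * N :=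
      mul_le_mul (by linarith) hδN hδ0.le (by positivity)
    have := pow_pos hN0 5
    linarith
  · have h9 : M * δ ^ 2 ≤ 128 * N ^ 2 * √(N * M) := by
      refine le_of_mul_le_mul_right ?_ hδ0
      linarith
    have h10 := pow_le_pow_left₀ (by positivity) h9 2
    rw [mul_pow _ (√(N * M)), Real.sq_sqrt (by positivity)] at h10
    refine le_of_mul_le_mul_left ?_ hM0
    have := pow_pos hN0 5
    nlinarith

end RichLines

section Balanced

variable {p : ℕ} [Fact p.Prime]

theorem sum_balanced (A : Finset (ZMod p)) : ∑ x, balanced A x = 0 := by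
  have hp : (p : ℝ) ≠ 0 := Nat.cast_ne_zero.2 (NeZero.ne p)
  simp only [balanced, Finset.sum_sub_distrib, Finset.sum_ite_mem, Finset.univ_inter,
    Finset.sum_const, Finset.card_univ, ZMod.card, nsmul_eq_mul]
  field_simp
  ring

theorem affCorr_balanced (A : Finset (ZMod p)) {l : ZMod p × ZMod p} (hl : l.1 ≠ 0) :
    affCorr (balanced A) l = nPts A A l - (A.card : ℝ) ^ 2 / p := by
  have hp : (p : ℝ) ≠ 0 := Nat.cast_ne_zero.2 (NeZero.ne p)
  set c : ℝ := (A.card : ℝ) / p with hc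
  have h1 : ∀ x, balanced A x * balanced A (l.1 * x + l.2) =
      (if x ∈ A then balanced A (l.1 * x + l.2) else 0) - c * balanced A (l.1 * x + l.2) := by
    intro x
    rw [balanced, sub_mul]
    simp only [ite_mul, one_mul, zero_mul, balanced]
    rfl
  have h2 : ∑ x, balanced A (l.1 * x + l.2) = 0 := by
    rw [← sum_balanced A]
    exact Equiv.sum_comp ((Equiv.mulLeft₀ l.1 hl).trans (Equiv.addRight l.2)) (balanced A)
  simp only [affCorr, h1, Finset.sum_sub_distrib]
  rw [← Finset.mul_sum, h2, mul_zero, sub_zero, Finset.sum_ite_mem, Finset.univ_inter]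
  simp only [balanced]
  rw [Finset.sum_sub_distrib, Finset.sum_const, nsmul_eq_mul, nPts_eq, Finset.card_filter]
  push_cast
  ring

theorem affCorr_one (f : ZMod p → ℝ) (d : ZMod p) : affCorr f (1, d) = autoCorr f d := by
  simp only [affCorr, autoCorr, one_mul, add_comm]

theorem autoCorr_balanced_zero (A : Finset (ZMod p)) :
    autoCorr (balanced A) 0 = A.card - (A.card : ℝ) ^ 2 / p := by
  rw [← affCorr_one, affCorr_balanced A one_ne_zero, nPts_eq]
  simp

theorem sum_sq_balanced (A : Finset (ZMod p)) :
    ∑ x, balanced A x ^ 2 = A.card - (A.card : ℝ) ^ 2 / p := by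
  rw [← autoCorr_balanced_zero]
  simp only [autoCorr, zero_add, sq]

theorem card_div_le_one (A : Finset (ZMod p)) : (A.card : ℝ) / p ≤ 1 := by
  have hp : (0 : ℝ) < p := Nat.cast_pos.2 (NeZero.pos p)
  rw [div_le_one hp]
  have := A.card_le_univ
  rw [ZMod.card] at this
  exact_mod_cast this

theorem card_sq_div_le (A : Finset (ZMod p)) : (A.card : ℝ) ^ 2 / p ≤ A.card := by
  have := mul_le_mul_of_nonneg_left (card_div_le_one A) (Nat.cast_nonneg A.card)
  rw [mul_one] at this
  calc (A.card : ℝ) ^ 2 / p = A.card * (A.card / p) := by ring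
    _ ≤ _ := this

theorem abs_balanced_le (A : Finset (ZMod p)) (x : ZMod p) : |balanced A x| ≤ 1 := by
  have h1 := card_div_le_one A
  have h0 : (0 : ℝ) ≤ (A.card : ℝ) / p := by positivity
  rw [balanced, abs_le]
  split_ifs <;> constructor <;> linarith

theorem abs_affCorr_balanced_le (A : Finset (ZMod p)) {l : ZMod p × ZMod p} (hl : l.1 ≠ 0) :
    |affCorr (balanced A) l| ≤ A.card := by
  have h1 := card_sq_div_le A
  have h0 : (0 : ℝ) ≤ (A.card : ℝ) ^ 2 / p := by positivity
  have h2 : (nPts A A l : ℝ) ≤ A.card := by exact_mod_cast nPts_le_card A l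
  have h3 : (0 : ℝ) ≤ nPts A A l := Nat.cast_nonneg _
  rw [affCorr_balanced A hl, abs_le]
  constructor <;> linarith

theorem addEfun_balanced_le (A : Finset (ZMod p)) :
    addEfun (balanced A) ≤ p * (A.card : ℝ) ^ 2 := by
  rw [addEfun_eq]
  calc ∑ d, autoCorr (balanced A) d ^ 2 ≤ ∑ _d : ZMod p, (A.card : ℝ) ^ 2 :=
        Finset.sum_le_sum fun d _ => by
          rw [← affCorr_one, ← sq_abs]
          exact pow_le_pow_left₀ (abs_nonneg _) (abs_affCorr_balanced_le A one_ne_zero) 2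
    _ = _ := by simp

theorem sq_le_addEfun_balanced (A : Finset (ZMod p)) :
    ((A.card : ℝ) - (A.card : ℝ) ^ 2 / p) ^ 2 ≤ addEfun (balanced A) := by
  rw [addEfun_eq, ← autoCorr_balanced_zero]
  exact Finset.single_le_sum (f := fun d => autoCorr (balanced A) d ^ 2)
    (fun d _ => sq_nonneg _) (Finset.mem_univ 0)

theorem sum_sq_affCorr_balanced_le (A : Finset (ZMod p)) :
    ∑ l ∈ Finset.univ.filter (fun l : ZMod p × ZMod p => l.1 ≠ 0), affCorr (balanced A) l ^ 2 ≤
      p * (A.card : ℝ) ^ 2 := by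
  rw [sum_sq_affCorr _ (sum_balanced A), autoCorr_balanced_zero]
  have h1 := card_sq_div_le A
  have h0 : (0 : ℝ) ≤ (A.card : ℝ) ^ 2 / p := by positivity
  exact mul_le_mul_of_nonneg_left (pow_le_pow_left₀ (by linarith) (by linarith) 2)
    (Nat.cast_nonneg p)

theorem card_mul_sq_le_of_forall_le (A : Finset (ZMod p)) {L : Finset (ZMod p × ZMod p)}
    (hL : ∀ l ∈ L, l.1 ≠ 0) {δ : ℝ} (hδ : 0 ≤ δ) (h : ∀ l ∈ L, δ ≤ |affCorr (balanced A) l|) :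
    L.card * δ ^ 2 ≤ p * (A.card : ℝ) ^ 2 := by
  refine le_trans ?_ (sum_sq_affCorr_balanced_le A)
  rw [← nsmul_eq_mul, ← Finset.sum_const]
  refine (Finset.sum_le_sum fun l hl => ?_).trans (Finset.sum_le_sum_of_subset_of_nonneg
    (fun l hl => Finset.mem_filter.2 ⟨Finset.mem_univ _, hL l hl⟩) fun _ _ _ => sq_nonneg _)
  rw [← sq_abs (affCorr _ l)]
  exact pow_le_pow_left₀ hδ (h l hl) 2

theorem card_mul_pow_four_le (A : Finset (ZMod p)) {L : Finset (ZMod p × ZMod p)}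
    (hL : ∀ l ∈ L, l.1 ≠ 0) {δ : ℝ} (hδ : 2 ≤ δ) (h : ∀ l ∈ L, δ ≤ |affCorr (balanced A) l|) :
    L.card * δ ^ 4 ≤ 36864 * (A.card : ℝ) ^ 5 := by
  have hp : (0 : ℝ) < p := Nat.cast_pos.2 (NeZero.pos p)
  have h2 := card_mul_sq_le_of_forall_le A hL (by linarith) h
  have hN0 : (0 : ℝ) ≤ A.card := Nat.cast_nonneg _
  by_cases hδN : δ ≤ (A.card : ℝ) ^ 2 / p
  · have h3 : δ ≤ A.card := hδN.trans (card_sq_div_le A)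
    rw [le_div_iff₀ hp] at hδN
    have h4 : (L.card * δ ^ 2) * δ ^ 2 ≤ (p * (A.card : ℝ) ^ 2) * δ ^ 2 := by gcongr
    have h5 : (A.card : ℝ) ^ 2 * δ * (δ * p) ≤ (A.card : ℝ) ^ 2 * A.card * (A.card : ℝ) ^ 2 := by
      gcongr
    have : 0 ≤ (A.card : ℝ) ^ 5 := by positivity
    nlinarith
  · push Not at hδN
    by_cases hlt : 256 * (A.card * L.card) < p ^ 2
    · refine card_richLines_le_of_lt p hδ (fun l hl => ?_) hlt
      have h3 := h l hl
      rw [affCorr_balanced A (hL l hl)] at h3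
      have h4 : (0 : ℝ) ≤ nPts A A l := Nat.cast_nonneg _
      have h5 : (0 : ℝ) ≤ (A.card : ℝ) ^ 2 / p := by positivity
      rcases le_abs.1 h3 with h6 | h6 <;> linarith
    · push Not at hlt
      have hlt' : (p : ℝ) ^ 2 ≤ 256 * (A.card * L.card) := by exact_mod_cast hlt
      rcases L.eq_empty_or_nonempty with rfl | hne
      · simp
      have hM : (0 : ℝ) < L.card := by exact_mod_cast hne.card_pos
      have h3 := pow_le_pow_left₀ (by positivity) h2 2
      have h4 : (p : ℝ) ^ 2 * (A.card : ℝ) ^ 4 ≤ 256 * (A.card * L.card) * (A.card : ℝ) ^ 4 := by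
        gcongr
      refine le_of_mul_le_mul_left ?_ hM
      have : 0 ≤ (A.card : ℝ) ^ 5 * L.card := by positivity
      nlinarith

/-- A tail bound for second moments from a fourth-power level set bound. -/
theorem sum_sq_tail_mul_le {ι : Type*} {S : Finset ι} {g : ι → ℝ} {K T : ℝ}
    (hT : ∀ i ∈ S, g i ≤ T)
    (h : ∀ t : ℝ, 2 ≤ t → ((S.filter fun i => t ≤ g i).card : ℝ) * t ^ 4 ≤ K) {δ : ℝ}
    (hδ : 2 ≤ δ) : (∑ i ∈ S.filter (fun i => δ ≤ g i), g i ^ 2) * δ ^ 2 ≤ 16 / 3 * K := by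
  obtain ⟨n, hn⟩ := pow_unbounded_of_one_lt T one_lt_two
  have hn' : T < 2 ^ n * δ := hn.trans_le (le_mul_of_one_le_right (by positivity) (by linarith))
  clear hn
  induction n generalizing δ with
  | zero =>
    have hK := (by positivity : (0 : ℝ) ≤ _).trans (h δ hδ)
    rw [Finset.filter_false_of_mem fun i hi => by have := hT i hi; linarith]
    simp only [Finset.sum_empty, zero_mul]
    positivity
  | succ n ih =>
    have h1 := ih (δ := 2 * δ) (by linarith) (by rw [pow_succ] at hn'; linarith)
    have h2 : ∑ i ∈ S.filter (fun i => δ ≤ g i), g i ^ 2 ≤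
        ∑ i ∈ S.filter (fun i => δ ≤ g i), ((2 * δ) ^ 2 + if 2 * δ ≤ g i then g i ^ 2 else 0) := by
      refine Finset.sum_le_sum fun i hi => ?_
      have hi' := (Finset.mem_filter.1 hi).2
      split_ifs with hc
      · linarith [sq_nonneg (2 * δ)]
      · rw [add_zero]
        exact pow_le_pow_left₀ (by linarith) (not_le.1 hc).le 2
    rw [Finset.sum_add_distrib, Finset.sum_const, nsmul_eq_mul, ← Finset.sum_filter,
      Finset.filter_filter] at h2
    rw [Finset.filter_congr (q := fun i => 2 * δ ≤ g i) fun i _ => and_iff_right_of_imp fun hi => by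
      linarith] at h2
    have h3 := mul_le_mul_of_nonneg_right h2 (sq_nonneg δ)
    have h4 := h δ hδ
    nlinarith

theorem sum_sq_affCorr_tail_le (A : Finset (ZMod p)) {δ : ℝ} (hδ : 2 ≤ δ) :
    (∑ l ∈ Finset.univ.filter
        (fun l : ZMod p × ZMod p => l.1 ≠ 0 ∧ δ ≤ |affCorr (balanced A) l|),
      affCorr (balanced A) l ^ 2) * δ ^ 2 ≤ 196608 * (A.card : ℝ) ^ 5 := by
  have h := sum_sq_tail_mul_le
    (S := Finset.univ.filter fun l : ZMod p × ZMod p => l.1 ≠ 0)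
    (g := fun l => |affCorr (balanced A) l|) (K := 36864 * (A.card : ℝ) ^ 5) (T := A.card)
    (fun l hl => abs_affCorr_balanced_le A (Finset.mem_filter.1 hl).2)
    (fun t ht => card_mul_pow_four_le A
      (fun l hl => (Finset.mem_filter.1 (Finset.mem_filter.1 hl).1).2) ht
      (fun l hl => (Finset.mem_filter.1 hl).2)) hδ
  simp only [sq_abs, Finset.filter_filter] at h
  linarith

end Balanced

section RatioEnergy

open MvPolynomial

variable {F : Type*} [Field F]

/-- The quotient `l ∘ l'⁻¹` of two affine maps. -/
def affQuot (l l' : F × F) : F × F := (l.1 / l'.1, l.2 - l.1 / l'.1 * l'.2)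

/-- The number of representations of `h` as a quotient of two maps in `L`. -/
noncomputable def quotReps (L : Finset (F × F)) (h : F × F) : ℕ :=
  ((L ×ˢ L).filter fun q => affQuot q.1 q.2 = h).card

/-- The triple attached to a pair of affine maps with a given product of slopes. -/
def pairTriple (q : (F × F) × F × F) : F × F × F := (q.2.1, q.2.2, q.1.2 * q.2.1)

theorem affQuot_eq_iff {l₁ l₂ l₃ l₄ : F × F} (h₂ : l₂.1 ≠ 0) (h₄ : l₄.1 ≠ 0) :
    affQuot l₁ l₂ = affQuot l₃ l₄ ↔
      l₁.1 * l₄.1 = l₂.1 * l₃.1 ∧ Meets (pairTriple (l₁, l₄)) (pairTriple (l₂, l₃)) := by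
  simp only [affQuot, Prod.mk.injEq, Meets, pairTriple]
  rw [div_eq_div_iff h₂ h₄, mul_comm l₂.1]
  refine and_congr_right fun h => ?_
  have e1 : l₁.1 / l₂.1 = l₃.1 / l₄.1 := (div_eq_div_iff h₂ h₄).2 h
  rw [e1]
  constructor
  · intro h'
    field_simp at h'
    linear_combination h'
  · intro h'
    field_simp
    linear_combination h'

theorem pairTriple_injOn (L : Finset (F × F)) (hL : ∀ l ∈ L, l.1 ≠ 0) (π : F) :
    Set.InjOn pairTriple
      (((L ×ˢ L).filter fun q => q.1.1 * q.2.1 = π : Finset ((F × F) × F × F)) :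
        Set ((F × F) × F × F)) := by
  rintro ⟨⟨a, b⟩, ⟨c, d⟩⟩ h ⟨⟨a', b'⟩, ⟨c', d'⟩⟩ h' heq
  simp only [Finset.coe_filter, Finset.mem_product, Set.mem_ofPred_eq] at h h'
  simp only [pairTriple, Prod.mk.injEq] at heq ⊢
  obtain ⟨rfl, rfl, h3⟩ := heq
  have hc := hL _ h.1.2
  exact ⟨⟨mul_right_cancel₀ hc (h.2.trans h'.2.symm), mul_right_cancel₀ hc h3⟩, rfl, rfl⟩

theorem sum_sq_quotReps [Fintype F] (L : Finset (F × F)) (hL : ∀ l ∈ L, l.1 ≠ 0) :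
    ∑ h, (quotReps L h : ℝ) ^ 2 = ∑ π : F,
      (meetCount (((L ×ˢ L).filter fun q => q.1.1 * q.2.1 = π).image pairTriple)
        (((L ×ˢ L).filter fun q => q.1.1 * q.2.1 = π).image pairTriple) : ℝ) := by
  have h1 : ∀ h, (quotReps L h : ℝ) ^ 2 = ∑ q ∈ L ×ˢ L, ∑ q' ∈ L ×ˢ L,
      (if affQuot q.1 q.2 = h then (1 : ℝ) else 0) *
        if affQuot q'.1 q'.2 = h then (1 : ℝ) else 0 := by
    intro h
    rw [quotReps, Finset.card_filter]
    push_cast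
    rw [sq, Finset.sum_mul_sum]
  have h2 : ∑ h, (quotReps L h : ℝ) ^ 2 = ∑ q ∈ L ×ˢ L, ∑ q' ∈ L ×ˢ L,
      if affQuot q.1 q.2 = affQuot q'.1 q'.2 then (1 : ℝ) else 0 := by
    simp only [h1]
    refine Finset.sum_comm.trans (Finset.sum_congr rfl fun q _ => ?_)
    refine Finset.sum_comm.trans (Finset.sum_congr rfl fun q' _ => ?_)
    simp only [ite_mul, one_mul, zero_mul]
    rw [Finset.sum_ite_eq, if_pos (Finset.mem_univ _)]
    exact if_congr eq_comm rfl rfl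
  have h3 : ∀ π : F, (meetCount (((L ×ˢ L).filter fun q => q.1.1 * q.2.1 = π).image pairTriple)
      (((L ×ˢ L).filter fun q => q.1.1 * q.2.1 = π).image pairTriple) : ℝ) =
      ∑ q ∈ L ×ˢ L, ∑ q' ∈ L ×ˢ L, if q.1.1 * q.2.1 = π then
        (if q'.1.1 * q'.2.1 = π then
          (if Meets (pairTriple q') (pairTriple q) then (1 : ℝ) else 0) else 0) else 0 := by
    intro π
    rw [meetCount_image (pairTriple_injOn L hL π) (pairTriple_injOn L hL π), Finset.sum_filter]
    refine Finset.sum_congr rfl fun q _ => ?_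
    rw [Finset.sum_filter]
    split_ifs
    · rfl
    · simp
  have h4 : ∑ π : F, (meetCount (((L ×ˢ L).filter fun q => q.1.1 * q.2.1 = π).image pairTriple)
      (((L ×ˢ L).filter fun q => q.1.1 * q.2.1 = π).image pairTriple) : ℝ) =
      ∑ q ∈ L ×ˢ L, ∑ q' ∈ L ×ˢ L, if q'.1.1 * q'.2.1 = q.1.1 * q.2.1 ∧
          Meets (pairTriple q') (pairTriple q) then (1 : ℝ) else 0 := by
    simp only [h3]
    refine Finset.sum_comm.trans (Finset.sum_congr rfl fun q _ => ?_)
    refine Finset.sum_comm.trans (Finset.sum_congr rfl fun q' _ => ?_)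
    rw [Finset.sum_ite_eq, if_pos (Finset.mem_univ _), ite_and]
  rw [h2, h4]
  simp only [Finset.sum_product]
  rw [Finset.sum_comm]
  refine Finset.sum_congr rfl fun l₂ h₂ => ?_
  rw [Finset.sum_comm]
  refine Finset.sum_congr rfl fun l₃ _ => Finset.sum_congr rfl fun l₁ _ =>
    Finset.sum_congr rfl fun l₄ h₄ => ?_
  exact if_congr (affQuot_eq_iff (hL _ h₂) (hL _ h₄)) rfl rfl

theorem alignedBound_pairTriple (L : Finset (F × F)) (hL : ∀ l ∈ L, l.1 ≠ 0) {M m : ℕ}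
    (hM : ∀ a, (L.filter fun l => l.1 = a).card ≤ M)
    (hm : ∀ s t, (L.filter fun l => l.1 * s + l.2 = t).card ≤ m) (π : F) :
    AlignedBound (M + m) (((L ×ˢ L).filter fun q => q.1.1 * q.2.1 = π).image pairTriple) := by
  set S := ((L ×ˢ L).filter fun q => q.1.1 * q.2.1 = π).image pairTriple with hS
  have hmem : ∀ r ∈ S, (r.1, r.2.1) ∈ L ∧ r.1 ≠ 0 ∧ (π / r.1, r.2.2 / r.1) ∈ L := by
    intro r hr
    obtain ⟨⟨⟨a, b⟩, ⟨c, d⟩⟩, hq, rfl⟩ := Finset.mem_image.1 hr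
    simp only [Finset.mem_filter, Finset.mem_product] at hq
    have hc : c ≠ 0 := hL _ hq.1.2
    refine ⟨hq.1.2, hc, ?_⟩
    simp only [pairTriple, ← hq.2]
    rw [mul_div_cancel_right₀ _ hc, mul_div_cancel_right₀ _ hc]
    exact hq.1.1
  rintro ⟨a₁, b₁, c₁⟩ hr₁ ⟨a₂, b₂, c₂⟩ hr₂ hne
  set Q := S.filter (Aligned (a₁, b₁, c₁) (a₂, b₂, c₂)) with hQ
  have hQ' : ∀ r ∈ Q, r ∈ S ∧ (r.1 - a₁) * (b₂ - b₁) = (r.2.1 - b₁) * (a₂ - a₁) ∧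
      (r.1 - a₁) * (c₂ - c₁) = (r.2.2 - c₁) * (a₂ - a₁) ∧
      (r.2.1 - b₁) * (c₂ - c₁) = (r.2.2 - c₁) * (b₂ - b₁) := fun r hr => Finset.mem_filter.1 hr
  have haux : ∀ T : Finset (F × F), (∀ r ∈ Q, (r.1, r.2.1) ∈ T) →
      (∀ r ∈ Q, ∀ r' ∈ Q, r.1 = r'.1 → r.2.1 = r'.2.1 → r.2.2 = r'.2.2) → Q.card ≤ T.card := by
    intro T hT hinj
    refine Finset.card_le_card_of_injOn (fun r => (r.1, r.2.1)) hT ?_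
    intro r hr r' hr' h
    simp only [Prod.mk.injEq] at h
    exact Prod.ext h.1 (Prod.ext h.2 (hinj r hr r' hr' h.1 h.2))
  by_cases ha : a₂ - a₁ = 0
  · refine le_trans ?_ (Nat.le_add_right _ _)
    have hbc : b₂ - b₁ ≠ 0 ∨ c₂ - c₁ ≠ 0 := by
      by_contra! h
      rw [sub_eq_zero] at h ha
      rw [sub_eq_zero] at h
      exact hne (by rw [ha, h.1, h.2])
    have hQa : ∀ r ∈ Q, r.1 = a₁ := by
      intro r hr
      obtain ⟨-, h1, h2, -⟩ := hQ' r hr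
      rw [ha, mul_zero] at h1 h2
      rcases hbc with h | h
      · exact sub_eq_zero.1 ((mul_eq_zero.1 h1).resolve_right h)
      · exact sub_eq_zero.1 ((mul_eq_zero.1 h2).resolve_right h)
    by_cases hb : b₂ - b₁ = 0
    · have hc := hbc.resolve_left (not_not.2 hb)
      refine le_trans ?_ (hM (π / a₁))
      refine Finset.card_le_card_of_injOn (fun r => (π / r.1, r.2.2 / r.1)) ?_ ?_
      · intro r hr
        refine Finset.mem_filter.2 ⟨(hmem r (hQ' r hr).1).2.2, ?_⟩
        simp only [hQa r hr]
      · intro r hr r' hr' h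
        have h0 := (hmem r (hQ' r hr).1).2.1
        have e1 := (hQ' r hr).2.2.2
        have e2 := (hQ' r' hr').2.2.2
        rw [hb, mul_zero, mul_eq_zero, or_iff_left hc, sub_eq_zero] at e1 e2
        simp only [Prod.mk.injEq] at h
        have h3 := h.2
        rw [hQa r' hr', ← hQa r hr, div_left_inj' h0] at h3
        exact Prod.ext ((hQa r hr).trans (hQa r' hr').symm) (Prod.ext (e1.trans e2.symm) h3)
    · refine (haux (L.filter fun l => l.1 = a₁) (fun r hr => Finset.mem_filter.2
        ⟨(hmem r (hQ' r hr).1).1, hQa r hr⟩) ?_).trans (hM a₁)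
      intro r hr r' hr' _ h
      have e1 := (hQ' r hr).2.2.2
      have e2 := (hQ' r' hr').2.2.2
      rw [h] at e1
      exact sub_left_injective (mul_right_cancel₀ hb (e1.symm.trans e2))
  · refine le_trans ?_ (Nat.le_add_left _ _)
    refine (haux (L.filter fun l => l.1 * (-(b₂ - b₁) / (a₂ - a₁)) + l.2 =
      a₁ * (-(b₂ - b₁) / (a₂ - a₁)) + b₁) (fun r hr => Finset.mem_filter.2
        ⟨(hmem r (hQ' r hr).1).1, ?_⟩) ?_).trans (hm _ _)
    · have e1 := (hQ' r hr).2.1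
      simp only
      field_simp
      linear_combination -e1
    · intro r hr r' hr' h _
      have e1 := (hQ' r hr).2.2.1
      have e2 := (hQ' r' hr').2.2.1
      rw [h] at e1
      exact sub_left_injective (mul_right_cancel₀ ha (e1.symm.trans e2))

theorem sum_sq_quotReps_le [Fintype F] (p : ℕ) [CharP F p] (L : Finset (F × F))
    (hL : ∀ l ∈ L, l.1 ≠ 0) {M m : ℝ}
    (hM : ∀ a, ((L.filter fun l => l.1 = a).card : ℝ) ≤ M) (hML : M ≤ L.card)
    (hm : ∀ s t, ((L.filter fun l => l.1 * s + l.2 = t).card : ℝ) ≤ m)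
    (hp : 256 * (M * L.card) < (p : ℝ) ^ 2) :
    ∑ h, (quotReps L h : ℝ) ^ 2 ≤
      66 * √(M * L.card) * (L.card : ℝ) ^ 2 + 2 * m * (L.card : ℝ) ^ 2 := by
  rw [sum_sq_quotReps L hL]
  rcases L.eq_empty_or_nonempty with rfl | ⟨l₀, hl₀⟩
  · simp [meetCount]
  have hM1 : 1 ≤ M := by
    refine le_trans ?_ (hM l₀.1)
    have h : l₀ ∈ L.filter fun l => l.1 = l₀.1 := Finset.mem_filter.2 ⟨hl₀, rfl⟩
    exact_mod_cast Finset.card_pos.2 ⟨l₀, h⟩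
  have hm0 : 0 ≤ m := (Nat.cast_nonneg _).trans (hm 0 0)
  have hal := alignedBound_pairTriple L hL (M := ⌊M⌋₊) (m := ⌊m⌋₊)
    (fun a => Nat.le_floor (hM a)) (fun s t => Nat.le_floor (hm s t))
  set n : F → ℕ := fun π => ((L ×ˢ L).filter fun q => q.1.1 * q.2.1 = π).card with hn
  have hnle : ∀ π, (n π : ℝ) ≤ M * L.card := by
    intro π
    have h1 : n π ≤ ∑ l ∈ L, (L.filter fun l' => l'.1 = π / l.1).card := by
      simp only [n, Finset.card_filter, Finset.sum_product]
      rw [Finset.sum_comm]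
      refine Finset.sum_le_sum fun l hl => Finset.sum_le_sum fun l' _ => le_of_eq ?_
      exact if_congr (eq_div_iff (hL l hl)).symm rfl rfl
    calc (n π : ℝ) ≤ ∑ l ∈ L, ((L.filter fun l' => l'.1 = π / l.1).card : ℝ) := by
          exact_mod_cast h1
      _ ≤ ∑ _l ∈ L, M := Finset.sum_le_sum fun l _ => hM _
      _ = _ := by rw [Finset.sum_const, nsmul_eq_mul, mul_comm]
  have hsum : ∑ π, (n π : ℝ) = (L.card : ℝ) ^ 2 := by
    have := Finset.card_eq_sum_card_fiberwise (s := L ×ˢ L) (t := Finset.univ)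
      (f := fun q => q.1.1 * q.2.1) fun _ _ => Finset.mem_univ _
    rw [Finset.card_product] at this
    rw [sq]
    exact_mod_cast this.symm
  have hML' : M ≤ √(M * L.card) := Real.le_sqrt_of_sq_le (by nlinarith)
  have hfin : ∀ π : F,
      (meetCount (((L ×ˢ L).filter fun q => q.1.1 * q.2.1 = π).image pairTriple)
        (((L ×ˢ L).filter fun q => q.1.1 * q.2.1 = π).image pairTriple) : ℝ) ≤
      n π * (66 * √(M * L.card) + 2 * m) := by
    intro π
    rcases Nat.eq_zero_or_pos (n π) with h0 | hpos
    · rw [Finset.card_eq_zero.1 h0, h0]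
      simp [meetCount]
    · have h1 := meetCount_le_of_card_le p
        (by have : 1 ≤ ⌊M⌋₊ := Nat.le_floor (by exact_mod_cast hM1)
            omega) hpos
        (by have h2 : (256 * n π : ℝ) < (p : ℝ) ^ 2 := by linarith [hnle π]
            exact_mod_cast h2) (hal π) (hal π) Finset.card_image_le Finset.card_image_le
      refine h1.trans ?_
      have h3 : √(n π : ℝ) ≤ √(M * L.card) := Real.sqrt_le_sqrt (hnle π)
      have h4 : ((⌊M⌋₊ + ⌊m⌋₊ : ℕ) : ℝ) ≤ √(M * L.card) + m := by
        push_cast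
        exact add_le_add ((Nat.floor_le (by linarith)).trans hML') (Nat.floor_le hm0)
      have hn0 : (0 : ℝ) ≤ n π := Nat.cast_nonneg _
      nlinarith [mul_le_mul_of_nonneg_left h3 hn0, mul_le_mul_of_nonneg_left h4 hn0]
  refine (Finset.sum_le_sum fun π _ => hfin π).trans ?_
  rw [← Finset.sum_mul, hsum]
  linarith

end RatioEnergy

section LevelSets

variable {p : ℕ} [Fact p.Prime]

theorem affCorr_affQuot (f : ZMod p → ℝ) (l : ZMod p × ZMod p) {l' : ZMod p × ZMod p}
    (hl' : l'.1 ≠ 0) :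
    affCorr f (affQuot l l') = ∑ x, f (l'.1 * x + l'.2) * f (l.1 * x + l.2) := by
  rw [affCorr, ← Equiv.sum_comp ((Equiv.mulLeft₀ l'.1 hl').trans (Equiv.addRight l'.2))]
  refine Finset.sum_congr rfl fun x _ => ?_
  simp only [Equiv.trans_apply, Equiv.mulLeft₀_apply, Equiv.coe_addRight, affQuot]
  congr 2
  field_simp
  ring

theorem sq_sum_abs_affCorr_le (f : ZMod p → ℝ) {L : Finset (ZMod p × ZMod p)}
    (hL : ∀ l ∈ L, l.1 ≠ 0) :
    (∑ l ∈ L, |affCorr f l|) ^ 2 ≤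
      (∑ x, f x ^ 2) * ∑ h, (quotReps L h : ℝ) * |affCorr f h| := by
  let ε : ZMod p × ZMod p → ℝ := fun l => SignType.sign (affCorr f l)
  have hε : ∀ l, |ε l| ≤ 1 := by
    intro l
    simp only [ε]
    rcases lt_trichotomy (affCorr f l) 0 with h | h | h <;> simp [h]
  let u : ZMod p → ℝ := fun x => ∑ l ∈ L, ε l * f (l.1 * x + l.2)
  have h1 : ∑ l ∈ L, |affCorr f l| = ∑ x, f x * u x := by
    simp only [u, Finset.mul_sum]
    rw [Finset.sum_comm]
    refine Finset.sum_congr rfl fun l _ => ?_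
    rw [← sign_mul_self, affCorr, Finset.mul_sum]
    exact Finset.sum_congr rfl fun x _ => by simp only [ε, affCorr]; ring
  have h2 : (∑ x, f x * u x) ^ 2 ≤ (∑ x, f x ^ 2) * ∑ x, u x ^ 2 :=
    Finset.sum_mul_sq_le_sq_mul_sq _ _ _
  have h3 : ∑ x, u x ^ 2 = ∑ l ∈ L, ∑ l' ∈ L, ε l * ε l' * affCorr f (affQuot l l') := by
    simp only [u, sq, Finset.sum_mul_sum]
    refine Finset.sum_comm.trans (Finset.sum_congr rfl fun l _ => ?_)
    refine Finset.sum_comm.trans (Finset.sum_congr rfl fun l' hl' => ?_)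
    rw [affCorr_affQuot f l (hL l' hl'), Finset.mul_sum]
    exact Finset.sum_congr rfl fun x _ => by ring
  have h4 : ∑ x, u x ^ 2 ≤ ∑ l ∈ L, ∑ l' ∈ L, |affCorr f (affQuot l l')| := by
    rw [h3]
    refine Finset.sum_le_sum fun l _ => Finset.sum_le_sum fun l' _ => ?_
    refine (le_abs_self _).trans ?_
    rw [abs_mul, abs_mul]
    exact mul_le_of_le_one_left (abs_nonneg _)
      (mul_le_one₀ (hε l) (abs_nonneg _) (hε l'))
  have h5 : ∑ h, (quotReps L h : ℝ) * |affCorr f h| =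
      ∑ l ∈ L, ∑ l' ∈ L, |affCorr f (affQuot l l')| := by
    rw [← Finset.sum_product' (f := fun l l' => |affCorr f (affQuot l l')|)]
    have h6 : ∀ h, (quotReps L h : ℝ) * |affCorr f h| =
        ∑ q ∈ L ×ˢ L, if affQuot q.1 q.2 = h then |affCorr f h| else 0 := by
      intro h
      rw [← Finset.sum_filter, Finset.sum_const, nsmul_eq_mul, quotReps]
      congr
    simp only [h6]
    refine Finset.sum_comm.trans (Finset.sum_congr rfl fun q _ => ?_)
    rw [Finset.sum_ite_eq, if_pos (Finset.mem_univ _)]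
  rw [h1, h5]
  exact h2.trans (mul_le_mul_of_nonneg_left h4 (Finset.sum_nonneg fun _ _ => sq_nonneg _))

theorem sum_quotReps {F : Type*} [Field F] [Fintype F] (L : Finset (F × F)) :
    ∑ h, (quotReps L h : ℝ) = (L.card : ℝ) ^ 2 := by
  have := Finset.card_eq_sum_card_fiberwise (s := L ×ˢ L) (t := Finset.univ)
    (f := fun q => affQuot q.1 q.2) fun _ _ => Finset.mem_univ _
  rw [Finset.card_product] at this
  rw [sq]
  exact_mod_cast this.symm

theorem quotReps_eq_zero {F : Type*} [Field F] {L : Finset (F × F)} (hL : ∀ l ∈ L, l.1 ≠ 0)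
    {h : F × F} (hh : h.1 = 0) : quotReps L h = 0 := by
  rw [quotReps, Finset.card_eq_zero, Finset.filter_eq_empty_iff]
  rintro ⟨l, l'⟩ hq rfl
  rw [Finset.mem_product] at hq
  exact div_ne_zero (hL _ hq.1) (hL _ hq.2) hh

theorem card_pow_four_mul_le (A : Finset (ZMod p)) {L : Finset (ZMod p × ZMod p)}
    (hL : ∀ l ∈ L, l.1 ≠ 0) {Δ : ℝ} (hN : 1 ≤ A.card) (hΔ0 : 0 ≤ Δ) (hΔ : 4 * A.card ≤ Δ ^ 2)
    (h : ∀ l ∈ L, Δ ≤ |affCorr (balanced A) l|) :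
    (L.card : ℝ) ^ 4 * Δ ^ 8 ≤
      3145728 * (A.card : ℝ) ^ 9 * ∑ h, (quotReps L h : ℝ) ^ 2 := by
  set f := balanced A with hf
  have hN0 : (0 : ℝ) < A.card := by exact_mod_cast hN
  set N : ℝ := (A.card : ℝ) with hNdef
  set δ : ℝ := Δ ^ 2 / (2 * N) with hδ
  have hδ2 : 2 ≤ δ := by rw [hδ, le_div_iff₀ (by positivity)]; linarith
  set D := Finset.univ.filter
    (fun l : ZMod p × ZMod p => l.1 ≠ 0 ∧ δ ≤ |affCorr f l|) with hD
  have h1 : (L.card * Δ) ^ 2 ≤ N * ∑ h, (quotReps L h : ℝ) * |affCorr f h| := by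
    have h2 : L.card * Δ ≤ ∑ l ∈ L, |affCorr f l| := by
      rw [← nsmul_eq_mul, ← Finset.sum_const]
      exact Finset.sum_le_sum h
    refine (pow_le_pow_left₀ (by positivity) h2 2).trans ((sq_sum_abs_affCorr_le f hL).trans ?_)
    refine mul_le_mul_of_nonneg_right ?_ (Finset.sum_nonneg fun _ _ => by positivity)
    rw [hf, sum_sq_balanced]
    have : (0 : ℝ) ≤ (A.card : ℝ) ^ 2 / p := by positivity
    linarith
  have h2 : ∑ h, (quotReps L h : ℝ) * |affCorr f h| ≤
      (L.card : ℝ) ^ 2 * δ + ∑ h ∈ D, (quotReps L h : ℝ) * |affCorr f h| := by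
    rw [← sum_quotReps, Finset.sum_mul, hD, Finset.sum_filter, ← Finset.sum_add_distrib]
    refine Finset.sum_le_sum fun h _ => ?_
    split_ifs with hc
    · have : 0 ≤ (quotReps L h : ℝ) * δ := by positivity
      linarith
    · rw [add_zero]
      by_cases hh : h.1 = 0
      · rw [quotReps_eq_zero hL hh]; simp
      · have : |affCorr f h| < δ := by
          by_contra! h'
          exact hc ⟨hh, h'⟩
        gcongr
  have h3 : (∑ h ∈ D, (quotReps L h : ℝ) * |affCorr f h|) ^ 2 ≤
      (∑ h, (quotReps L h : ℝ) ^ 2) * ∑ h ∈ D, affCorr f h ^ 2 := by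
    refine (Finset.sum_mul_sq_le_sq_mul_sq _ _ _).trans ?_
    simp only [sq_abs]
    refine mul_le_mul_of_nonneg_right ?_ (Finset.sum_nonneg fun _ _ => sq_nonneg _)
    exact Finset.sum_le_sum_of_subset_of_nonneg (Finset.subset_univ _) fun _ _ _ => sq_nonneg _
  have h4 : (∑ h ∈ D, affCorr f h ^ 2) * δ ^ 2 ≤ 196608 * N ^ 5 := sum_sq_affCorr_tail_le A hδ2
  have hS0 : 0 ≤ ∑ h ∈ D, (quotReps L h : ℝ) * |affCorr f h| :=
    Finset.sum_nonneg fun _ _ => by positivity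
  have hE0 : 0 ≤ ∑ h, (quotReps L h : ℝ) ^ 2 := Finset.sum_nonneg fun _ _ => sq_nonneg _
  set S := ∑ h ∈ D, (quotReps L h : ℝ) * |affCorr f h|
  set E := ∑ h, (quotReps L h : ℝ) ^ 2
  set Γ := ∑ h ∈ D, affCorr f h ^ 2
  have hδN : N * δ = Δ ^ 2 / 2 := by rw [hδ]; field_simp
  have h5 : (L.card : ℝ) ^ 2 * Δ ^ 2 / 2 ≤ N * S := by
    have := h1.trans (mul_le_mul_of_nonneg_left h2 hN0.le)
    have h6 : N * ((L.card : ℝ) ^ 2 * δ + S) = (L.card : ℝ) ^ 2 * (N * δ) + N * S := by ring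
    rw [h6, hδN] at this
    linarith
  have h6 := pow_le_pow_left₀ (by positivity) h5 2
  have h7 : Γ * Δ ^ 4 ≤ 786432 * N ^ 7 := by
    have e : Δ ^ 4 = 4 * N ^ 2 * δ ^ 2 := by
      have : (N * δ) ^ 2 = (Δ ^ 2 / 2) ^ 2 := by rw [hδN]
      linarith
    rw [e]
    have := mul_le_mul_of_nonneg_left h4 (by positivity : 0 ≤ 4 * N ^ 2)
    linarith
  calc (L.card : ℝ) ^ 4 * Δ ^ 8 = 4 * ((L.card : ℝ) ^ 2 * Δ ^ 2 / 2) ^ 2 * Δ ^ 4 := by ring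
    _ ≤ 4 * (N * S) ^ 2 * Δ ^ 4 := by gcongr
    _ = 4 * N ^ 2 * Δ ^ 4 * S ^ 2 := by ring
    _ ≤ 4 * N ^ 2 * Δ ^ 4 * (E * Γ) := by gcongr
    _ = 4 * N ^ 2 * E * (Γ * Δ ^ 4) := by ring
    _ ≤ 4 * N ^ 2 * E * (786432 * N ^ 7) := by gcongr
    _ = _ := by ring

theorem card_slope_mul_le (f : ZMod p → ℝ) {L : Finset (ZMod p × ZMod p)}
    (hL : ∀ l ∈ L, l.1 ≠ 0) {Δ : ℝ} (hΔ0 : 0 ≤ Δ) (h : ∀ l ∈ L, Δ ≤ |affCorr f l|)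
    (a : ZMod p) : ((L.filter fun l => l.1 = a).card : ℝ) * Δ ^ 2 ≤ addEfun f := by
  by_cases ha : a = 0
  · rw [Finset.filter_false_of_mem fun l hl => by rw [ha]; exact hL l hl]
    simpa using addEfun_nonneg f
  refine le_trans ?_ (sum_sq_affCorr_slope_le f ha)
  have h1 : ((L.filter fun l => l.1 = a).card : ℝ) * Δ ^ 2 ≤
      ∑ l ∈ L.filter (fun l => l.1 = a), affCorr f (a, l.2) ^ 2 := by
    rw [← nsmul_eq_mul, ← Finset.sum_const]
    refine Finset.sum_le_sum fun l hl => ?_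
    obtain ⟨hlL, rfl⟩ := Finset.mem_filter.1 hl
    rw [← sq_abs (affCorr f _)]
    exact pow_le_pow_left₀ hΔ0 (h l hlL) 2
  refine h1.trans ?_
  rw [← Finset.sum_image (f := fun b => affCorr f (a, b) ^ 2) (g := Prod.snd)]
  · exact Finset.sum_le_sum_of_subset_of_nonneg (Finset.subset_univ _) fun _ _ _ => sq_nonneg _
  · intro l hl l' hl' heq
    exact Prod.ext ((Finset.mem_filter.1 hl).2.trans (Finset.mem_filter.1 hl').2.symm) heq

theorem card_concurrent_mul_le (A : Finset (ZMod p)) {L : Finset (ZMod p × ZMod p)}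
    (hL : ∀ l ∈ L, l.1 ≠ 0) {Δ : ℝ} (hΔ : 2 ≤ Δ) (h : ∀ l ∈ L, Δ ≤ |affCorr (balanced A) l|)
    (s t : ZMod p) :
    ((L.filter fun l => l.1 * s + l.2 = t).card : ℝ) * Δ ^ 2 ≤
      4 * mulEbarFun (balanced A) := by
  set f := balanced A
  have h0 := sum_sq_affCorr_concurrent_le f s t
  rw [sum_units_eq fun a => (affCorr f (a, t - a * s) - f s * f t) ^ 2] at h0
  have hfs : |f s * f t| ≤ 1 := by
    rw [abs_mul]
    exact mul_le_one₀ (abs_balanced_le A s) (abs_nonneg _) (abs_balanced_le A t)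
  have h1 : ((L.filter fun l => l.1 * s + l.2 = t).card : ℝ) * (Δ / 2) ^ 2 ≤
      ∑ l ∈ L.filter (fun l => l.1 * s + l.2 = t),
        (affCorr f (l.1, t - l.1 * s) - f s * f t) ^ 2 := by
    rw [← nsmul_eq_mul, ← Finset.sum_const]
    refine Finset.sum_le_sum fun l hl => ?_
    obtain ⟨hlL, rfl⟩ := Finset.mem_filter.1 hl
    rw [add_sub_cancel_left, ← sq_abs (affCorr f _ - _)]
    refine pow_le_pow_left₀ (by linarith) ?_ 2
    have h2 := abs_sub_abs_le_abs_sub (affCorr f l) (f s * f (l.1 * s + l.2))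
    have h3 := h l hlL
    linarith
  rw [← Finset.sum_image (f := fun a => (affCorr f (a, t - a * s) - f s * f t) ^ 2)
    (g := Prod.fst)] at h1
  · have h2 : ∑ a ∈ (L.filter fun l => l.1 * s + l.2 = t).image Prod.fst,
        (affCorr f (a, t - a * s) - f s * f t) ^ 2 ≤
        ∑ a ∈ Finset.univ.erase 0, (affCorr f (a, t - a * s) - f s * f t) ^ 2 := by
      refine Finset.sum_le_sum_of_subset_of_nonneg ?_ fun _ _ _ => sq_nonneg _
      intro a ha
      obtain ⟨l, hl, rfl⟩ := Finset.mem_image.1 ha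
      exact Finset.mem_erase.2 ⟨hL l (Finset.mem_filter.1 hl).1, Finset.mem_univ _⟩
    linarith
  · intro l hl l' hl' heq
    have e1 := (Finset.mem_filter.1 hl).2
    have e2 := (Finset.mem_filter.1 hl').2
    rw [heq, ← e2] at e1
    exact Prod.ext heq (add_left_cancel e1)

theorem mul_pow_five_le_of_pow_ten_le {lam Δ h e q : ℝ} (hlam : 0 < lam) (hΔ : 0 < Δ) (hh : 0 ≤ h)
    (he : 0 ≤ e) (hq : 0 ≤ q) (h4 : lam * Δ ^ 2 ≤ 192 * h ^ 5)
    (h10 : lam ^ 4 * Δ ^ 10 ≤ 3145728 * h ^ 18 * (66 * (e ^ 3 * lam * Δ) + 8 * q ^ 2)) :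
    lam ^ 2 * Δ ^ 5 ≤ 147456 * (h ^ 11 * e + h ^ 9 * q) := by
  have hq' : 0 ≤ h ^ 9 * q := by positivity
  have he' : 0 ≤ h ^ 11 * e := by positivity
  rcases le_total (8 * q ^ 2) (66 * (e ^ 3 * lam * Δ)) with hc | hc
  · have h1 : lam ^ 4 * Δ ^ 10 ≤ 3145728 * h ^ 18 * (2 * (66 * (e ^ 3 * lam * Δ))) :=
      h10.trans (by gcongr; linarith)
    have h2 : (lam * Δ ^ 3) ^ 3 ≤ (750 * (h ^ 6 * e)) ^ 3 := by
      refine le_of_mul_le_mul_right ?_ (mul_pos hlam hΔ)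
      have : 0 ≤ h ^ 18 * e ^ 3 * (lam * Δ) := by positivity
      linarith
    have h3 := le_of_pow_le_pow_left₀ (by norm_num) (by positivity) h2
    calc lam ^ 2 * Δ ^ 5 = (lam * Δ ^ 3) * (lam * Δ ^ 2) := by ring
      _ ≤ (750 * (h ^ 6 * e)) * (192 * h ^ 5) := by gcongr
      _ ≤ _ := by linarith
  · have h1 : lam ^ 4 * Δ ^ 10 ≤ 3145728 * h ^ 18 * (2 * (8 * q ^ 2)) :=
      h10.trans (by gcongr; linarith)
    have h2 : (lam ^ 2 * Δ ^ 5) ^ 2 ≤ (7100 * (h ^ 9 * q)) ^ 2 := by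
      have : 0 ≤ h ^ 18 * q ^ 2 := by positivity
      linarith
    have h3 := le_of_pow_le_pow_left₀ (by norm_num) (by positivity) h2
    linarith

theorem card_mul_pow_five_le (A : Finset (ZMod p)) {L : Finset (ZMod p × ZMod p)}
    (hL : ∀ l ∈ L, l.1 ≠ 0) {Δ : ℝ} (hN : 1 ≤ A.card) (hΔ0 : 0 ≤ Δ) (hΔ : 4 * A.card ≤ Δ ^ 2)
    (hLΔ : ∀ l ∈ L, Δ ≤ |affCorr (balanced A) l|) {e h q : ℝ} (he : 0 ≤ e) (hh : 0 ≤ h)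
    (hq : 0 ≤ q) (he6 : e ^ 6 = addEfun (balanced A)) (hh2 : h ^ 2 = A.card)
    (hq2 : q ^ 2 = mulEbarFun (balanced A)) :
    L.card * Δ ^ 5 ≤ 147456 * (h ^ 11 * e + h ^ 9 * q) := by
  have hN1 : (1 : ℝ) ≤ A.card := by exact_mod_cast hN
  have hΔ2 : 2 ≤ Δ := le_of_pow_le_pow_left₀ two_ne_zero hΔ0 (by linarith)
  have hΔpos : 0 < Δ := by linarith
  have hp0 : (0 : ℝ) < p := Nat.cast_pos.2 (NeZero.pos p)
  rcases L.eq_empty_or_nonempty with rfl | hne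
  · simp only [Finset.card_empty, Nat.cast_zero, zero_mul]
    positivity
  have hLpos : (0 : ℝ) < L.card := by exact_mod_cast hne.card_pos
  have h4 := card_mul_pow_four_le A hL hΔ2 hLΔ
  have h2 := card_mul_sq_le_of_forall_le A hL hΔ0 hLΔ
  have h8 := card_pow_four_mul_le A hL hN hΔ0 hΔ hLΔ
  have hEp := addEfun_balanced_le A
  have hNp : (A.card : ℝ) ≤ p := by
    have := card_div_le_one A
    rwa [div_le_one hp0] at this
  have hM := card_slope_mul_le (balanced A) hL hΔ0 hLΔ
  have hm := card_concurrent_mul_le A hL hΔ2 hLΔ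
  rw [← he6] at hM hEp
  rw [← hq2] at hm
  rw [← hh2] at h4 h2 h8 hEp hNp
  by_cases hsmall : Δ ≤ 4 * (h * e)
  · have h5 : (L.card * Δ ^ 4) * Δ ≤ (36864 * (h ^ 2) ^ 5) * (4 * (h * e)) := by gcongr
    have : 0 ≤ h ^ 9 * q := by positivity
    linarith
  push Not at hsmall
  have hep : e ^ 2 ≤ p := by
    refine le_of_pow_le_pow_left₀ three_ne_zero hp0.le ?_
    calc (e ^ 2) ^ 3 = e ^ 6 := by ring
      _ ≤ p * (h ^ 2) ^ 2 := hEp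
      _ ≤ p * (p : ℝ) ^ 2 := by gcongr
      _ = _ := by ring
  set M : ℝ := min (e ^ 6 / Δ ^ 2) L.card with hMdef
  have hM0 : 0 ≤ M := le_min (by positivity) hLpos.le
  have hMΔ : M * Δ ^ 2 ≤ e ^ 6 := by
    rw [← le_div_iff₀ (by positivity)]; exact min_le_left _ _
  have hcond : 256 * (M * L.card) < (p : ℝ) ^ 2 := by
    refine lt_of_mul_lt_mul_right ?_ (pow_pos hΔpos 4).le
    calc 256 * (M * L.card) * Δ ^ 4 = 256 * ((M * Δ ^ 2) * (L.card * Δ ^ 2)) := by ring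
      _ ≤ 256 * (e ^ 6 * (p * (h ^ 2) ^ 2)) := by gcongr
      _ = (4 * (h * e)) ^ 4 * (p * e ^ 2) := by ring
      _ ≤ (4 * (h * e)) ^ 4 * (p * p) := by gcongr
      _ < Δ ^ 4 * (p * p) := by gcongr
      _ = _ := by ring
  have hen := sum_sq_quotReps_le p L hL (M := M) (m := 4 * q ^ 2 / Δ ^ 2)
    (fun a => le_min ((le_of_eq (by congr)).trans ((le_div_iff₀ (by positivity)).2 (hM a)))
      (Nat.cast_le.2 ((le_of_eq (by congr)).trans (Finset.card_filter_le L fun l => l.1 = a))))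
    (min_le_right _ _) (fun s t =>
      (le_of_eq (by congr)).trans ((le_div_iff₀ (by positivity)).2 (hm s t))) hcond
  set lam : ℝ := √(L.card : ℝ) with hlam
  have hlam0 : 0 < lam := Real.sqrt_pos.2 hLpos
  have hlam2 : lam ^ 2 = L.card := Real.sq_sqrt hLpos.le
  rw [← hlam2] at h4 h8 hen ⊢
  have hsq : √(M * lam ^ 2) * Δ ≤ e ^ 3 * lam := by
    refine le_of_pow_le_pow_left₀ two_ne_zero (by positivity) ?_
    rw [mul_pow, Real.sq_sqrt (by positivity)]
    calc M * lam ^ 2 * Δ ^ 2 = (M * Δ ^ 2) * lam ^ 2 := by ring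
      _ ≤ e ^ 6 * lam ^ 2 := by gcongr
      _ = _ := by ring
  refine mul_pow_five_le_of_pow_ten_le hlam0 hΔpos hh he hq ?_ ?_
  · refine le_of_pow_le_pow_left₀ two_ne_zero (by positivity) ?_
    linarith
  · refine le_of_mul_le_mul_left ?_ (pow_pos hlam0 4)
    have hcancel : 4 * q ^ 2 / Δ ^ 2 * Δ ^ 2 = 4 * q ^ 2 := by field_simp
    have e1 := mul_le_mul_of_nonneg_right (h8.trans (mul_le_mul_of_nonneg_left hen
      (by positivity))) (sq_nonneg Δ)
    calc lam ^ 4 * (lam ^ 4 * Δ ^ 10) = (lam ^ 2) ^ 4 * Δ ^ 8 * Δ ^ 2 := by ring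
      _ ≤ _ := e1
      _ = 3145728 * h ^ 18 * lam ^ 4 * (66 * (√(M * lam ^ 2) * Δ * Δ) +
          2 * (4 * q ^ 2 / Δ ^ 2 * Δ ^ 2)) := by ring
      _ ≤ 3145728 * h ^ 18 * lam ^ 4 * (66 * (e ^ 3 * lam * Δ) + 2 * (4 * q ^ 2)) := by
          rw [hcancel]
          gcongr
      _ = _ := by ring

end LevelSets

section Assembly

/-- A tail bound for fifth moments from a level set bound, losing the number of dyadic scales. -/
theorem sum_pow_five_tail_le {ι : Type*} {S : Finset ι} {g : ι → ℝ} {K T : ℝ}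
    (hT : ∀ i ∈ S, g i ≤ T) {t : ℝ} (ht : 0 < t)
    (h : ∀ s : ℝ, t ≤ s → ((S.filter fun i => s ≤ g i).card : ℝ) * s ^ 5 ≤ K) {n : ℕ}
    (hn : T < 2 ^ n * t) : ∑ i ∈ S.filter (fun i => t ≤ g i), g i ^ 5 ≤ n * (32 * K) := by
  induction n generalizing t with
  | zero =>
    rw [Finset.filter_false_of_mem fun i hi => by have := hT i hi; linarith]
    simp
  | succ n ih =>
    have h1 := ih (t := 2 * t) (by linarith) (fun s hs => h s (by linarith))
      (by rw [pow_succ] at hn; linarith)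
    have h2 : ∑ i ∈ S.filter (fun i => t ≤ g i), g i ^ 5 ≤
        ∑ i ∈ S.filter (fun i => t ≤ g i), ((2 * t) ^ 5 + if 2 * t ≤ g i then g i ^ 5 else 0) := by
      refine Finset.sum_le_sum fun i hi => ?_
      have hi' := (Finset.mem_filter.1 hi).2
      split_ifs with hc
      · have : 0 ≤ (2 * t) ^ 5 := by positivity
        linarith
      · rw [add_zero]
        exact pow_le_pow_left₀ (by linarith) (not_le.1 hc).le 5
    rw [Finset.sum_add_distrib, Finset.sum_const, nsmul_eq_mul, ← Finset.sum_filter,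
      Finset.filter_filter] at h2
    rw [Finset.filter_congr (q := fun i => 2 * t ≤ g i) fun i _ => and_iff_right_of_imp fun hi => by
      linarith] at h2
    have h4 := h t le_rfl
    push_cast
    linarith

theorem sum_nPts_mul_pred_le {F : Type*} [Field F] (A : Finset F) (P : Finset (F × F)) :
    ∑ l ∈ P, (nPts A A l : ℝ) * (nPts A A l - 1) ≤ (A.card : ℝ) ^ 4 := by
  let T : F × F → Finset ((F × F) × F × F) := fun l =>
    (A.filter fun x => l.1 * x + l.2 ∈ A).offDiag.image
      fun q => ((q.1, l.1 * q.1 + l.2), (q.2, l.1 * q.2 + l.2))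
  have h1 : (P.biUnion T).card = ∑ l ∈ P, (T l).card := by
    refine Finset.card_biUnion fun l hl l' hl' hne => ?_
    rw [Function.onFun, Finset.disjoint_left]
    intro q hq hq'
    simp only [T, Finset.mem_image, Finset.mem_offDiag] at hq hq'
    obtain ⟨⟨x, y⟩, hx, rfl⟩ := hq
    obtain ⟨⟨x', y'⟩, hx', h⟩ := hq'
    simp only [Prod.mk.injEq] at h hx
    obtain ⟨⟨rfl, h2⟩, rfl, h4⟩ := h
    have key : l.1 = l'.1 :=
      mul_right_cancel₀ (sub_ne_zero.2 hx.2.2) (by linear_combination h4 - h2)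
    rw [key] at h2
    exact hne (Prod.ext key (add_left_cancel h2).symm)
  have h2 : (P.biUnion T).card ≤ A.card ^ 4 := by
    have : A.card ^ 4 = ((A ×ˢ A) ×ˢ A ×ˢ A).card := by
      simp only [Finset.card_product]; ring
    rw [this]
    refine Finset.card_le_card fun q hq => ?_
    simp only [T, Finset.mem_biUnion, Finset.mem_image, Finset.mem_offDiag,
      Finset.mem_filter] at hq
    obtain ⟨l, _, x, hx, rfl⟩ := hq
    simp only [Finset.mem_product]
    exact ⟨hx.1, hx.2.1⟩
  have h3 : ∀ l, (nPts A A l : ℝ) * (nPts A A l - 1) = (T l).card := by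
    intro l
    rw [Finset.card_image_of_injective, Finset.offDiag_card, ← nPts_eq,
      Nat.cast_sub (Nat.le_mul_self _)]
    · push_cast; ring
    · rintro ⟨x, y⟩ ⟨x', y'⟩ h
      simp only [Prod.mk.injEq] at h ⊢
      exact ⟨h.1.1, h.2.1⟩
  simp only [h3]
  rw [h1] at h2
  exact_mod_cast h2

variable {p : ℕ} [Fact p.Prime]

theorem sum_sq_affCorr_richLines_le (A : Finset (ZMod p)) :
    ∑ l ∈ Finset.univ.filter (fun l : ZMod p × ZMod p => l.1 ≠ 0 ∧ 2 ≤ nPts A A l),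
      affCorr (balanced A) l ^ 2 ≤ 2 * (A.card : ℝ) ^ 4 := by
  have hp0 : (0 : ℝ) < p := Nat.cast_pos.2 (NeZero.pos p)
  by_cases hp : (p : ℝ) ≤ (A.card : ℝ) ^ 2
  · have h1 := sum_sq_affCorr_balanced_le A
    have h2 : (p : ℝ) * (A.card : ℝ) ^ 2 ≤ (A.card : ℝ) ^ 2 * (A.card : ℝ) ^ 2 := by gcongr
    have h3 : ∑ l ∈ Finset.univ.filter (fun l : ZMod p × ZMod p => l.1 ≠ 0 ∧ 2 ≤ nPts A A l),
        affCorr (balanced A) l ^ 2 ≤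
        ∑ l ∈ Finset.univ.filter (fun l : ZMod p × ZMod p => l.1 ≠ 0),
          affCorr (balanced A) l ^ 2 :=
      Finset.sum_le_sum_of_subset_of_nonneg
        (Finset.monotone_filter_right _ fun l _ h => h.1) fun _ _ _ => sq_nonneg _
    have h4 : 0 ≤ (A.card : ℝ) ^ 4 := by positivity
    linarith
  · push Not at hp
    have h1 := mul_le_mul_of_nonneg_left (sum_nPts_mul_pred_le A
      (Finset.univ.filter fun l : ZMod p × ZMod p => l.1 ≠ 0 ∧ 2 ≤ nPts A A l)) zero_le_two
    refine le_trans ?_ h1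
    rw [Finset.mul_sum]
    refine Finset.sum_le_sum fun l hl => ?_
    obtain ⟨hl1, hl2⟩ := (Finset.mem_filter.1 hl).2
    rw [affCorr_balanced A hl1]
    have hl2' : (2 : ℝ) ≤ nPts A A l := by exact_mod_cast hl2
    have h3 : (A.card : ℝ) ^ 2 / p ≤ 1 := (div_le_one hp0).2 hp.le
    have h4 : (0 : ℝ) ≤ (A.card : ℝ) ^ 2 / p := by positivity
    nlinarith

theorem one_half_le_of_pow_six_eq (A : Finset (ZMod p)) (hN : 2 ≤ A.card) (hNp : A.card < p)
    {e : ℝ} (he : 0 ≤ e) (he6 : e ^ 6 = addEfun (balanced A)) : 1 / 2 ≤ e := by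
  have hp0 : (0 : ℝ) < p := Nat.cast_pos.2 (NeZero.pos p)
  have h1 := sq_le_addEfun_balanced A
  rw [← he6] at h1
  have hN' : (2 : ℝ) ≤ A.card := by exact_mod_cast hN
  have hNp' : (A.card : ℝ) + 1 ≤ p := by exact_mod_cast hNp
  have h2 : 1 / 2 ≤ (A.card : ℝ) - (A.card : ℝ) ^ 2 / p := by
    rw [show (A.card : ℝ) - (A.card : ℝ) ^ 2 / p = A.card * (p - A.card) / p by field_simp,
      le_div_iff₀ hp0]
    nlinarith
  refine le_of_pow_le_pow_left₀ (by norm_num : 6 ≠ 0) he ?_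
  nlinarith

theorem sum_pow_five_low_le (A : Finset (ZMod p)) {h : ℝ} (hh : 0 ≤ h)
    (hh2 : h ^ 2 = A.card) :
    ∑ l ∈ (Finset.univ.filter (fun l : ZMod p × ZMod p => l.1 ≠ 0 ∧ 2 ≤ nPts A A l)).filter
      (fun l => ¬ 2 * h ≤ |affCorr (balanced A) l|), |affCorr (balanced A) l| ^ 5 ≤
      16 * h ^ 11 := by
  have h1 := mul_le_mul_of_nonneg_left (sum_sq_affCorr_richLines_le A)
    (by positivity : 0 ≤ (2 * h) ^ 3)
  rw [← hh2, Finset.mul_sum] at h1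
  have h2 : (2 * h) ^ 3 * (2 * (h ^ 2) ^ 4) = 16 * h ^ 11 := by ring
  rw [← h2]
  refine le_trans ?_ h1
  refine (Finset.sum_le_sum fun l hl => ?_).trans (Finset.sum_le_sum_of_subset_of_nonneg
    (Finset.filter_subset _ _) fun _ _ _ => by positivity)
  have h3 := not_le.1 (Finset.mem_filter.1 hl).2
  rw [← sq_abs (affCorr _ l)]
  calc |affCorr (balanced A) l| ^ 5 =
        |affCorr (balanced A) l| ^ 3 * |affCorr (balanced A) l| ^ 2 := by ring
    _ ≤ _ := by gcongr

theorem natLog_succ_le {N : ℕ} (hN : 2 ≤ N) : ((Nat.log 2 N + 1 : ℕ) : ℝ) ≤ 3 * Real.log N := by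
  have h1 : ((2 ^ Nat.log 2 N : ℕ) : ℝ) ≤ N := by
    exact_mod_cast Nat.pow_log_le_self 2 (by omega)
  have h2 := Real.log_le_log (by positivity) h1
  have hN' : (2 : ℝ) ≤ N := by exact_mod_cast hN
  have h3 := Real.log_le_log two_pos hN'
  push_cast at h2
  rw [Real.log_pow] at h2
  have h4 := Real.log_two_gt_d9
  have h5 : (0 : ℝ) ≤ Nat.log 2 N := Nat.cast_nonneg _
  push_cast
  nlinarith

theorem sum_pow_five_le (A : Finset (ZMod p)) (hN : 2 ≤ A.card) (hNp : A.card < p)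
    {e h q : ℝ} (he : 0 ≤ e) (hh : 0 ≤ h)
    (hq : 0 ≤ q) (he6 : e ^ 6 = addEfun (balanced A)) (hh2 : h ^ 2 = A.card)
    (hq2 : q ^ 2 = mulEbarFun (balanced A)) :
    ∑ l ∈ Finset.univ.filter (fun l : ZMod p × ZMod p => l.1 ≠ 0 ∧ 2 ≤ nPts A A l),
      |affCorr (balanced A) l| ^ 5 ≤
      14200000 * Real.log A.card * (h ^ 11 * e + h ^ 9 * q) := by
  have hN' : (2 : ℝ) ≤ A.card := by exact_mod_cast hN
  have hh1 : 1 ≤ h := le_of_pow_le_pow_left₀ two_ne_zero hh (by linarith)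
  have hlow := sum_pow_five_low_le A hh hh2
  have he2 := one_half_le_of_pow_six_eq A hN hNp he he6
  have hhigh := sum_pow_five_tail_le
    (S := Finset.univ.filter fun l : ZMod p × ZMod p => l.1 ≠ 0 ∧ 2 ≤ nPts A A l)
    (g := fun l => |affCorr (balanced A) l|) (T := A.card) (t := 2 * h)
    (K := 147456 * (h ^ 11 * e + h ^ 9 * q)) (n := Nat.log 2 A.card + 1)
    (fun l hl => abs_affCorr_balanced_le A (Finset.mem_filter.1 hl).2.1) (by linarith)
    (fun s hs => card_mul_pow_five_le A
      (fun l hl => (Finset.mem_filter.1 (Finset.mem_filter.1 hl).1).2.1) (by omega)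
      (by linarith) (by rw [← hh2]; nlinarith)
      (fun l hl => (Finset.mem_filter.1 hl).2) he hh hq he6 hh2 hq2)
    (by
      have h1 : ((A.card : ℕ) : ℝ) < (2 ^ (Nat.log 2 A.card + 1) : ℕ) := by
        exact_mod_cast Nat.lt_pow_succ_log_self one_lt_two _
      push_cast at h1
      refine h1.trans_le (le_mul_of_one_le_right (by positivity) (by linarith)))
  rw [← Finset.sum_filter_add_sum_filter_not _
    (fun l => 2 * h ≤ |affCorr (balanced A) l|)]
  have hlog := natLog_succ_le hN
  have hlog2 : 1 / 2 ≤ Real.log A.card := by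
    have := Real.log_le_log two_pos hN'
    linarith [Real.log_two_gt_d9]
  set X := h ^ 11 * e + h ^ 9 * q with hX
  have h9 : 0 ≤ h ^ 9 * q := by positivity
  have h11 : 0 ≤ h ^ 11 := by positivity
  have hX0 : h ^ 11 ≤ 2 * X := by nlinarith
  have hX1 : 0 ≤ X := by linarith
  have h5 := hhigh.trans (mul_le_mul_of_nonneg_right hlog (by positivity))
  have h6 : X ≤ 2 * Real.log A.card * X := by nlinarith
  nlinarith

theorem balanced_eq_zero_of_card_eq {A : Finset (ZMod p)} (h : A.card = p) : balanced A = 0 := by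
  have hp : (p : ℝ) ≠ 0 := Nat.cast_ne_zero.2 (NeZero.ne p)
  have hA : A = Finset.univ := (Finset.card_eq_iff_eq_univ A).1 (by rw [h, ZMod.card])
  funext x
  simp only [balanced, div_self hp, hA, Finset.mem_univ, if_true, Finset.card_univ, ZMod.card,
    sub_self, Pi.zero_apply]

end Assembly

theorem stmt4 :
    ∃ C D : ℝ, 0 < C ∧ 0 < D ∧ ∀ (p : ℕ) [Fact p.Prime] (A : Finset (ZMod p)),
      ∑ l ∈ Finset.univ.filter (fun l : ZMod p × ZMod p => l.1 ≠ 0 ∧ 2 ≤ nPts A A l),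
          |∑ x, balanced A x * balanced A (l.1 * x + l.2)| ^ 5 ≤
        C * Real.log A.card ^ D *
          (addEfun (balanced A) ^ (1 / 6 : ℝ) * (A.card : ℝ) ^ (11 / 2 : ℝ)
            + mulEbarFun (balanced A) ^ (1 / 2 : ℝ) * (A.card : ℝ) ^ (9 / 2 : ℝ)) := by
  refine ⟨14200000, 1, by norm_num, one_pos, fun p _ A => ?_⟩
  change ∑ l ∈ Finset.univ.filter (fun l : ZMod p × ZMod p => l.1 ≠ 0 ∧ 2 ≤ nPts A A l),
    |affCorr (balanced A) l| ^ 5 ≤ _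
  have hE := addEfun_nonneg (balanced A)
  have hEbar := mulEbarFun_nonneg (balanced A)
  have hN0 : (0 : ℝ) ≤ A.card := Nat.cast_nonneg _
  have hrpow : ∀ {y : ℝ} (n : ℕ), 0 ≤ y → √y ^ n = y ^ ((n : ℝ) / 2) := by
    intro y n hy
    rw [Real.sqrt_eq_rpow, ← Real.rpow_natCast, ← Real.rpow_mul hy]
    congr 1
    ring
  rw [Real.rpow_one]
  rcases Nat.lt_or_ge A.card 2 with hN | hN
  · rw [Finset.filter_false_of_mem fun l _ h => absurd (h.2.trans (nPts_le_card A l)) (by omega),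
      Finset.sum_empty]
    have := Real.log_natCast_nonneg A.card
    positivity
  rcases eq_or_lt_of_le (A.card_le_univ.trans_eq (ZMod.card p)) with hNp | hNp
  · rw [Finset.sum_eq_zero fun l _ => by simp [affCorr, balanced_eq_zero_of_card_eq hNp]]
    have := Real.log_natCast_nonneg A.card
    positivity
  have h := sum_pow_five_le A hN hNp (e := addEfun (balanced A) ^ (1 / 6 : ℝ))
    (h := √(A.card : ℝ)) (q := √(mulEbarFun (balanced A))) (by positivity) (by positivity)
    (by positivity) (by rw [← Real.rpow_natCast, ← Real.rpow_mul hE]; norm_num)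
    (Real.sq_sqrt hN0) (Real.sq_sqrt hEbar)
  rw [hrpow 11 hN0, hrpow 9 hN0, Real.sqrt_eq_rpow (mulEbarFun _)] at h
  push_cast at h
  linarith
end

section
/- Let F = ℝ or F = 𝔽_p, A, B ⊆ F be finite sets, τ ≥ 2 a real number, 𝓛 a set of affine transformations over F, and k ≥ 2 an integer. Then m(𝓛_τ) ≤ τ^{−k} (E⁺ₖ(A) · E⁺ₖ(B))^{1/2}, where 𝓛_τ = {l ∈ 𝓛 : |l ∩ (A×B)| ≥ τ}. -/
open scoped Classical Pointwise

/-- Coincidences between two maps, counted by their common value. -/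
theorem card_coincidence_eq_sum {α β γ : Type*} [DecidableEq γ] (s : Finset α) (t : Finset β)
    (u : α → γ) (v : β → γ) (C : Finset γ) (hC : ∀ x ∈ s, u x ∈ C) :
    ((s ×ˢ t).filter fun q => u q.1 = v q.2).card =
      ∑ c ∈ C, (s.filter fun x => u x = c).card * (t.filter fun y => v y = c).card := by
  rw [Finset.card_eq_sum_card_fiberwise (f := fun q => u q.1) (t := C)]
  · refine Finset.sum_congr rfl fun c _ => ?_
    rw [← Finset.card_product]
    congr 1
    ext q
    simp only [Finset.mem_filter, Finset.mem_product]
    grind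
  · intro q hq
    exact hC _ (Finset.mem_product.1 (Finset.mem_filter.1 (Finset.mem_coe.1 hq)).1).1

/-- Cauchy–Schwarz for the number of coincidences between two maps. -/
theorem card_coincidence_sq_le {α β γ : Type*} [DecidableEq γ] (s : Finset α) (t : Finset β)
    (u : α → γ) (v : β → γ) :
    ((s ×ˢ t).filter fun q => u q.1 = v q.2).card ^ 2 ≤
      ((s ×ˢ s).filter fun q => u q.1 = u q.2).card *
        ((t ×ˢ t).filter fun q => v q.1 = v q.2).card := by
  set C := s.image u ∪ t.image v
  have hs : ∀ x ∈ s, u x ∈ C := fun x hx =>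
    Finset.mem_union_left _ (Finset.mem_image_of_mem u hx)
  have ht : ∀ y ∈ t, v y ∈ C := fun y hy =>
    Finset.mem_union_right _ (Finset.mem_image_of_mem v hy)
  rw [card_coincidence_eq_sum s t u v C hs, card_coincidence_eq_sum s s u u C hs,
    card_coincidence_eq_sum t t v v C ht]
  simp only [← sq]
  exact Finset.sum_mul_sq_le_sq_mul_sq _ _ _

/-- Pairs of `k`-tuples with all coordinates in a fixed fibre of `φ`. -/
theorem card_tuples_fiber {α β γ : Type*} (X : Finset α) (Y : Finset β) (φ : α → β → γ) (b : γ)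
    (k : ℕ) :
    (((Fintype.piFinset fun _ : Fin k => X) ×ˢ Fintype.piFinset fun _ : Fin k => Y).filter
      fun q => ∀ i, φ (q.1 i) (q.2 i) = b).card =
      ((X ×ˢ Y).filter fun q => φ q.1 q.2 = b).card ^ k := by
  have h := Fintype.card_piFinset_const ((X ×ˢ Y).filter fun q => φ q.1 q.2 = b) k
  rw [← h]
  refine Finset.card_bij' (fun q _ i => (q.1 i, q.2 i))
    (fun f _ => (fun i => (f i).1, fun i => (f i).2)) ?_ ?_ ?_ ?_
  · intro q hq
    simp only [Finset.mem_filter, Finset.mem_product, Fintype.mem_piFinset] at hq ⊢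
    exact fun i => ⟨⟨hq.1.1 i, hq.1.2 i⟩, hq.2 i⟩
  · intro f hf
    simp only [Finset.mem_filter, Finset.mem_product, Fintype.mem_piFinset] at hf ⊢
    exact ⟨⟨fun i => (hf i).1.1, fun i => (hf i).1.2⟩, fun i => (hf i).2⟩
  · intro q _
    rfl
  · intro f _
    rfl

/-- The `k`-th additive energy counts pairs of `k`-tuples that are translates of each other. -/
theorem card_translate_tuples {F : Type*} [Field F] (A : Finset F) (n : ℕ) :
    (((Fintype.piFinset fun _ : Fin (n + 1) => A) ×ˢ
        Fintype.piFinset fun _ : Fin (n + 1) => A).filter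
      fun q => (fun i => q.1 i - q.1 0) = fun i => q.2 i - q.2 0).card = addEk F (n + 1) A := by
  rw [Finset.card_eq_sum_card_fiberwise (f := fun q => q.1 0 - q.2 0) (t := A - A), addEk]
  · refine Finset.sum_congr rfl fun x _ => ?_
    rw [repSub, ← card_tuples_fiber A A (fun a b => a - b) x (n + 1), Finset.filter_filter]
    congr 1
    refine Finset.filter_congr fun q _ => ?_
    simp only [funext_iff]
    constructor
    · rintro ⟨h, h0⟩ i
      linear_combination h i + h0
    · intro h
      exact ⟨fun i => by linear_combination h i - h 0, h 0⟩
  · intro q hq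
    simp only [Finset.mem_coe, Finset.mem_filter, Finset.mem_product,
      Fintype.mem_piFinset] at hq
    exact Finset.sub_mem_sub (hq.1.1 0) (hq.1.2 0)

/-- The `k`-th moment of the richness of parallel lines of nonzero slope. -/
theorem sum_nPts_pow_sq_le {F : Type*} [Field F] (A B S : Finset F) {a : F} (ha : a ≠ 0) (n : ℕ) :
    (∑ b ∈ S, nPts A B (a, b) ^ (n + 1)) ^ 2 ≤ addEk F (n + 1) A * addEk F (n + 1) B := by
  have h := card_coincidence_sq_le (Fintype.piFinset fun _ : Fin (n + 1) => A)
    (Fintype.piFinset fun _ : Fin (n + 1) => B)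
    (fun f i => a * (f i - f 0)) (fun g i => g i - g 0)
  have hA : ∀ f g : Fin (n + 1) → F, ((fun i => a * (f i - f 0)) = fun i => a * (g i - g 0)) ↔
      (fun i => f i - f 0) = fun i => g i - g 0 := by
    intro f g
    simp only [funext_iff, mul_right_inj' ha]
  simp only [hA] at h
  rw [card_translate_tuples, card_translate_tuples] at h
  refine le_trans (Nat.pow_le_pow_left ?_ 2) h
  have hb : ∀ b ∈ S, nPts A B (a, b) ^ (n + 1) =
      (((Fintype.piFinset fun _ : Fin (n + 1) => A) ×ˢ
        Fintype.piFinset fun _ : Fin (n + 1) => B).filter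
          fun q => ∀ i, q.2 i - a * q.1 i = b).card := by
    intro b _
    rw [card_tuples_fiber A B (fun x y => y - a * x) b (n + 1), nPts]
    simp only [sub_eq_iff_eq_add']
  rw [Finset.sum_congr rfl hb, ← Finset.card_biUnion]
  · refine Finset.card_le_card fun q hq => ?_
    simp only [Finset.mem_biUnion, Finset.mem_filter] at hq ⊢
    obtain ⟨b, _, hq, h⟩ := hq
    exact ⟨hq, funext fun i => by linear_combination h 0 - h i⟩
  · intro b _ c _ hbc
    refine Finset.disjoint_left.2 fun q hq hq' => hbc ?_
    rw [← (Finset.mem_filter.1 hq).2 0, ← (Finset.mem_filter.1 hq').2 0]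

/-- The number of `τ`-rich lines of a given nonzero slope is controlled by additive energies. -/
theorem card_Lrich_slope_le {F : Type*} [Field F] (A B : Finset F) (L : Finset (F × F)) {τ : ℝ}
    {k : ℕ} (hL : ∀ l ∈ L, l.1 ≠ 0) (hτ : 0 < τ) (hk : k ≠ 0) (a : F) :
    (((Lrich A B L τ).filter fun l => l.1 = a).card : ℝ) ≤
      τ ^ (-(k : ℝ)) * ((addEk F k A : ℝ) * (addEk F k B : ℝ)) ^ (1 / 2 : ℝ) := by
  obtain ⟨n, rfl⟩ := Nat.exists_eq_succ_of_ne_zero hk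
  rw [Nat.succ_eq_add_one, Real.rpow_neg hτ.le, Real.rpow_natCast, ← Real.sqrt_eq_rpow,
    ← div_eq_inv_mul, le_div_iff₀ (pow_pos hτ _)]
  set R := (Lrich A B L τ).filter fun l => l.1 = a with hR
  have hmem : ∀ l ∈ R, l ∈ L ∧ τ ≤ nPts A B l ∧ l.1 = a := by
    intro l hl
    simp only [hR, Lrich, Finset.mem_filter] at hl
    exact ⟨hl.1.1, hl.1.2, hl.2⟩
  rcases R.eq_empty_or_nonempty with h0 | ⟨l₀, hl₀⟩
  · rw [h0, Finset.card_empty, Nat.cast_zero, zero_mul]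
    exact Real.sqrt_nonneg _
  have ha : a ≠ 0 := (hmem l₀ hl₀).2.2 ▸ hL l₀ (hmem l₀ hl₀).1
  have hinj : Set.InjOn Prod.snd (R : Set (F × F)) := fun l hl m hm h =>
    Prod.ext ((hmem l hl).2.2.trans (hmem m hm).2.2.symm) h
  have hsum : (R.card : ℝ) * τ ^ (n + 1) ≤
      ((∑ b ∈ R.image Prod.snd, nPts A B (a, b) ^ (n + 1) : ℕ) : ℝ) := by
    rw [Finset.sum_image hinj, ← nsmul_eq_mul, Nat.cast_sum]
    refine Finset.card_nsmul_le_sum _ _ _ fun l hl => ?_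
    obtain ⟨-, hrich, rfl⟩ := hmem l hl
    rw [Nat.cast_pow]
    exact pow_le_pow_left₀ hτ.le hrich _
  refine hsum.trans (Real.le_sqrt_of_sq_le ?_)
  exact_mod_cast sum_nPts_pow_sq_le A B (R.image Prod.snd) ha n

theorem stmt9 :
    (∀ (A B : Finset ℝ) (L : Finset (ℝ × ℝ)) (τ : ℝ) (k : ℕ),
        (∀ l ∈ L, l.1 ≠ 0) → 2 ≤ τ → 2 ≤ k →
        ∀ a : ℝ, (((Lrich A B L τ).filter fun l => l.1 = a).card : ℝ) ≤
          τ ^ (-(k : ℝ)) * ((addEk ℝ k A : ℝ) * (addEk ℝ k B : ℝ)) ^ (1 / 2 : ℝ)) ∧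
      ∀ (p : ℕ) [Fact p.Prime] (A B : Finset (ZMod p)) (L : Finset (ZMod p × ZMod p))
        (τ : ℝ) (k : ℕ),
        (∀ l ∈ L, l.1 ≠ 0) → 2 ≤ τ → 2 ≤ k →
        ∀ a : ZMod p, (((Lrich A B L τ).filter fun l => l.1 = a).card : ℝ) ≤
          τ ^ (-(k : ℝ)) * ((addEk (ZMod p) k A : ℝ) * (addEk (ZMod p) k B : ℝ)) ^ (1 / 2 : ℝ) := by
  refine ⟨fun A B L τ k hL hτ hk a => ?_, fun p _ A B L τ k hL hτ hk a => ?_⟩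
  · convert card_Lrich_slope_le A B L (k := k) hL (two_pos.trans_le hτ) (by lia) a
  · convert card_Lrich_slope_le A B L (k := k) hL (two_pos.trans_le hτ) (by lia) a
end
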